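/- Let (M, D = ker α∧β, g, R) be a K-Engel structure of rank k on a closed manifold M. Then there exist K-Engel structures (M, D = ker α_i∧β_i, g_i, R_i) of rank 1 for i = 1, ..., k, inducing the same Engel structure D, such that the vector fields R_1, ..., R_k are linearly independent. -/

import Mathlib

noncomputable section

open Manifold Module Function Set

variable {E : Type*} [NormedAddCommGroup E] [NormedSpace ℝ E]
  {H : Type*} [TopologicalSpace H]

/-- The type of (not necessarily smooth) vector fields on a manifold. -/
abbrev VF (I : ModelWithCorners ℝ E H) (M : Type*) [TopologicalSpace M] [ChartedSpace H M] :=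
  ∀ x : M, TangentSpace I x

/-- A vector field is smooth if the corresponding section of the tangent bundle is smooth. -/
def SmoothVF (I : ModelWithCorners ℝ E H) {M : Type*} [TopologicalSpace M] [ChartedSpace H M]
    [IsManifold I (⊤ : ℕ∞) M] (V : VF I M) : Prop :=
  ContMDiff I I.tangent (⊤ : ℕ∞) (fun x => (⟨x, V x⟩ : TangentBundle I M))

/-- A smooth real valued function on a manifold. -/
def SmoothFn (I : ModelWithCorners ℝ E H) {M : Type*} [TopologicalSpace M] [ChartedSpace H M]
    [IsManifold I (⊤ : ℕ∞) M] (f : M → ℝ) : Prop :=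
  ContMDiff I 𝓘(ℝ) (⊤ : ℕ∞) f

/-- Derivative of a real valued function along a vector field. -/
def vderiv (I : ModelWithCorners ℝ E H) {M : Type*} [TopologicalSpace M] [ChartedSpace H M]
    [IsManifold I (⊤ : ℕ∞) M] (V : VF I M) (f : M → ℝ) : M → ℝ :=
  fun x => mfderiv I 𝓘(ℝ) f x (V x)

/-- The Lie bracket of two vector fields on a manifold, defined by transporting the two
vector fields to the model space via the preferred chart at the given point, taking the
Lie bracket of vector fields there, and transporting the result back.  For smooth vector
fields this is the usual Lie bracket `[V, W]`. -/
def vfLie (I : ModelWithCorners ℝ E H) {M : Type*} [TopologicalSpace M] [ChartedSpace H M]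
    [IsManifold I (⊤ : ℕ∞) M] (V W : VF I M) : VF I M := fun x₀ =>
  mfderiv 𝓘(ℝ, E) I (extChartAt I x₀).symm (extChartAt I x₀ x₀)
    ((VectorField.lieBracket ℝ
      (fun e => (mfderiv I 𝓘(ℝ, E) (extChartAt I x₀) ((extChartAt I x₀).symm e)
        (V ((extChartAt I x₀).symm e)) : E))
      (fun e => (mfderiv I 𝓘(ℝ, E) (extChartAt I x₀) ((extChartAt I x₀).symm e)
        (W ((extChartAt I x₀).symm e)) : E))
      (extChartAt I x₀ x₀) : E))

/-- A smooth differential `1`-form on a manifold, given by its pointwise values. -/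
structure OneForm (I : ModelWithCorners ℝ E H) (M : Type*) [TopologicalSpace M]
    [ChartedSpace H M] [IsManifold I (⊤ : ℕ∞) M] where
  val : ∀ x : M, TangentSpace I x →ₗ[ℝ] ℝ
  smooth' : ∀ V : VF I M, SmoothVF I V → SmoothFn I (fun x => val x (V x))

/-- A smooth differential `k`-form on a manifold, given by its pointwise values. -/
structure FormPt (I : ModelWithCorners ℝ E H) (M : Type*) [TopologicalSpace M]
    [ChartedSpace H M] [IsManifold I (⊤ : ℕ∞) M] (k : ℕ) where
  val : ∀ x : M, (TangentSpace I x) [⋀^Fin k]→ₗ[ℝ] ℝ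
  smooth' : ∀ V : Fin k → VF I M, (∀ i, SmoothVF I (V i)) →
    SmoothFn I (fun x => val x (fun i => V i x))

variable {I : ModelWithCorners ℝ E H} {M : Type*} [TopologicalSpace M] [ChartedSpace H M]
  [IsManifold I (⊤ : ℕ∞) M]

/-- The exterior derivative of a (pointwise defined) `1`-form, evaluated on two vector
fields, via the Cartan formula `dω(V,W) = V (ω W) - W (ω V) - ω [V,W]`.  Here the `1`-form
is given as a function on vector fields. -/
def dOfFun (I : ModelWithCorners ℝ E H) {M : Type*} [TopologicalSpace M] [ChartedSpace H M]
    [IsManifold I (⊤ : ℕ∞) M] (lam : VF I M → M → ℝ) (V W : VF I M) : M → ℝ :=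
  fun x => vderiv I V (lam W) x - vderiv I W (lam V) x - lam (vfLie I V W) x

/-- The exterior derivative of a `1`-form, as a function of two vector fields. -/
def OneForm.d (ω : OneForm I M) (V W : VF I M) : M → ℝ :=
  dOfFun I (fun U x => ω.val x (U x)) V W

/-- A distribution (field of tangent subspaces) on a manifold. -/
abbrev TangentDist (I : ModelWithCorners ℝ E H) (M : Type*) [TopologicalSpace M] [ChartedSpace H M] :=
  ∀ x : M, Submodule ℝ (TangentSpace I x)

/-- A (smooth) section of a distribution. -/
def IsSection (I : ModelWithCorners ℝ E H) {M : Type*} [TopologicalSpace M] [ChartedSpace H M]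
    [IsManifold I (⊤ : ℕ∞) M] (D : TangentDist I M) (V : VF I M) : Prop :=
  SmoothVF I V ∧ ∀ x, V x ∈ D x

/-- The distribution `[D, D]` generated by a distribution `D` together with all Lie brackets
of its sections. -/
def derivedDist (I : ModelWithCorners ℝ E H) {M : Type*} [TopologicalSpace M] [ChartedSpace H M]
    [IsManifold I (⊤ : ℕ∞) M] (D : TangentDist I M) : TangentDist I M := fun x =>
  Submodule.span ℝ
    ({v | ∃ V, IsSection I D V ∧ V x = v} ∪
     {v | ∃ V W, IsSection I D V ∧ IsSection I D W ∧ vfLie I V W x = v})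

/-- A distribution is integrable (in the sense of Frobenius: involutive) if Lie brackets of
its sections are again tangent to it. -/
def IsIntegrableDist (I : ModelWithCorners ℝ E H) {M : Type*} [TopologicalSpace M]
    [ChartedSpace H M] [IsManifold I (⊤ : ℕ∞) M] (D : TangentDist I M) : Prop :=
  ∀ V W, IsSection I D V → IsSection I D W → ∀ x, vfLie I V W x ∈ D x

/-- `(ω ∧ θ)(U,V,W)` for a `1`-form `ω` and a `2`-form `θ` given as a function of two
vector fields. -/
def wedge1_2 (I : ModelWithCorners ℝ E H) {M : Type*} [TopologicalSpace M] [ChartedSpace H M]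
    [IsManifold I (⊤ : ℕ∞) M] (ω : OneForm I M) (θ : VF I M → VF I M → M → ℝ)
    (U V W : VF I M) : M → ℝ := fun x =>
  ω.val x (U x) * θ V W x - ω.val x (V x) * θ U W x + ω.val x (W x) * θ U V x

/-- The square `θ ∧ θ` of a `2`-form `θ` (given as a function of two vector fields) vanishes
identically. -/
def FormSqZero (I : ModelWithCorners ℝ E H) {M : Type*} [TopologicalSpace M] [ChartedSpace H M]
    [IsManifold I (⊤ : ℕ∞) M] (θ : VF I M → VF I M → M → ℝ) : Prop :=
  ∀ V₀ V₁ V₂ V₃ : VF I M, SmoothVF I V₀ → SmoothVF I V₁ → SmoothVF I V₂ → SmoothVF I V₃ →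
    ∀ x, θ V₀ V₁ x * θ V₂ V₃ x - θ V₀ V₂ x * θ V₁ V₃ x + θ V₀ V₃ x * θ V₁ V₂ x = 0

/-- An Engel structure: a rank 2 distribution `D` such that `E := [D,D]` has rank 3 and
`[E,E] = TM`. -/
def IsEngel (I : ModelWithCorners ℝ E H) {M : Type*} [TopologicalSpace M] [ChartedSpace H M]
    [IsManifold I (⊤ : ℕ∞) M] (D : TangentDist I M) : Prop :=
  (∀ x, Module.finrank ℝ (D x) = 2) ∧ (∀ x, Module.finrank ℝ (derivedDist I D x) = 3) ∧
  (∀ x, derivedDist I (derivedDist I D) x = ⊤)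

/-- Engel defining forms: `D = ker α ∩ ker β` and `E = [D,D] = ker α`. -/
def EngelDefiningForms (I : ModelWithCorners ℝ E H) {M : Type*} [TopologicalSpace M]
    [ChartedSpace H M] [IsManifold I (⊤ : ℕ∞) M] (D : TangentDist I M)
    (α β : OneForm I M) : Prop :=
  (∀ x, D x = LinearMap.ker (α.val x) ⊓ LinearMap.ker (β.val x)) ∧
  (∀ x, derivedDist I D x = LinearMap.ker (α.val x))

/-- The pair of Reeb vector fields `T`, `R` associated with Engel defining forms `α`, `β`:
`i_T(α ∧ dβ) = 0`, `β(T) = 1`, `α(T) = 0`, `i_R(β ∧ dβ) = 0`, `β(R) = 0`, `α(R) = 1`. -/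
structure IsReebPair (I : ModelWithCorners ℝ E H) {M : Type*} [TopologicalSpace M]
    [ChartedSpace H M] [IsManifold I (⊤ : ℕ∞) M] (α β : OneForm I M)
    (T R : VF I M) : Prop where
  smoothT : SmoothVF I T
  smoothR : SmoothVF I R
  alphaT : ∀ x, α.val x (T x) = 0
  betaT : ∀ x, β.val x (T x) = 1
  alphaR : ∀ x, α.val x (R x) = 1
  betaR : ∀ x, β.val x (R x) = 0
  insT : ∀ V W, SmoothVF I V → SmoothVF I W → ∀ x, wedge1_2 I α β.d T V W x = 0
  insR : ∀ V W, SmoothVF I V → SmoothVF I W → ∀ x, wedge1_2 I β β.d R V W x = 0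

/-- The Reeb distribution spanned by the two Reeb vector fields. -/
def reebDist (I : ModelWithCorners ℝ E H) {M : Type*} [TopologicalSpace M] [ChartedSpace H M]
    (T R : VF I M) : TangentDist I M := fun x => Submodule.span ℝ {T x, R x}

/-- `W` is a nonsingular vector field spanning the characteristic foliation of the even
contact structure `E = [D,D]`:  `W` is tangent to `D` and `[W, E] ⊆ E`. -/
def SpansChar (I : ModelWithCorners ℝ E H) {M : Type*} [TopologicalSpace M] [ChartedSpace H M]
    [IsManifold I (⊤ : ℕ∞) M] (D : TangentDist I M) (W : VF I M) : Prop :=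
  SmoothVF I W ∧ (∀ x, W x ≠ 0) ∧ (∀ x, W x ∈ D x) ∧
  ∀ V, IsSection I (derivedDist I D) V → ∀ x, vfLie I W V x ∈ derivedDist I D x

/-- A Riemannian metric, given by its pointwise values. -/
structure RMetric (I : ModelWithCorners ℝ E H) (M : Type*) [TopologicalSpace M]
    [ChartedSpace H M] [IsManifold I (⊤ : ℕ∞) M] where
  val : ∀ x : M, TangentSpace I x →ₗ[ℝ] TangentSpace I x →ₗ[ℝ] ℝ
  symm : ∀ x u v, val x u v = val x v u
  posdef : ∀ x v, v ≠ 0 → 0 < val x v v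
  smooth' : ∀ V W, SmoothVF I V → SmoothVF I W → SmoothFn I (fun x => val x (V x) (W x))

/-- The Koszul formula: `koszul g X Y Z = g(∇_X Y, Z)` where `∇` is the Levi-Civita
connection of `g`. -/
def koszul (I : ModelWithCorners ℝ E H) {M : Type*} [TopologicalSpace M] [ChartedSpace H M]
    [IsManifold I (⊤ : ℕ∞) M] (g : RMetric I M) (X Y Z : VF I M) : M → ℝ := fun x =>
  (vderiv I X (fun y => g.val y (Y y) (Z y)) x + vderiv I Y (fun y => g.val y (X y) (Z y)) x
    - vderiv I Z (fun y => g.val y (X y) (Y y)) x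
    + g.val x (vfLie I X Y x) (Z x) - g.val x (vfLie I X Z x) (Y x)
    - g.val x (vfLie I Y Z x) (X x)) / 2

/-- A distribution `D` is totally geodesic for `g` iff every geodesic tangent to it at one
point stays tangent to it; equivalently (the standard characterization, which we take as the
definition) `∇_U U` is tangent to `D` for every section `U` of `D`, i.e. `g(∇_U U, V) = 0`
for every vector field `V` orthogonal to `D`. -/
def IsTotallyGeodesic (I : ModelWithCorners ℝ E H) {M : Type*} [TopologicalSpace M]
    [ChartedSpace H M] [IsManifold I (⊤ : ℕ∞) M] (g : RMetric I M)
    (D : TangentDist I M) : Prop :=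
  ∀ U, IsSection I D U → ∀ V, SmoothVF I V → (∀ x, ∀ u ∈ D x, g.val x (V x) u = 0) →
    ∀ x, koszul I g U U V x = 0

/-- A Killing vector field: `L_Z g = 0`, expressed on vector fields. -/
def IsKilling (I : ModelWithCorners ℝ E H) {M : Type*} [TopologicalSpace M] [ChartedSpace H M]
    [IsManifold I (⊤ : ℕ∞) M] (g : RMetric I M) (Z : VF I M) : Prop :=
  ∀ V W, SmoothVF I V → SmoothVF I W → ∀ x,
    vderiv I Z (fun y => g.val y (V y) (W y)) x
      = g.val x (vfLie I Z V x) (W x) + g.val x (V x) (vfLie I Z W x)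

/-- An Engel vector field: the flow of `Z` preserves `D`, i.e. `L_Z D ⊆ D`. -/
def IsEngelVF (I : ModelWithCorners ℝ E H) {M : Type*} [TopologicalSpace M] [ChartedSpace H M]
    [IsManifold I (⊤ : ℕ∞) M] (D : TangentDist I M) (Z : VF I M) : Prop :=
  SmoothVF I Z ∧ ∀ V, IsSection I D V → ∀ x, vfLie I Z V x ∈ D x

/-- A K-Engel structure: `D` is an Engel structure, `g` a Riemannian metric and `Z` a
(nowhere vanishing) vector field which is Engel, Killing and orthogonal to `E = [D,D]`. -/
structure IsKEngel (I : ModelWithCorners ℝ E H) {M : Type*} [TopologicalSpace M]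
    [ChartedSpace H M] [IsManifold I (⊤ : ℕ∞) M] (D : TangentDist I M)
    (g : RMetric I M) (Z : VF I M) : Prop where
  engel : IsEngel I D
  engelVF : IsEngelVF I D Z
  killing : IsKilling I g Z
  orth : ∀ x, ∀ v ∈ derivedDist I D x, g.val x (Z x) v = 0
  nonzero : ∀ x, Z x ≠ 0

/-- A `1`-form is closed. -/
def OneForm.IsClosed {I : ModelWithCorners ℝ E H} {M : Type*} [TopologicalSpace M]
    [ChartedSpace H M] [IsManifold I (⊤ : ℕ∞) M] (ω : OneForm I M) : Prop :=
  ∀ V W, SmoothVF I V → SmoothVF I W → ∀ x, ω.d V W x = 0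

/-- The Lie derivative `(L_Z ω)(V) = Z (ω V) - ω [Z,V]` of a `1`-form along a vector
field, as a function of vector fields. -/
def lieOneForm (I : ModelWithCorners ℝ E H) {M : Type*} [TopologicalSpace M] [ChartedSpace H M]
    [IsManifold I (⊤ : ℕ∞) M] (ω : OneForm I M) (Z V : VF I M) : M → ℝ := fun x =>
  vderiv I Z (fun y => ω.val y (V y)) x - ω.val x (vfLie I Z V x)

/-- The exterior derivative of a pointwise-defined `(m+1)`-form evaluated on `m+2` vector
fields, via the global Koszul formula. -/
def extDerEval (I : ModelWithCorners ℝ E H) {M : Type*} [TopologicalSpace M] [ChartedSpace H M]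
    [IsManifold I (⊤ : ℕ∞) M] {m : ℕ} (ν : FormPt I M (m+1)) (V : Fin (m+2) → VF I M) :
    M → ℝ := fun x =>
  (∑ i : Fin (m+2), (-1 : ℝ)^(i : ℕ) *
    vderiv I (V i) (fun y => ν.val y (fun l => V (i.succAbove l) y)) x)
  + ∑ i : Fin (m+2), ∑ j : Fin (m+2), if h : (i : ℕ) < (j : ℕ) then
      (-1 : ℝ)^((i : ℕ)+(j : ℕ)) * ν.val x (Fin.cons (vfLie I (V i) (V j) x)
        (fun l => V (j.succAbove ((⟨(i : ℕ), by have := j.2; omega⟩ : Fin (m+1)).succAbove l)) x))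
    else 0

/-- A pointwise-defined form is closed. -/
def FormPt.IsClosedForm {I : ModelWithCorners ℝ E H} {M : Type*} [TopologicalSpace M]
    [ChartedSpace H M] [IsManifold I (⊤ : ℕ∞) M] {m : ℕ} (ν : FormPt I M (m+1)) : Prop :=
  ∀ V : Fin (m+2) → VF I M, (∀ i, SmoothVF I (V i)) → ∀ x, extDerEval I ν V x = 0

/-- `φ : ℝ → M → M` is the flow of the vector field `Z`. -/
def IsFlowOf (I : ModelWithCorners ℝ E H) {M : Type*} [TopologicalSpace M] [ChartedSpace H M]
    [IsManifold I (⊤ : ℕ∞) M] (Z : VF I M) (φ : ℝ → M → M) : Prop :=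
  Continuous (fun p : ℝ × M => φ p.1 p.2) ∧ (∀ x, φ 0 x = x) ∧
  (∀ s t x, φ (s + t) x = φ s (φ t x)) ∧
  ∀ x t, HasMFDerivAt 𝓘(ℝ) I (fun s => φ s x) t
    ((1 : ℝ →L[ℝ] ℝ).smulRight (Z (φ t x)))

/-- `(η ∧ dη ∧ dη)(V₀,...,V₄)` up to a positive constant factor, for a pointwise `1`-form
`η`; pointwise nonvanishing of this expression on frames is the contact condition in
dimension 5. -/
def contactEval (I : ModelWithCorners ℝ E H) {M : Type*} [TopologicalSpace M] [ChartedSpace H M]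
    [IsManifold I (⊤ : ℕ∞) M] (η : ∀ z : M, TangentSpace I z →ₗ[ℝ] ℝ)
    (V : Fin 5 → VF I M) : M → ℝ := fun z =>
  ∑ σ : Equiv.Perm (Fin 5), ((Equiv.Perm.sign σ : ℤ) : ℝ) *
    (η z (V (σ 0) z) * dOfFun I (fun U x => η x (U x)) (V (σ 1)) (V (σ 2)) z *
      dOfFun I (fun U x => η x (U x)) (V (σ 3)) (V (σ 4)) z)

/-- The `k`-dimensional torus, as a compact abelian topological group. -/
abbrev Torus (k : ℕ) := Fin k → Circle

/-- The structure of a principal `T^k`-bundle over an `n`-dimensional manifold on a space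
`M`: a free continuous `T^k`-action together with an orbit projection onto a base manifold
admitting equivariant local trivializations. -/
structure PrincipalTorusBundle (k n : ℕ) (M : Type*) [TopologicalSpace M] where
  /-- the torus action -/
  act : Torus k → M → M
  continuous_act : Continuous fun p : Torus k × M => act p.1 p.2
  act_one : ∀ x, act 1 x = x
  act_mul : ∀ a b x, act (a * b) x = act a (act b x)
  /-- the action is free -/
  free : ∀ a x, act a x = x → a = 1
  /-- the base -/
  B : Type
  [tB : TopologicalSpace B]
  [cB : ChartedSpace (EuclideanSpace ℝ (Fin n)) B]
  [sB : IsManifold (𝓡 n) (⊤ : ℕ∞) B]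
  /-- the bundle projection -/
  proj : M → B
  continuous_proj : Continuous proj
  surj_proj : Function.Surjective proj
  /-- the fibres of the projection are the orbits -/
  fiber_orbit : ∀ x y, proj x = proj y ↔ ∃ a, act a x = y
  /-- equivariant local trivializations -/
  loc_triv : ∀ b : B, ∃ e : Bundle.Trivialization (Torus k) proj, b ∈ e.baseSet ∧
    ∀ a z, z ∈ e.source → act a z ∈ e.source ∧ (e (act a z)).2 = a * (e z).2

section NearIsometry

open Filter Topology

variable {V : Type*} [NormedAddCommGroup V] [NormedSpace ℝ V]

/-- Telescoping a quantitative doubling estimate: a map whose defect `F v - 2 F (v / 2)` is cubic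
differs from its derivative at the origin by a cubic error. -/
lemma norm_sub_fderiv_le_of_doubling {F : V → V} {L : V →L[ℝ] V} {K r : ℝ}
    (h0 : F 0 = 0) (hL : HasFDerivAt F L 0)
    (hF : ∀ v, ‖v‖ ≤ r → ‖F v - (2 : ℝ) • F ((2 : ℝ)⁻¹ • v)‖ ≤ K * ‖v‖ ^ 3)
    {v : V} (hv : ‖v‖ ≤ r) : ‖F v - L v‖ ≤ 4 / 3 * K * ‖v‖ ^ 3 := by
  have hK : 0 ≤ K * ‖v‖ ^ 3 := (norm_nonneg _).trans (hF v hv)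
  have key : ∀ n : ℕ, ‖F v - (2 : ℝ) ^ n • F (((2 : ℝ) ^ n)⁻¹ • v)‖
      ≤ 4 / 3 * (K * ‖v‖ ^ 3) * (1 - (1 / 4) ^ n) := by
    intro n
    induction n with
    | zero => simp
    | succ n ih =>
      have hn : ‖((2 : ℝ) ^ n)⁻¹ • v‖ = ((2 : ℝ) ^ n)⁻¹ * ‖v‖ := by
        rw [norm_smul, norm_inv, norm_pow, Real.norm_ofNat]
      have hle : ((2 : ℝ) ^ n)⁻¹ ≤ 1 := inv_le_one_of_one_le₀ (one_le_pow₀ (by norm_num))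
      have h1 := hF (((2 : ℝ) ^ n)⁻¹ • v) (by
        rw [hn]
        exact (mul_le_of_le_one_left (norm_nonneg _) hle).trans hv)
      rw [hn, smul_smul] at h1
      have h2 : F v - (2 : ℝ) ^ (n + 1) • F (((2 : ℝ) ^ (n + 1))⁻¹ • v)
          = (F v - (2 : ℝ) ^ n • F (((2 : ℝ) ^ n)⁻¹ • v)) + (2 : ℝ) ^ n •
            (F (((2 : ℝ) ^ n)⁻¹ • v) - (2 : ℝ) • F (((2 : ℝ)⁻¹ * ((2 : ℝ) ^ n)⁻¹) • v)) := by
        rw [smul_sub, smul_smul, pow_succ, mul_inv, mul_comm ((2 : ℝ) ^ n)⁻¹]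
        abel
      rw [h2]
      refine (norm_add_le _ _).trans ?_
      rw [norm_smul, norm_pow, Real.norm_ofNat]
      have h3 : (2 : ℝ) ^ n * (K * (((2 : ℝ) ^ n)⁻¹ * ‖v‖) ^ 3)
          = K * ‖v‖ ^ 3 * (1 / 4) ^ n := by
        have h4 : (4 : ℝ) ^ n = 2 ^ n * 2 ^ n := by rw [← mul_pow]; norm_num
        rw [one_div, inv_pow, h4]
        field_simp
      have h5 := mul_le_mul_of_nonneg_left h1 (by positivity : (0 : ℝ) ≤ 2 ^ n)
      rw [h3] at h5
      calc _ ≤ _ := add_le_add ih h5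
        _ = _ := by rw [pow_succ]; ring
  have hlim : Tendsto (fun n : ℕ => (2 : ℝ) ^ n • F (((2 : ℝ) ^ n)⁻¹ • v)) atTop (𝓝 (L v)) := by
    have := hL.lim v (c := fun n : ℕ => (2 : ℝ) ^ n) (l := atTop)
      (by simpa using tendsto_pow_atTop_atTop_of_one_lt (one_lt_two : (1 : ℝ) < 2))
    simpa [h0] using this
  refine le_of_tendsto ((tendsto_const_nhds.sub hlim).norm) (Eventually.of_forall fun n => ?_)
  refine (key n).trans ?_
  have : (0 : ℝ) ≤ (1 / 4) ^ n := by positivity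
  nlinarith

/-- A map between quadratic spaces which preserves the quadratic forms up to a fourth order
error and is almost onto agrees with its derivative at the origin up to a cubic error, uniformly. -/
lemma exists_norm_sub_fderiv_le {m C r₀ : ℝ} (hm : 0 < m) (hC : 1 ≤ C) (hr₀ : 0 < r₀) :
    ∃ K r₁ : ℝ, 0 < r₁ ∧ ∀ (bp bq : V →L[ℝ] V →L[ℝ] ℝ) (F : V → V) (L : V →L[ℝ] V),
      (∀ u v, bp u v = bp v u) → (∀ u v, bq u v = bq v u) → (∀ v, m * ‖v‖ ^ 2 ≤ bq v v) →
      ‖bq‖ ≤ C → F 0 = 0 → HasFDerivAt F L 0 →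
      (∀ v w r, ‖v‖ ≤ r → ‖w‖ ≤ r → r ≤ r₀ →
        |bq (F v - F w) (F v - F w) - bp (v - w) (v - w)| ≤ C * r ^ 4) →
      (∀ w', ‖w'‖ ≤ r₀ → ∃ w, ‖w‖ ≤ C * ‖w'‖ ∧ ‖F w - w'‖ ≤ C * ‖w'‖ ^ 3) →
      ∀ v, ‖v‖ ≤ r₁ → ‖F v - L v‖ ≤ K * ‖v‖ ^ 3 := by
  have hC0 : 0 < C := by linarith
  refine ⟨4 / 3 * (10 * C ^ 5 / m), min (r₀ / C) (m / (2 * C ^ 2 + m)), by positivity, ?_⟩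
  intro bp bq F L hbp hbq hbqm hbqC h0 hL hF hsurj v hv
  refine norm_sub_fderiv_le_of_doubling h0 hL (fun v hv => ?_) hv
  have hvr : C * ‖v‖ ≤ r₀ := by
    have := hv.trans (min_le_left _ _)
    rwa [le_div_iff₀ hC0, mul_comm] at this
  have hvm : ‖v‖ ≤ m / (2 * C ^ 2 + m) := hv.trans (min_le_right _ _)
  have hv1 : ‖v‖ ≤ 1 := hvm.trans (by rw [div_le_one (by positivity)]; nlinarith [sq_nonneg C])
  have hvC : C ^ 2 * ‖v‖ ^ 2 ≤ m / 2 := by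
    rw [le_div_iff₀ (by positivity)] at hvm
    nlinarith [norm_nonneg v, sq_nonneg C, mul_nonneg (norm_nonneg v) (sq_nonneg C)]
  have polar : ∀ v w r, ‖v‖ ≤ r → ‖w‖ ≤ r → r ≤ r₀ →
      |bq (F v) (F w) - bp v w| ≤ 3 / 2 * (C * r ^ 4) := by
    intro v w r h1 h2 h3
    have hr : 0 ≤ r := (norm_nonneg _).trans h1
    have e1 := hF v w r h1 h2 h3
    have e2 := hF v 0 r h1 (by simpa using hr) h3
    have e3 := hF w 0 r h2 (by simpa using hr) h3
    simp only [h0, sub_zero] at e2 e3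
    simp only [map_sub, sub_apply, hbq (F w) (F v), hbp w v] at e1
    rw [abs_le] at *
    constructor <;> linarith [e1.1, e1.2, e2.1, e2.2, e3.1, e3.2]
  set u := F v - (2 : ℝ) • F ((2 : ℝ)⁻¹ • v) with hu
  rcases eq_or_ne u 0 with hu0 | hu0
  · rw [hu0, norm_zero]; positivity
  rcases eq_or_ne v 0 with hv0 | hv0
  · exact absurd (by rw [hu, hv0]; simp [h0]) hu0
  have hun : 0 < ‖u‖ := norm_pos_iff.2 hu0
  have hvn : 0 < ‖v‖ := norm_pos_iff.2 hv0
  set w' := (‖v‖ / ‖u‖) • u with hw'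
  have hw'n : ‖w'‖ = ‖v‖ := by
    rw [hw', norm_smul, norm_div, norm_norm, norm_norm]; field_simp
  obtain ⟨w, hw1, hw2⟩ := hsurj w' (by rw [hw'n]; nlinarith)
  rw [hw'n] at hw1 hw2
  have hvC' : ‖v‖ ≤ C * ‖v‖ := by nlinarith
  have p1 := polar v w (C * ‖v‖) hvC' hw1 hvr
  have p2 := polar ((2 : ℝ)⁻¹ • v) w (C * ‖v‖) (by
    rw [norm_smul, norm_inv, Real.norm_ofNat]; linarith) hw1 hvr
  have hb : |bq u (F w)| ≤ 5 * (C * (C * ‖v‖) ^ 4) := by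
    have : bq u (F w) = (bq (F v) (F w) - bp v w)
        - 2 * (bq (F ((2 : ℝ)⁻¹ • v)) (F w) - bp ((2 : ℝ)⁻¹ • v) w) := by
      simp only [hu, map_sub, map_smul, sub_apply, FunLike.coe_smul, Pi.smul_apply, smul_eq_mul]; ring
    have hp : 0 ≤ C * (C * ‖v‖) ^ 4 := by positivity
    rw [this]
    rw [abs_le] at *
    constructor <;> linarith [p1.1, p1.2, p2.1, p2.2]
  have hd : |bq u (F w - w')| ≤ C * ‖u‖ * (C * ‖v‖ ^ 3) := by
    calc |bq u (F w - w')| ≤ ‖bq‖ * ‖u‖ * ‖F w - w'‖ := bq.le_opNorm₂ _ _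
      _ ≤ _ := by gcongr
  have hlow : m * ‖v‖ * ‖u‖ ≤ bq u w' := by
    rw [hw', map_smul, smul_eq_mul]
    calc m * ‖v‖ * ‖u‖ = ‖v‖ / ‖u‖ * (m * ‖u‖ ^ 2) := by field_simp
      _ ≤ _ := by gcongr; exact hbqm u
  rw [map_sub] at hd
  have hfin : m * ‖v‖ * ‖u‖ ≤ 5 * (C * (C * ‖v‖) ^ 4) + C * ‖u‖ * (C * ‖v‖ ^ 3) := by
    rw [abs_le] at hb hd
    linarith [hb.2, hd.1]
  have h1 : C * ‖u‖ * (C * ‖v‖ ^ 3) ≤ m / 2 * (‖u‖ * ‖v‖) := by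
    calc _ = C ^ 2 * ‖v‖ ^ 2 * (‖u‖ * ‖v‖) := by ring
      _ ≤ _ := by gcongr
  have h2 : (m / 2 * ‖u‖) * ‖v‖ ≤ (5 * C ^ 5 * ‖v‖ ^ 3) * ‖v‖ := by
    calc _ = m * ‖v‖ * ‖u‖ - m / 2 * (‖u‖ * ‖v‖) := by ring
      _ ≤ 5 * (C * (C * ‖v‖) ^ 4) := by linarith
      _ = _ := by ring
  have h3 := le_of_mul_le_mul_right h2 hvn
  calc ‖u‖ = (m / 2 * ‖u‖) * (2 / m) := by field_simp
    _ ≤ (5 * C ^ 5 * ‖v‖ ^ 3) * (2 / m) := by gcongr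
    _ = _ := by ring

end NearIsometry

section MetricComparison

open Filter Topology

variable {V : Type*} [NormedAddCommGroup V] [NormedSpace ℝ V]

/-- Uniform bounds, on a set `B`, for a field `G` of inner products together with a symmetric
field `Γ` of Christoffel symbols: `Γ` accounts for the first order variation of `G`. -/
structure MetricBounds (G : V → V →L[ℝ] V →L[ℝ] ℝ) (Γ : V → V →L[ℝ] V →L[ℝ] V)
    (B : Set V) (m C : ℝ) : Prop where
  m_pos : 0 < m
  one_le : 1 ≤ C
  symm : ∀ x ∈ B, ∀ u v, G x u v = G x v u
  lower : ∀ x ∈ B, ∀ v, m * ‖v‖ ^ 2 ≤ G x v v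
  upper : ∀ x ∈ B, ‖G x‖ ≤ C
  gamma_symm : ∀ x ∈ B, ∀ u v, Γ x u v = Γ x v u
  gamma_upper : ∀ x ∈ B, ‖Γ x‖ ≤ C
  taylor : ∀ x ∈ B, ∀ h, x + h ∈ B → ∀ u,
    |G (x + h) u u - G x u u - 2 * G x (Γ x h u) u| ≤ C * ‖h‖ ^ 2 * ‖u‖ ^ 2

/-- Quadratic approximation of a normal chart at `p`. -/
def quadChart (Γ : V → V →L[ℝ] V →L[ℝ] V) (p y : V) : V :=
  (y - p) + (2 : ℝ)⁻¹ • Γ p (y - p) (y - p)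

/-- Quadratic approximation of the exponential map at `p`. -/
def quadExp (Γ : V → V →L[ℝ] V →L[ℝ] V) (p v : V) : V :=
  p + (v - (2 : ℝ)⁻¹ • Γ p v v)

namespace MetricBounds

variable {G : V → V →L[ℝ] V →L[ℝ] ℝ} {Γ : V → V →L[ℝ] V →L[ℝ] V} {B : Set V} {m C : ℝ}
  (hb : MetricBounds G Γ B m C)

include hb

lemma C_pos : 0 < C := by linarith [hb.one_le]

lemma abs_le {x : V} (hx : x ∈ B) (u v : V) : |G x u v| ≤ C * ‖u‖ * ‖v‖ :=
  ((G x).le_opNorm₂ u v).trans (by gcongr; exact hb.upper x hx)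

lemma gamma_le {x : V} (hx : x ∈ B) (u v : V) : ‖Γ x u v‖ ≤ C * ‖u‖ * ‖v‖ :=
  ((Γ x).le_opNorm₂ u v).trans (by gcongr; exact hb.gamma_upper x hx)

lemma nonneg {x : V} (hx : x ∈ B) (u : V) : 0 ≤ G x u u :=
  (mul_nonneg hb.m_pos.le (sq_nonneg _)).trans (hb.lower x hx u)

lemma apply_chart_le {p h : V} (hp : p ∈ B) (hph : p + h ∈ B) (u : V) :
    G p (u + Γ p h u) (u + Γ p h u) ≤ G (p + h) u u + 2 * C ^ 3 * ‖h‖ ^ 2 * ‖u‖ ^ 2 := by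
  have h1 := hb.taylor p hp h hph u
  have h2 := hb.abs_le hp (Γ p h u) (Γ p h u)
  have h3 := hb.gamma_le hp h u
  have hC := hb.C_pos
  have h4 : C * ‖Γ p h u‖ * ‖Γ p h u‖ ≤ C * (C * ‖h‖ * ‖u‖) * (C * ‖h‖ * ‖u‖) := by gcongr
  have h5 : C * ‖h‖ ^ 2 * ‖u‖ ^ 2 ≤ C ^ 3 * ‖h‖ ^ 2 * ‖u‖ ^ 2 := by
    gcongr; exact le_self_pow₀ hb.one_le (by norm_num)
  simp only [map_add, add_apply, hb.symm p hp u (Γ p h u)]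
  rw [_root_.abs_le] at h1 h2
  nlinarith [h1.1, h2.2]

lemma norm_sub_gamma_le {p ξ : V} (hp : p ∈ B) (hξ : C * ‖ξ‖ ≤ 1) (e : V) :
    ‖e - Γ p ξ e‖ ≤ 2 * ‖e‖ := by
  have h1 := hb.gamma_le hp ξ e
  have h2 : C * ‖ξ‖ * ‖e‖ ≤ 1 * ‖e‖ := by gcongr
  linarith [norm_sub_le e (Γ p ξ e)]

lemma norm_quadExp_sub_le {p ξ : V} (hp : p ∈ B) (hξ : C * ‖ξ‖ ≤ 1) :
    ‖ξ - (2 : ℝ)⁻¹ • Γ p ξ ξ‖ ≤ 2 * ‖ξ‖ := by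
  have h1 := hb.gamma_le hp ξ ξ
  have h2 : C * ‖ξ‖ * ‖ξ‖ ≤ 1 * ‖ξ‖ := by gcongr
  have h3 := norm_sub_le ξ ((2 : ℝ)⁻¹ • Γ p ξ ξ)
  rw [norm_smul, norm_inv, Real.norm_ofNat] at h3
  linarith [norm_nonneg ξ]

lemma apply_exp_le {p ξ : V} (hp : p ∈ B) (hξ : C * ‖ξ‖ ≤ 1) (hpξ : quadExp Γ p ξ ∈ B) (e : V) :
    G (quadExp Γ p ξ) (e - Γ p ξ e) (e - Γ p ξ e)
      ≤ G p e e + 27 * C ^ 3 * ‖ξ‖ ^ 2 * ‖e‖ ^ 2 := by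
  have hC := hb.C_pos
  set h := ξ - (2 : ℝ)⁻¹ • Γ p ξ ξ with hh
  set e' := e - Γ p ξ e with he'
  have hhn : ‖h‖ ≤ 2 * ‖ξ‖ := hb.norm_quadExp_sub_le hp hξ
  have he'n : ‖e'‖ ≤ 2 * ‖e‖ := hb.norm_sub_gamma_le hp hξ e
  have h1 := hb.taylor p hp h hpξ e'
  have hg : ‖Γ p ξ e‖ ≤ C * ‖ξ‖ * ‖e‖ := hb.gamma_le hp ξ e
  have h2 : G p e' e' = G p e e - 2 * G p (Γ p ξ e) e + G p (Γ p ξ e) (Γ p ξ e) := by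
    simp only [he', map_sub, sub_apply, hb.symm p hp e (Γ p ξ e)]; ring
  have hdiff : ‖Γ p h e' - Γ p ξ e‖ ≤ 2 * C ^ 2 * ‖ξ‖ ^ 2 * ‖e‖ := by
    have : Γ p h e' - Γ p ξ e
        = -(Γ p ((2 : ℝ)⁻¹ • Γ p ξ ξ) e' + Γ p ξ (Γ p ξ e)) := by
      simp only [hh, he', map_sub, sub_apply]; abel
    rw [this, norm_neg]
    refine (norm_add_le _ _).trans ?_
    have k1 : ‖(2 : ℝ)⁻¹ • Γ p ξ ξ‖ ≤ 2⁻¹ * (C * ‖ξ‖ * ‖ξ‖) := by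
      rw [norm_smul, norm_inv, Real.norm_ofNat]
      gcongr; exact hb.gamma_le hp ξ ξ
    have k2 := hb.gamma_le hp ((2 : ℝ)⁻¹ • Γ p ξ ξ) e'
    have k3 := hb.gamma_le hp ξ (Γ p ξ e)
    have k4 : C * ‖(2 : ℝ)⁻¹ • Γ p ξ ξ‖ * ‖e'‖ ≤ C * (2⁻¹ * (C * ‖ξ‖ * ‖ξ‖)) * (2 * ‖e‖) := by
      gcongr
    have k5 : C * ‖ξ‖ * ‖Γ p ξ e‖ ≤ C * ‖ξ‖ * (C * ‖ξ‖ * ‖e‖) := by gcongr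
    nlinarith
  have h3 : G p (Γ p h e') e' - G p (Γ p ξ e) e
      = G p (Γ p h e' - Γ p ξ e) e' - G p (Γ p ξ e) (Γ p ξ e) := by
    simp only [he', map_sub, sub_apply]; ring
  have h4 : |G p (Γ p h e' - Γ p ξ e) e'| ≤ C * (2 * C ^ 2 * ‖ξ‖ ^ 2 * ‖e‖) * (2 * ‖e‖) :=
    (hb.abs_le hp _ _).trans (by gcongr)
  have h5 : 0 ≤ G p (Γ p ξ e) (Γ p ξ e) := hb.nonneg hp _
  have h6 : C * ‖h‖ ^ 2 * ‖e'‖ ^ 2 ≤ C * (2 * ‖ξ‖) ^ 2 * (2 * ‖e‖) ^ 2 := by gcongr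
  have h7 : C * ‖ξ‖ ^ 2 * ‖e‖ ^ 2 ≤ C ^ 3 * ‖ξ‖ ^ 2 * ‖e‖ ^ 2 := by
    gcongr; exact le_self_pow₀ hb.one_le (by norm_num)
  have h8 : 0 ≤ C ^ 3 * ‖ξ‖ ^ 2 * ‖e‖ ^ 2 := by positivity
  change G (p + h) e' e' ≤ _
  rw [_root_.abs_le] at h1 h4
  nlinarith [h1.2, h4.2]

/-- The Cauchy-Schwarz inequality. -/
lemma cauchy_schwarz {x : V} (hx : x ∈ B) (u v : V) : G x u v ^ 2 ≤ G x u u * G x v v := by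
  have h : ∀ t : ℝ, 0 ≤ G x v v * (t * t) + (2 * G x u v) * t + G x u u := by
    intro t
    have := hb.nonneg hx (u + t • v)
    simp only [map_add, map_smul, add_apply, FunLike.coe_smul, Pi.smul_apply, smul_eq_mul,
      hb.symm x hx v u] at this
    linarith
  have := discrim_le_zero h
  rw [discrim] at this
  linarith

end MetricBounds

lemma hasDerivAt_quadExp {Γ : V → V →L[ℝ] V →L[ℝ] V} {p : V}
    (hΓ : ∀ u v, Γ p u v = Γ p v u) (v e : V) (t : ℝ) :
    HasDerivAt (fun t : ℝ => quadExp Γ p (v + t • e)) (e - Γ p (v + t • e) e) t := by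
  have h1 : HasDerivAt (fun t : ℝ => v + t • e) e t := by
    simpa using ((hasDerivAt_id t).smul_const e).const_add v
  have h2 : HasDerivAt (fun t : ℝ => Γ p (v + t • e) (v + t • e))
      (Γ p e (v + t • e) + Γ p (v + t • e) e) t :=
    ((Γ p).hasFDerivAt.comp_hasDerivAt t h1).clm_apply h1
  have h3 := (h1.sub (h2.const_smul (2 : ℝ)⁻¹)).const_add p
  refine h3.congr_deriv ?_
  rw [hΓ e, ← two_smul ℝ, smul_smul]
  norm_num

lemma hasFDerivAt_quadChart_comp {Γ : V → V →L[ℝ] V →L[ℝ] V} {q : V}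
    (hΓ : ∀ u v, Γ q u v = Γ q v u) {c : ℝ → V} {c' : V} {t : ℝ} (hc : HasDerivAt c c' t) :
    HasDerivAt (fun t => quadChart Γ q (c t)) (c' + Γ q (c t - q) c') t := by
  have h1 := hc.sub_const q
  have h2 : HasDerivAt (fun t : ℝ => Γ q (c t - q) (c t - q))
      (Γ q c' (c t - q) + Γ q (c t - q) c') t :=
    ((Γ q).hasFDerivAt.comp_hasDerivAt t h1).clm_apply h1
  have h3 := h1.add (h2.const_smul (2 : ℝ)⁻¹)
  refine h3.congr_deriv ?_
  rw [hΓ c', ← two_smul ℝ, smul_smul]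
  norm_num

/-- `f` is a differentiable local isometry of `G` near `p`, with derivative field `L`. -/
structure IsIsomAt (G : V → V →L[ℝ] V →L[ℝ] ℝ) (B : Set V) (d : ℝ)
    (p : V) (f : V → V) (L : V → V →L[ℝ] V) : Prop where
  ball_subset : Metric.ball p d ⊆ B
  ball_subset' : Metric.ball (f p) d ⊆ B
  maps : ∀ x ∈ Metric.ball p d, f x ∈ B
  hasFDerivAt : ∀ x ∈ Metric.ball p d, HasFDerivAt f (L x) x
  isom : ∀ x ∈ Metric.ball p d, ∀ u v, G (f x) (L x u) (L x v) = G x u v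

namespace IsIsomAt

variable {G : V → V →L[ℝ] V →L[ℝ] ℝ} {Γ : V → V →L[ℝ] V →L[ℝ] V} {B : Set V} {m C d : ℝ}
  {p : V} {f : V → V} {L : V → V →L[ℝ] V}

lemma norm_le (hb : MetricBounds G Γ B m C) (hf : IsIsomAt G B d p f L) {x : V}
    (hx : x ∈ Metric.ball p d) : ‖L x‖ ≤ √(C / m) := by
  have hm := hb.m_pos
  have hC := hb.C_pos
  refine (L x).opNorm_le_bound (by positivity) fun v => ?_
  have h1 := hb.lower (f x) (hf.maps x hx) (L x v)
  rw [hf.isom x hx] at h1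
  have h2 := (le_abs_self _).trans (hb.abs_le (hf.ball_subset hx) v v)
  have h3 : ‖L x v‖ ^ 2 ≤ C / m * ‖v‖ ^ 2 := by
    rw [div_mul_eq_mul_div, le_div_iff₀ hm]; nlinarith
  calc ‖L x v‖ ≤ √(C / m * ‖v‖ ^ 2) := Real.le_sqrt_of_sq_le h3
    _ = _ := by rw [Real.sqrt_mul (by positivity), Real.sqrt_sq (norm_nonneg v)]

lemma norm_sub_le (hb : MetricBounds G Γ B m C) (hf : IsIsomAt G B d p f L) {x y : V}
    (hx : x ∈ Metric.ball p d) (hy : y ∈ Metric.ball p d) :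
    ‖f y - f x‖ ≤ √(C / m) * ‖y - x‖ :=
  (convex_ball p d).norm_image_sub_le_of_norm_hasFDerivWithin_le
    (fun z hz => (hf.hasFDerivAt z hz).hasFDerivWithinAt) (fun _ hz => hf.norm_le hb hz) hx hy

end IsIsomAt

end MetricComparison

section IsometryTaylor

open Filter Topology

variable {V : Type*} [NormedAddCommGroup V] [NormedSpace ℝ V]

lemma norm_bilin_diag_sub_le (A : V →L[ℝ] V →L[ℝ] V) {C : ℝ} (hA : ‖A‖ ≤ C) (z w : V) :
    ‖A z z - A w w‖ ≤ C * (‖z‖ + ‖w‖) * ‖z - w‖ := by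
  have h : A z z - A w w = A (z - w) z + A w (z - w) := by
    simp only [map_sub, sub_apply]; abel
  rw [h]
  have h1 : ‖A (z - w) z‖ ≤ C * ‖z - w‖ * ‖z‖ := (A.le_opNorm₂ _ _).trans (by gcongr)
  have h2 : ‖A w (z - w)‖ ≤ C * ‖w‖ * ‖z - w‖ := (A.le_opNorm₂ _ _).trans (by gcongr)
  linarith [norm_add_le (A (z - w) z) (A w (z - w))]

lemma norm_quadratic_inverse_le (A : V →L[ℝ] V →L[ℝ] V) {C : ℝ} (hA : ‖A‖ ≤ C) {η : V}
    (hη : C * ‖η‖ ≤ 1) :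
    ‖(η + (2 : ℝ)⁻¹ • A η η) - (2 : ℝ)⁻¹ •
      A (η + (2 : ℝ)⁻¹ • A η η) (η + (2 : ℝ)⁻¹ • A η η) - η‖ ≤ C ^ 2 * ‖η‖ ^ 3 := by
  set z := η + (2 : ℝ)⁻¹ • A η η with hz
  have hC : 0 ≤ C := (norm_nonneg A).trans hA
  have h1 : ‖A η η‖ ≤ C * ‖η‖ * ‖η‖ := (A.le_opNorm₂ _ _).trans (by gcongr)
  have h2 : z - η = (2 : ℝ)⁻¹ • A η η := by simp [hz]
  have h3 : ‖z - η‖ ≤ 2⁻¹ * (C * ‖η‖ * ‖η‖) := by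
    rw [h2, norm_smul, norm_inv, Real.norm_ofNat]; gcongr
  have h4 : ‖z‖ ≤ 2 * ‖η‖ := by
    have : ‖z‖ ≤ ‖η‖ + ‖z - η‖ := by simpa using norm_add_le η (z - η)
    nlinarith [norm_nonneg η]
  have h5 : z - (2 : ℝ)⁻¹ • A z z - η = -((2 : ℝ)⁻¹ • (A z z - A η η)) := by
    rw [sub_right_comm, h2, smul_sub]; abel
  rw [h5, norm_neg, norm_smul, norm_inv, Real.norm_ofNat]
  have h6 := norm_bilin_diag_sub_le A hA z η
  have h7 : C * (‖z‖ + ‖η‖) * ‖z - η‖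
      ≤ C * (2 * ‖η‖ + ‖η‖) * (2⁻¹ * (C * ‖η‖ * ‖η‖)) := by gcongr
  have : 0 ≤ C ^ 2 * ‖η‖ ^ 3 := by positivity
  nlinarith

namespace MetricBounds

variable {G : V → V →L[ℝ] V →L[ℝ] ℝ} {Γ : V → V →L[ℝ] V →L[ℝ] V} {B : Set V} {m C : ℝ}
  (hb : MetricBounds G Γ B m C)

include hb

lemma norm_quadExp_quadChart_sub_le {q y : V} (hq : q ∈ B) (hy : C * ‖y - q‖ ≤ 1) :
    ‖quadExp Γ q (quadChart Γ q y) - y‖ ≤ C ^ 2 * ‖y - q‖ ^ 3 := by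
  have := norm_quadratic_inverse_le (Γ q) (hb.gamma_upper q hq) hy
  rw [quadExp, quadChart]
  convert this using 2
  abel

lemma norm_quadChart_quadExp_sub_le {p v : V} (hp : p ∈ B) (hv : C * ‖v‖ ≤ 1) :
    ‖quadChart Γ p (quadExp Γ p v) - v‖ ≤ C ^ 2 * ‖v‖ ^ 3 := by
  have := norm_quadratic_inverse_le (-Γ p) ((norm_neg (Γ p)).le.trans (hb.gamma_upper p hp)) hv
  rw [quadExp, quadChart]
  convert this using 2
  simp [sub_eq_add_neg]

lemma norm_quadChart_sub_le {q y z : V} (hq : q ∈ B) (hy : C * ‖y - q‖ ≤ 1)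
    (hz : C * ‖z - q‖ ≤ 1) : ‖quadChart Γ q y - quadChart Γ q z‖ ≤ 2 * ‖y - z‖ := by
  have h1 := norm_bilin_diag_sub_le (Γ q) (hb.gamma_upper q hq) (y - q) (z - q)
  rw [sub_sub_sub_cancel_right] at h1
  have h2 : quadChart Γ q y - quadChart Γ q z = (y - z) + (2 : ℝ)⁻¹ •
      (Γ q (y - q) (y - q) - Γ q (z - q) (z - q)) := by
    rw [quadChart, quadChart, smul_sub]; abel
  rw [h2]
  refine (norm_add_le _ _).trans ?_
  rw [norm_smul, norm_inv, Real.norm_ofNat]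
  nlinarith [norm_nonneg (y - z)]

lemma norm_quadExp_sub_quadExp_le {q y z : V} (hq : q ∈ B) (hy : C * ‖y‖ ≤ 1)
    (hz : C * ‖z‖ ≤ 1) : ‖quadExp Γ q y - quadExp Γ q z‖ ≤ 2 * ‖y - z‖ := by
  have h1 := norm_bilin_diag_sub_le (Γ q) (hb.gamma_upper q hq) y z
  have h2 : quadExp Γ q y - quadExp Γ q z = (y - z) - (2 : ℝ)⁻¹ • (Γ q y y - Γ q z z) := by
    rw [quadExp, quadExp, smul_sub]; abel
  rw [h2]
  refine (norm_sub_le _ _).trans ?_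
  rw [norm_smul, norm_inv, Real.norm_ofNat]
  nlinarith [norm_nonneg (y - z)]

omit hb in
lemma quadChart_self (q : V) : quadChart Γ q q = 0 := by simp [quadChart]

omit hb in
lemma quadExp_zero (q : V) : quadExp Γ q 0 = q := by simp [quadExp]

lemma norm_quadChart_le {q y : V} (hq : q ∈ B) (hy : C * ‖y - q‖ ≤ 1) :
    ‖quadChart Γ q y‖ ≤ 2 * ‖y - q‖ := by
  simpa [quadChart_self] using hb.norm_quadChart_sub_le hq hy (z := q) (by simp)

lemma norm_quadExp_sub_base_le {q y : V} (hq : q ∈ B) (hy : C * ‖y‖ ≤ 1) :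
    ‖quadExp Γ q y - q‖ ≤ 2 * ‖y‖ := by
  simpa [quadExp_zero] using hb.norm_quadExp_sub_quadExp_le hq hy (z := 0) (by simp)

end MetricBounds

/-- The map `f` read in the quadratic approximations of normal charts at `p` and `f p`. -/
def normalRep (Γ : V → V →L[ℝ] V →L[ℝ] V) (f : V → V) (p v : V) : V :=
  quadChart Γ (f p) (f (quadExp Γ p v))

namespace IsIsomAt

variable {G : V → V →L[ℝ] V →L[ℝ] ℝ} {Γ : V → V →L[ℝ] V →L[ℝ] V} {B : Set V} {m C d ℓ : ℝ}
  {p : V} {f : V → V} {L : V → V →L[ℝ] V}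

section

variable (hb : MetricBounds G Γ B m C) (hf : IsIsomAt G B d p f L) (hd : 0 < d)
  (hℓ : √(C / m) ≤ ℓ)

include hb hf hd hℓ

omit hb hℓ in
lemma mem_base : p ∈ B := hf.ball_subset (Metric.mem_ball_self hd)

omit hb hℓ in
lemma mem_base' : f p ∈ B := hf.ball_subset' (Metric.mem_ball_self hd)

omit hℓ in
lemma quadExp_mem {v : V} (hv : C * ‖v‖ ≤ 1) (hvd : 2 * ‖v‖ < d) :
    quadExp Γ p v ∈ Metric.ball p d := by
  rw [mem_ball_iff_norm]
  exact (hb.norm_quadExp_sub_base_le (hf.mem_base hd) hv).trans_lt hvd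

lemma norm_apply_quadExp_sub_le {v : V} (hv : C * ‖v‖ ≤ 1) (hvd : 2 * ‖v‖ < d) :
    ‖f (quadExp Γ p v) - f p‖ ≤ ℓ * (2 * ‖v‖) := by
  have h1 := hf.norm_sub_le hb (Metric.mem_ball_self hd) (hf.quadExp_mem hb hd hv hvd)
  have h2 := hb.norm_quadExp_sub_base_le (hf.mem_base hd) hv
  have hℓ0 : 0 ≤ ℓ := (Real.sqrt_nonneg _).trans hℓ
  refine h1.trans (by gcongr)

/-- Local isometries increase distances in the quadratic normal charts by at most a fourth order
error. -/
lemma apply_normalRep_sub_le {v w : V} {r : ℝ} (hv : ‖v‖ ≤ r) (hw : ‖w‖ ≤ r) (hr : C * r ≤ 1)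
    (hrd : 2 * r < d) :
    G (f p) (normalRep Γ f p v - normalRep Γ f p w) (normalRep Γ f p v - normalRep Γ f p w)
      ≤ G p (v - w) (v - w) + (27 * C ^ 3 + 32 * C ^ 3 * ℓ ^ 4) * r ^ 2 * ‖v - w‖ ^ 2 := by
  have hC := hb.C_pos
  have hp := hf.mem_base hd
  have hq := hf.mem_base' hd
  have hℓ0 : 0 ≤ ℓ := (Real.sqrt_nonneg _).trans hℓ
  have hr0 : 0 ≤ r := (norm_nonneg v).trans hv
  set e := v - w with he
  have hξ : ∀ t ∈ Set.Icc (0 : ℝ) 1, ‖w + t • e‖ ≤ r := by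
    intro t ht
    have : w + t • e = (1 - t) • w + t • v := by rw [he, smul_sub, sub_smul, one_smul]; abel
    rw [this]
    refine (norm_add_le _ _).trans ?_
    rw [norm_smul, norm_smul, Real.norm_of_nonneg ht.1, Real.norm_of_nonneg (by linarith [ht.2])]
    nlinarith [mul_le_mul_of_nonneg_left hw (show 0 ≤ 1 - t by linarith [ht.2]),
      mul_le_mul_of_nonneg_left hv ht.1]
  have hξC : ∀ t ∈ Set.Icc (0 : ℝ) 1, C * ‖w + t • e‖ ≤ 1 := fun t ht =>
    (mul_le_mul_of_nonneg_left (hξ t ht) hC.le).trans hr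
  have hξd : ∀ t ∈ Set.Icc (0 : ℝ) 1, 2 * ‖w + t • e‖ < d := fun t ht =>
    (mul_le_mul_of_nonneg_left (hξ t ht) (by norm_num)).trans_lt hrd
  set x : ℝ → V := fun t => quadExp Γ p (w + t • e) with hx
  set x' : ℝ → V := fun t => e - Γ p (w + t • e) e with hx'
  have hxm : ∀ t ∈ Set.Icc (0 : ℝ) 1, x t ∈ Metric.ball p d := fun t ht =>
    hf.quadExp_mem hb hd (hξC t ht) (hξd t ht)
  set κ : ℝ → V := fun t => normalRep Γ f p (w + t • e) with hκ
  set κ' : ℝ → V := fun t => L (x t) (x' t) + Γ (f p) (f (x t) - f p) (L (x t) (x' t)) with hκ'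
  have hder : ∀ t ∈ Set.Icc (0 : ℝ) 1, HasDerivAt κ (κ' t) t := fun t ht =>
    hasFDerivAt_quadChart_comp (hb.gamma_symm _ hq)
      ((hf.hasFDerivAt _ (hxm t ht)).comp_hasDerivAt t
        (hasDerivAt_quadExp (hb.gamma_symm p hp) w e t))
  set u := κ 1 - κ 0 with hu
  obtain ⟨t, ht, hts⟩ := exists_hasDerivAt_eq_slope (fun t => G (f p) u (κ t))
    (fun t => G (f p) u (κ' t)) zero_lt_one
    (fun t ht => ((G (f p) u).hasFDerivAt.comp_hasDerivAt t
      (hder t ht)).continuousAt.continuousWithinAt)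
    (fun t ht => (G (f p) u).hasFDerivAt.comp_hasDerivAt t (hder t (Ioo_subset_Icc_self ht)))
  have ht' := Ioo_subset_Icc_self ht
  have hts' : G (f p) u (κ' t) = G (f p) u u := by
    rw [hts, hu, map_sub (G (f p) u)]; ring
  have hle : G (f p) u u ≤ G (f p) (κ' t) (κ' t) := by
    have h1 := hb.cauchy_schwarz hq u (κ' t)
    rw [hts'] at h1
    rcases (hb.nonneg hq u).eq_or_lt with h | h
    · rw [← h]; exact hb.nonneg hq _
    · nlinarith
  have hend : u = normalRep Γ f p v - normalRep Γ f p w := by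
    simp [hu, hκ, he]
  rw [← hend]
  refine hle.trans ?_
  have h2 := hb.apply_chart_le (h := f (x t) - f p) hq
    (by rw [add_sub_cancel]; exact hf.maps _ (hxm t ht')) (L (x t) (x' t))
  rw [add_sub_cancel, hf.isom _ (hxm t ht')] at h2
  have h3 := hb.apply_exp_le hp (hξC t ht') (hf.ball_subset (hxm t ht')) e
  have h4 : ‖f (x t) - f p‖ ≤ ℓ * (2 * r) :=
    (hf.norm_apply_quadExp_sub_le hb hd hℓ (hξC t ht') (hξd t ht')).trans
      (by gcongr; exact hξ t ht')
  have h5 : ‖L (x t) (x' t)‖ ≤ ℓ * (2 * ‖e‖) :=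
    ((L (x t)).le_opNorm _).trans (mul_le_mul ((hf.norm_le hb (hxm t ht')).trans hℓ)
      (hb.norm_sub_gamma_le hp (hξC t ht') e) (norm_nonneg _) hℓ0)
  have h6 : 2 * C ^ 3 * ‖f (x t) - f p‖ ^ 2 * ‖L (x t) (x' t)‖ ^ 2
      ≤ 2 * C ^ 3 * (ℓ * (2 * r)) ^ 2 * (ℓ * (2 * ‖e‖)) ^ 2 := by gcongr
  have h7 : 27 * C ^ 3 * ‖w + t • e‖ ^ 2 * ‖e‖ ^ 2 ≤ 27 * C ^ 3 * r ^ 2 * ‖e‖ ^ 2 := by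
    gcongr; exact hξ t ht'
  have h2' : G (f p) (κ' t) (κ' t) ≤ G (x t) (x' t) (x' t)
      + 2 * C ^ 3 * ‖f (x t) - f p‖ ^ 2 * ‖L (x t) (x' t)‖ ^ 2 := h2
  have h3' : G (x t) (x' t) (x' t) ≤ _ := h3
  nlinarith

lemma norm_normalRep_le {v : V} (hv : C * ‖v‖ ≤ 1) (hvd : 2 * ‖v‖ < d)
    (hvℓ : C * (ℓ * (2 * ‖v‖)) ≤ 1) : ‖normalRep Γ f p v‖ ≤ 4 * ℓ * ‖v‖ := by
  have h1 := hf.norm_apply_quadExp_sub_le hb hd hℓ hv hvd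
  have h2 := hb.norm_quadChart_le (hf.mem_base' hd) (y := f (quadExp Γ p v))
    ((mul_le_mul_of_nonneg_left h1 hb.C_pos.le).trans hvℓ)
  rw [normalRep]
  linarith

omit hb hℓ in
lemma hasFDerivAt_normalRep : HasFDerivAt (normalRep Γ f p) (L p) 0 := by
  have h1 : HasFDerivAt (quadExp Γ p) (ContinuousLinearMap.id ℝ V) 0 := by
    have h2 : HasFDerivAt (fun v => Γ p v v) (0 : V →L[ℝ] V) 0 := by
      refine ((Γ p).hasFDerivAt.clm_apply (hasFDerivAt_id (0 : V))).congr_fderiv ?_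
      ext; simp
    refine (((hasFDerivAt_id (0 : V)).sub (h2.const_smul (2 : ℝ)⁻¹)).const_add p).congr_fderiv ?_
    simp
  have h3 : HasFDerivAt (quadChart Γ (f p)) (ContinuousLinearMap.id ℝ V) (f p) := by
    have h0 : HasFDerivAt (fun y : V => y - f p) (ContinuousLinearMap.id ℝ V) (f p) :=
      (hasFDerivAt_id (f p)).sub_const _
    have h2 : HasFDerivAt (fun y => Γ (f p) (y - f p) (y - f p)) (0 : V →L[ℝ] V) (f p) := by
      refine (((Γ (f p)).hasFDerivAt.comp (f p) h0).clm_apply h0).congr_fderiv ?_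
      ext; simp
    refine (h0.add (h2.const_smul (2 : ℝ)⁻¹)).congr_fderiv ?_
    simp
  have h4 : HasFDerivAt f (L p) (quadExp Γ p 0) := by
    rw [MetricBounds.quadExp_zero]; exact hf.hasFDerivAt p (Metric.mem_ball_self hd)
  have h5 := h4.comp 0 h1
  have h6 : HasFDerivAt (quadChart Γ (f p)) (ContinuousLinearMap.id ℝ V)
      ((f ∘ quadExp Γ p) 0) := by
    simpa [MetricBounds.quadExp_zero] using h3
  exact (h6.comp 0 h5).congr_fderiv (by simp)

end

end IsIsomAt

/-- A local isometry near `p` together with its local inverse near `f p`. -/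
structure IsIsomPair (G : V → V →L[ℝ] V →L[ℝ] ℝ) (B : Set V) (d : ℝ) (p : V)
    (f f' : V → V) (L L' : V → V →L[ℝ] V) : Prop where
  fwd : IsIsomAt G B d p f L
  bwd : IsIsomAt G B d (f p) f' L'
  left_inv : ∀ x ∈ Metric.ball p d, f x ∈ Metric.ball (f p) d → f' (f x) = x
  right_inv : ∀ y ∈ Metric.ball (f p) d, f' y ∈ Metric.ball p d → f (f' y) = y

namespace IsIsomPair

variable {G : V → V →L[ℝ] V →L[ℝ] ℝ} {Γ : V → V →L[ℝ] V →L[ℝ] V} {B : Set V} {m C d ℓ : ℝ}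
  {p : V} {f f' : V → V} {L L' : V → V →L[ℝ] V}

lemma apply_base (hf : IsIsomPair G B d p f f' L L') (hd : 0 < d) : f' (f p) = p :=
  hf.left_inv p (Metric.mem_ball_self hd) (Metric.mem_ball_self hd)

lemma symm (hf : IsIsomPair G B d p f f' L L') (hd : 0 < d) :
    IsIsomPair G B d (f p) f' f L' L := by
  have h := hf.apply_base hd
  refine ⟨hf.bwd, ?_, ?_, ?_⟩
  · rw [h]; exact hf.fwd
  · rw [h]; exact hf.right_inv
  · rw [h]; exact hf.left_inv

variable (hb : MetricBounds G Γ B m C) (hf : IsIsomPair G B d p f f' L L') (hd : 0 < d)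
  (hℓ : √(C / m) ≤ ℓ) (hℓ1 : 1 ≤ ℓ)

include hb hf hd hℓ hℓ1

lemma norm_normalRep_normalRep_sub_le {v : V} (hv : 32 * C * ℓ ^ 2 * ‖v‖ ≤ 1)
    (hvd : 32 * ℓ ^ 2 * ‖v‖ < d) :
    ‖normalRep Γ f' (f p) (normalRep Γ f p v) - v‖ ≤ 17 * C ^ 2 * ℓ ^ 4 * ‖v‖ ^ 3 := by
  have hC := hb.C_pos
  have hC1 := hb.one_le
  have hp := hf.fwd.mem_base hd
  have hq := hf.fwd.mem_base' hd
  have hn := norm_nonneg v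
  have hℓ2 : ℓ ≤ ℓ ^ 2 := le_self_pow₀ hℓ1 (by norm_num)
  have hℓ3 : 1 ≤ ℓ ^ 2 := hℓ1.trans hℓ2
  have hℓ0 : 0 ≤ ℓ := by linarith
  have e1 : ‖v‖ ≤ ℓ ^ 2 * ‖v‖ := le_mul_of_one_le_left hn hℓ3
  have e2 : ℓ * ‖v‖ ≤ ℓ ^ 2 * ‖v‖ := by gcongr
  have e1' : C * ‖v‖ ≤ C * (ℓ ^ 2 * ‖v‖) := by gcongr
  have e2' : C * (ℓ * ‖v‖) ≤ C * (ℓ ^ 2 * ‖v‖) := by gcongr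
  have e3 : 0 ≤ C * (ℓ ^ 2 * ‖v‖) := by positivity
  have e4 : 0 ≤ ℓ ^ 2 * ‖v‖ := by positivity
  have hv1 : C * ‖v‖ ≤ 1 := by nlinarith
  have hvd1 : 2 * ‖v‖ < d := by nlinarith
  set x := quadExp Γ p v with hx
  have hxm : x ∈ Metric.ball p d := hf.fwd.quadExp_mem hb hd hv1 hvd1
  have hxn : ‖x - p‖ ≤ 2 * ‖v‖ := hb.norm_quadExp_sub_base_le hp hv1
  have hyn : ‖f x - f p‖ ≤ ℓ * (2 * ‖v‖) := hf.fwd.norm_apply_quadExp_sub_le hb hd hℓ hv1 hvd1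
  have hyC : C * ‖f x - f p‖ ≤ 1 := by
    have : C * ‖f x - f p‖ ≤ C * (ℓ * (2 * ‖v‖)) := by gcongr
    nlinarith
  have hym : f x ∈ Metric.ball (f p) d := by
    rw [mem_ball_iff_norm]; nlinarith
  have hFn : ‖normalRep Γ f p v‖ ≤ 4 * ℓ * ‖v‖ :=
    hf.fwd.norm_normalRep_le hb hd hℓ hv1 hvd1 (by nlinarith)
  have hFC : C * ‖normalRep Γ f p v‖ ≤ 1 := by
    have : C * ‖normalRep Γ f p v‖ ≤ C * (4 * ℓ * ‖v‖) := by gcongr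
    nlinarith
  set y' := quadExp Γ (f p) (normalRep Γ f p v) with hy'
  have hyy' : ‖y' - f x‖ ≤ C ^ 2 * (ℓ * (2 * ‖v‖)) ^ 3 :=
    (hb.norm_quadExp_quadChart_sub_le hq hyC).trans (by gcongr)
  have hy'n : ‖y' - f p‖ ≤ 2 * (4 * ℓ * ‖v‖) :=
    (hb.norm_quadExp_sub_base_le hq hFC).trans (by gcongr)
  have hy'm : y' ∈ Metric.ball (f p) d := by
    rw [mem_ball_iff_norm]; nlinarith
  have hinv := hf.left_inv x hxm hym
  have h1 : ‖f' y' - x‖ ≤ ℓ * (C ^ 2 * (ℓ * (2 * ‖v‖)) ^ 3) := by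
    have := hf.bwd.norm_sub_le hb hym hy'm
    rw [hinv] at this
    exact this.trans (mul_le_mul hℓ hyy' (norm_nonneg _) hℓ0)
  have h2 : ‖f' y' - p‖ ≤ ℓ * (2 * (4 * ℓ * ‖v‖)) := by
    have := hf.bwd.norm_sub_le hb (Metric.mem_ball_self hd) hy'm
    rw [hf.apply_base hd] at this
    exact this.trans (mul_le_mul hℓ hy'n (norm_nonneg _) hℓ0)
  have h3 := hb.norm_quadChart_sub_le hp (y := f' y') (z := x)
    (by
      have : C * ‖f' y' - p‖ ≤ C * (ℓ * (2 * (4 * ℓ * ‖v‖))) := by gcongr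
      nlinarith)
    (by
      have : C * ‖x - p‖ ≤ C * (2 * ‖v‖) := by gcongr
      nlinarith)
  have h4 := hb.norm_quadChart_quadExp_sub_le hp hv1
  have h5 : normalRep Γ f' (f p) (normalRep Γ f p v) = quadChart Γ p (f' y') := by
    rw [normalRep, hf.apply_base hd]
  rw [h5]
  have h6 : ‖quadChart Γ p (f' y') - v‖
      ≤ ‖quadChart Γ p (f' y') - quadChart Γ p x‖ + ‖quadChart Γ p x - v‖ :=
    norm_sub_le_norm_sub_add_norm_sub _ _ _
  have h7 : C ^ 2 * ‖v‖ ^ 3 ≤ C ^ 2 * ‖v‖ ^ 3 * ℓ ^ 4 :=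
    le_mul_of_one_le_right (by positivity) (one_le_pow₀ hℓ1)
  nlinarith

/-- In quadratic normal charts a local isometry preserves distances up to fourth order. -/
lemma abs_normalRep_sub_le {v w : V} {r : ℝ} (hv : ‖v‖ ≤ r) (hw : ‖w‖ ≤ r)
    (hr : 32 * C * ℓ ^ 2 * r ≤ 1) (hrd : 32 * ℓ ^ 2 * r < d) :
    |G (f p) (normalRep Γ f p v - normalRep Γ f p w) (normalRep Γ f p v - normalRep Γ f p w)
      - G p (v - w) (v - w)|
      ≤ ((27 * C ^ 3 + 32 * C ^ 3 * ℓ ^ 4) * 1024 * ℓ ^ 4 + 136 * C ^ 3 * ℓ ^ 4) * r ^ 4 := by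
  have hC := hb.C_pos
  have hp := hf.fwd.mem_base hd
  have hq := hf.fwd.mem_base' hd
  have hr0 : 0 ≤ r := (norm_nonneg v).trans hv
  have hℓ2 : ℓ ≤ ℓ ^ 2 := le_self_pow₀ hℓ1 (by norm_num)
  have hℓ3 : 1 ≤ ℓ ^ 2 := hℓ1.trans hℓ2
  have hℓ0 : 0 ≤ ℓ := by linarith
  have e1 : r ≤ ℓ ^ 2 * r := le_mul_of_one_le_left hr0 hℓ3
  have e2 : ℓ * r ≤ ℓ ^ 2 * r := by gcongr
  have e1' : C * r ≤ C * (ℓ ^ 2 * r) := by gcongr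
  have e2' : C * (ℓ * r) ≤ C * (ℓ ^ 2 * r) := by gcongr
  have e3 : 0 ≤ C * (ℓ ^ 2 * r) := by positivity
  have e4 : 0 ≤ ℓ ^ 2 * r := by positivity
  have hvw : ‖v - w‖ ≤ 2 * r := by linarith [norm_sub_le v w]
  set K := 27 * C ^ 3 + 32 * C ^ 3 * ℓ ^ 4 with hK
  have hK0 : 0 ≤ K := by positivity
  have hup := hf.fwd.apply_normalRep_sub_le hb hd hℓ hv hw (by nlinarith) (by nlinarith)
  have hF : ∀ z : V, ‖z‖ ≤ r → ‖normalRep Γ f p z‖ ≤ 4 * ℓ * r := by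
    intro z hz
    have hz0 := norm_nonneg z
    have k1 : C * ‖z‖ ≤ C * r := by gcongr
    have k2 : C * (ℓ * (2 * ‖z‖)) ≤ C * (ℓ * (2 * r)) := by gcongr
    refine (hf.fwd.norm_normalRep_le hb hd hℓ (by nlinarith) (by nlinarith)
      (by nlinarith)).trans (by gcongr)
  have hcomp : ∀ z : V, ‖z‖ ≤ r →
      ‖normalRep Γ f' (f p) (normalRep Γ f p z) - z‖ ≤ 17 * C ^ 2 * ℓ ^ 4 * r ^ 3 := by
    intro z hz
    have k1 : 32 * C * ℓ ^ 2 * ‖z‖ ≤ 32 * C * ℓ ^ 2 * r := by gcongr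
    have k2 : 32 * ℓ ^ 2 * ‖z‖ ≤ 32 * ℓ ^ 2 * r := by gcongr
    exact (hf.norm_normalRep_normalRep_sub_le hb hd hℓ hℓ1 (k1.trans hr)
      (k2.trans_lt hrd)).trans (by gcongr)
  have hlow := hf.bwd.apply_normalRep_sub_le hb hd hℓ (hF v hv) (hF w hw)
    (by nlinarith) (by nlinarith)
  rw [hf.apply_base hd] at hlow
  set Fv := normalRep Γ f p v
  set Fw := normalRep Γ f p w
  set a := normalRep Γ f' (f p) Fv - v with ha
  set b := normalRep Γ f' (f p) Fw - w with hb'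
  have hab : ‖a - b‖ ≤ 34 * C ^ 2 * ℓ ^ 4 * r ^ 3 := by
    linarith [norm_sub_le a b, hcomp v hv, hcomp w hw]
  have h1 : normalRep Γ f' (f p) Fv - normalRep Γ f' (f p) Fw = (v - w) + (a - b) := by
    rw [ha, hb']; abel
  rw [h1] at hlow
  have h2 : G p ((v - w) + (a - b)) ((v - w) + (a - b))
      = G p (v - w) (v - w) + 2 * G p (v - w) (a - b) + G p (a - b) (a - b) := by
    simp only [map_add, add_apply, hb.symm p hp (a - b) (v - w)]; ring
  have h3 := hb.nonneg hp (a - b)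
  have h4 : |G p (v - w) (a - b)| ≤ C * (2 * r) * (34 * C ^ 2 * ℓ ^ 4 * r ^ 3) :=
    (hb.abs_le hp _ _).trans (by gcongr)
  have h5 : ‖Fv - Fw‖ ≤ 8 * ℓ * r := by linarith [norm_sub_le Fv Fw, hF v hv, hF w hw]
  have h6 : K * (4 * ℓ * r) ^ 2 * ‖Fv - Fw‖ ^ 2 ≤ K * (4 * ℓ * r) ^ 2 * (8 * ℓ * r) ^ 2 := by
    gcongr
  have h7 : K * r ^ 2 * ‖v - w‖ ^ 2 ≤ K * r ^ 2 * (2 * r) ^ 2 := by gcongr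
  have h8 : K * r ^ 4 ≤ K * r ^ 4 * ℓ ^ 4 :=
    le_mul_of_one_le_right (by positivity) (one_le_pow₀ hℓ1)
  have h9 : 0 ≤ C ^ 3 * ℓ ^ 4 * r ^ 4 := by positivity
  rw [abs_le] at h4 ⊢
  constructor
  · nlinarith [h4.1]
  · nlinarith

end IsIsomPair

end IsometryTaylor

section IsometryRegularity

open Filter Topology

variable {V : Type*} [NormedAddCommGroup V] [NormedSpace ℝ V]

set_option maxHeartbeats 1000000 in
/-- Second order Taylor expansion of local isometries, uniformly over all isometries. -/
theorem exists_isom_taylor {G : V → V →L[ℝ] V →L[ℝ] ℝ} {Γ : V → V →L[ℝ] V →L[ℝ] V} {B : Set V}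
    {m C d : ℝ} (hb : MetricBounds G Γ B m C) (hd : 0 < d) :
    ∃ K r₁ : ℝ, 0 ≤ K ∧ 0 < r₁ ∧ ∀ (p : V) (f f' : V → V) (L L' : V → V →L[ℝ] V),
      IsIsomPair G B d p f f' L L' → ∀ u : V, ‖u‖ ≤ r₁ →
      ‖f (p + u) - (f p + L p u
        + (2 : ℝ)⁻¹ • (L p (Γ p u u) - Γ (f p) (L p u) (L p u)))‖ ≤ K * ‖u‖ ^ 3 := by
  have hC := hb.C_pos
  have hm := hb.m_pos
  obtain ⟨ℓ, hℓ, hℓ1⟩ : ∃ ℓ : ℝ, √(C / m) ≤ ℓ ∧ 1 ≤ ℓ := ⟨_, le_max_left _ 1, le_max_right _ _⟩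
  have hℓ0 : 0 < ℓ := by linarith
  set c₄ := (27 * C ^ 3 + 32 * C ^ 3 * ℓ ^ 4) * 1024 * ℓ ^ 4 + 136 * C ^ 3 * ℓ ^ 4 with hc₄
  have hc₄0 : 0 < c₄ := by positivity
  set Cc := C + c₄ + 4 * ℓ + 17 * C ^ 2 * ℓ ^ 4 with hCc
  have h17 : 0 < 17 * C ^ 2 * ℓ ^ 4 := by positivity
  set r₀ := min (1 / (32 * C * ℓ ^ 2)) (d / (64 * ℓ ^ 2)) with hr₀
  have hr₀0 : 0 < r₀ := by positivity
  have hr₀C : ∀ r ≤ r₀, 32 * C * ℓ ^ 2 * r ≤ 1 := fun r hr => by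
    have := (le_div_iff₀ (by positivity)).1 (hr.trans (min_le_left _ _)); linarith
  have hr₀d : ∀ r ≤ r₀, 32 * ℓ ^ 2 * r < d := fun r hr => by
    have := (le_div_iff₀ (by positivity)).1 (hr.trans (min_le_right _ _)); linarith
  obtain ⟨K₀, r₁, hr₁, hcore⟩ := exists_norm_sub_fderiv_le (V := V) (m := m) (C := Cc) (r₀ := r₀)
    hm (by linarith [hb.one_le]) hr₀0
  refine ⟨ℓ * C ^ 2 + 64 * C ^ 2 * ℓ ^ 3 + 16 * max K₀ 0 + C ^ 2 * ℓ ^ 2,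
    min (r₀ / 2) (r₁ / 2), by positivity, by positivity, ?_⟩
  intro p f f' L L' hf u hu
  have hp := hf.fwd.mem_base hd
  have hq := hf.fwd.mem_base' hd
  have hℓ2 : ℓ ≤ ℓ ^ 2 := le_self_pow₀ hℓ1 (by norm_num)
  have hℓ3 : 1 ≤ ℓ ^ 2 := hℓ1.trans hℓ2
  have key : ∀ v, ‖v‖ ≤ r₁ → ‖normalRep Γ f p v - L p v‖ ≤ K₀ * ‖v‖ ^ 3 := by
    refine hcore (G p) (G (f p)) (normalRep Γ f p) (L p) (hb.symm p hp) (hb.symm _ hq)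
      (hb.lower _ hq) ((hb.upper _ hq).trans (by linarith)) ?_
      (hf.fwd.hasFDerivAt_normalRep hd) ?_ ?_
    · rw [normalRep, MetricBounds.quadExp_zero, MetricBounds.quadChart_self]
    · intro v w r hv hw hr
      refine (hf.abs_normalRep_sub_le hb hd hℓ hℓ1 hv hw (hr₀C r hr) (hr₀d r hr)).trans ?_
      have hr0 : 0 ≤ r := (norm_nonneg v).trans hv
      have : c₄ ≤ Cc := by linarith
      gcongr
    · intro w' hw'
      have h1 := (hf.symm hd).norm_normalRep_normalRep_sub_le hb hd hℓ hℓ1 (hr₀C _ hw')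
        (hr₀d _ hw')
      rw [hf.apply_base hd] at h1
      have hn := norm_nonneg w'
      have e1 : ‖w'‖ ≤ ℓ ^ 2 * ‖w'‖ := le_mul_of_one_le_left hn hℓ3
      have e2 : ℓ * ‖w'‖ ≤ ℓ ^ 2 * ‖w'‖ := by gcongr
      have e1' : C * ‖w'‖ ≤ C * (ℓ ^ 2 * ‖w'‖) := by gcongr
      have e2' : C * (ℓ * ‖w'‖) ≤ C * (ℓ ^ 2 * ‖w'‖) := by gcongr
      have e3 : 0 ≤ C * (ℓ ^ 2 * ‖w'‖) := by positivity
      have e4 : 0 ≤ ℓ ^ 2 * ‖w'‖ := by positivity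
      have k1 := hr₀C _ hw'
      have k2 := hr₀d _ hw'
      have h2 := hf.bwd.norm_normalRep_le hb hd hℓ (v := w') (by linarith) (by linarith)
        (by linarith)
      refine ⟨_, h2.trans ?_, h1.trans ?_⟩
      · gcongr; linarith
      · gcongr; linarith
  have hn := norm_nonneg u
  have hur₀ : ‖u‖ ≤ r₀ / 2 := hu.trans (min_le_left _ _)
  have hur₁ : ‖u‖ ≤ r₁ / 2 := hu.trans (min_le_right _ _)
  have k1 := hr₀C (2 * ‖u‖) (by linarith)
  have k2 := hr₀d (2 * ‖u‖) (by linarith)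
  have e1 : ‖u‖ ≤ ℓ ^ 2 * ‖u‖ := le_mul_of_one_le_left hn hℓ3
  have e2 : ℓ * ‖u‖ ≤ ℓ ^ 2 * ‖u‖ := by gcongr
  have e1' : C * ‖u‖ ≤ C * (ℓ ^ 2 * ‖u‖) := by gcongr
  have e2' : C * (ℓ * ‖u‖) ≤ C * (ℓ ^ 2 * ‖u‖) := by gcongr
  have e3 : 0 ≤ C * (ℓ ^ 2 * ‖u‖) := by positivity
  have e4 : 0 ≤ ℓ ^ 2 * ‖u‖ := by positivity
  have hC1 := hb.one_le
  have hpu : C * ‖p + u - p‖ ≤ 1 := by rw [add_sub_cancel_left]; linarith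
  set v := quadChart Γ p (p + u) with hv
  have hvu : v - u = (2 : ℝ)⁻¹ • Γ p u u := by simp [hv, quadChart]
  have hvun : ‖v - u‖ ≤ 2⁻¹ * (C * ‖u‖ * ‖u‖) := by
    rw [hvu, norm_smul, norm_inv, Real.norm_ofNat]; gcongr; exact hb.gamma_le hp u u
  have hvn : ‖v‖ ≤ 2 * ‖u‖ := by
    have := hb.norm_quadChart_le hp hpu; rwa [add_sub_cancel_left] at this
  have hCv : C * ‖v‖ ≤ C * (2 * ‖u‖) := by gcongr
  have hv1 : C * ‖v‖ ≤ 1 := by linarith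
  have hvd : 2 * ‖v‖ < d := by linarith
  set x' := quadExp Γ p v with hx'
  have hx'n : ‖x' - (p + u)‖ ≤ C ^ 2 * ‖u‖ ^ 3 := by
    have := hb.norm_quadExp_quadChart_sub_le hp hpu; rwa [add_sub_cancel_left] at this
  have hx'm : x' ∈ Metric.ball p d := hf.fwd.quadExp_mem hb hd hv1 hvd
  have hpum : p + u ∈ Metric.ball p d := by
    rw [mem_ball_iff_norm, add_sub_cancel_left]; linarith
  have hyy' : ‖f (p + u) - f x'‖ ≤ ℓ * (C ^ 2 * ‖u‖ ^ 3) := by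
    refine (hf.fwd.norm_sub_le hb hx'm hpum).trans (mul_le_mul hℓ ?_ (norm_nonneg _) hℓ0.le)
    rwa [norm_sub_rev]
  have hy'n : ‖f x' - f p‖ ≤ 4 * ℓ * ‖u‖ := by
    refine (hf.fwd.norm_apply_quadExp_sub_le hb hd hℓ hv1 hvd).trans ?_
    have : ℓ * (2 * ‖v‖) ≤ ℓ * (2 * (2 * ‖u‖)) := by gcongr
    linarith
  have hCy' : C * ‖f x' - f p‖ ≤ C * (4 * ℓ * ‖u‖) := by gcongr
  set z := normalRep Γ f p v with hz
  have hzn : ‖z‖ ≤ 4 * ℓ * ‖v‖ := by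
    refine hf.fwd.norm_normalRep_le hb hd hℓ hv1 hvd ?_
    have : C * (ℓ * (2 * ‖v‖)) ≤ C * (ℓ * (2 * (2 * ‖u‖))) := by gcongr
    linarith
  have hzL : ‖z - L p v‖ ≤ 8 * max K₀ 0 * ‖u‖ ^ 3 := by
    refine (key v (by linarith)).trans ?_
    calc K₀ * ‖v‖ ^ 3 ≤ max K₀ 0 * (2 * ‖u‖) ^ 3 := by gcongr; exact le_max_left _ _
      _ = _ := by ring
  have hLn : ‖L p‖ ≤ ℓ := (hf.fwd.norm_le hb (Metric.mem_ball_self hd)).trans hℓ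
  have hLu : ‖L p u‖ ≤ ℓ * ‖u‖ := (L p).le_of_opNorm_le hLn u
  have hLv : ‖L p v‖ ≤ 2 * ℓ * ‖u‖ := by
    have : ℓ * ‖v‖ ≤ ℓ * (2 * ‖u‖) := by gcongr
    linarith [(L p).le_of_opNorm_le hLn v]
  have h1 : ‖quadExp Γ (f p) z - f x'‖ ≤ C ^ 2 * (4 * ℓ * ‖u‖) ^ 3 :=
    (hb.norm_quadExp_quadChart_sub_le hq (by linarith)).trans (by gcongr)
  have h2 : ‖quadExp Γ (f p) z - quadExp Γ (f p) (L p v)‖ ≤ 2 * (8 * max K₀ 0 * ‖u‖ ^ 3) := by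
    refine (hb.norm_quadExp_sub_quadExp_le hq ?_ ?_).trans (by gcongr)
    · have : C * ‖z‖ ≤ C * (4 * ℓ * (2 * ‖u‖)) := by
        gcongr; exact hzn.trans (by gcongr)
      linarith
    · have : C * ‖L p v‖ ≤ C * (2 * ℓ * ‖u‖) := by gcongr
      linarith
  have h3 : ‖quadExp Γ (f p) (L p v) - (f p + L p u
        + (2 : ℝ)⁻¹ • (L p (Γ p u u) - Γ (f p) (L p u) (L p u)))‖ ≤ C ^ 2 * ℓ ^ 2 * ‖u‖ ^ 3 := by
    have hvu' : L p v = L p u + (2 : ℝ)⁻¹ • L p (Γ p u u) := by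
      rw [← map_smul, ← map_add, ← hvu]; congr 1; abel
    have h4 : quadExp Γ (f p) (L p v) - (f p + L p u
        + (2 : ℝ)⁻¹ • (L p (Γ p u u) - Γ (f p) (L p u) (L p u)))
        = -((2 : ℝ)⁻¹ • (Γ (f p) (L p v) (L p v) - Γ (f p) (L p u) (L p u))) := by
      rw [quadExp, smul_sub, smul_sub]
      nth_rewrite 1 [hvu']
      abel
    rw [h4, norm_neg, norm_smul, norm_inv, Real.norm_ofNat]
    have h5 := norm_bilin_diag_sub_le (Γ (f p)) (hb.gamma_upper _ hq) (L p v) (L p u)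
    rw [← map_sub] at h5
    have h6 : ‖L p (v - u)‖ ≤ ℓ * (2⁻¹ * (C * ‖u‖ * ‖u‖)) :=
      ((L p).le_of_opNorm_le hLn _).trans (by gcongr)
    have h7 : C * (‖L p v‖ + ‖L p u‖) * ‖L p (v - u)‖
        ≤ C * (2 * ℓ * ‖u‖ + ℓ * ‖u‖) * (ℓ * (2⁻¹ * (C * ‖u‖ * ‖u‖))) := by gcongr
    have : 0 ≤ C ^ 2 * ℓ ^ 2 * ‖u‖ ^ 3 := by positivity
    linarith
  have h4 : ∀ a b c e w : V, ‖a - w‖ ≤ ‖a - b‖ + ‖c - b‖ + ‖c - e‖ + ‖e - w‖ := fun a b c e w => by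
    have : a - w = (a - b) - (c - b) + (c - e) + (e - w) := by abel
    rw [this]
    refine (norm_add_le _ _).trans ?_
    gcongr
    refine (norm_add_le _ _).trans ?_
    gcongr
    exact norm_sub_le _ _
  refine (h4 _ (f x') (quadExp Γ (f p) z) (quadExp Γ (f p) (L p v)) _).trans ?_
  linarith

end IsometryRegularity

section IsometryFamilies

open Filter Topology

variable {V : Type*} [NormedAddCommGroup V] [NormedSpace ℝ V]

/-- The second derivative of an isometry with value `q` and derivative `L` at `p`. -/
def isomHessian (Γ : V → V →L[ℝ] V →L[ℝ] V) (p q : V) (L : V →L[ℝ] V) : V →L[ℝ] V →L[ℝ] V :=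
  (ContinuousLinearMap.compL ℝ V V V L).comp (Γ p) - (Γ q).bilinearComp L L

lemma isomHessian_apply (Γ : V → V →L[ℝ] V →L[ℝ] V) (p q : V) (L : V →L[ℝ] V) (u v : V) :
    isomHessian Γ p q L u v = L (Γ p u v) - Γ q (L u) (L v) := rfl

omit [NormedSpace ℝ V] in
lemma tendsto_norm_add_sub {W : Type*} [SeminormedAddCommGroup W] {A : V → W} {p : V}
    (hA : ContinuousAt A p) : Tendsto (fun h : V => ‖A (p + h) - A p‖) (𝓝 0) (𝓝 0) := by
  have h1 : ContinuousAt (fun h : V => p + h) 0 := by fun_prop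
  have h2 : ContinuousAt (fun h : V => A (p + h)) 0 :=
    ContinuousAt.comp (g := A) (by simpa using hA) h1
  refine tendsto_iff_norm_sub_tendsto_zero.1 ?_
  simpa [ContinuousAt] using h2

/-- Converse of Taylor's theorem: a uniform second order expansion can be differentiated. -/
lemma hasFDerivAt_of_taylor {f : V → V} {L : V → V →L[ℝ] V} {A : V → V →L[ℝ] V →L[ℝ] V}
    {U : Set V} {K r : ℝ} (hr : 0 < r) (hU : IsOpen U) (hA : ∀ p ∈ U, ∀ u v, A p u v = A p v u)
    (hT : ∀ p ∈ U, ∀ u : V, ‖u‖ ≤ r →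
      ‖f (p + u) - (f p + L p u + (2 : ℝ)⁻¹ • A p u u)‖ ≤ K * ‖u‖ ^ 3)
    {p : V} (hp : p ∈ U) (hAc : ContinuousAt A p) : HasFDerivAt L (A p) p := by
  have main : ∀ h : V, p + h ∈ U → ‖h‖ ≤ r / 2 →
      ‖L (p + h) - L p - A p h‖ ≤ (‖A (p + h) - A p‖ + 10 * K * ‖h‖) * ‖h‖ := by
    intro h hph hh
    rcases eq_or_ne h 0 with rfl | h0
    · simp
    have hhpos : 0 < ‖h‖ := norm_pos_iff.2 h0
    have hK : 0 ≤ K := by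
      have := (norm_nonneg _).trans (hT p hp h (by linarith))
      exact nonneg_of_mul_nonneg_left this (by positivity)
    have step : ∀ w : V, ‖w‖ = ‖h‖ → ‖(L (p + h) - L p - A p h) w‖
        ≤ (‖A (p + h) - A p‖ + 10 * K * ‖h‖) * ‖h‖ * ‖w‖ := by
      intro w hw
      have t1 := hT (p + h) hph w (by linarith)
      have hhw : ‖h + w‖ ≤ 2 * ‖h‖ := by linarith [norm_add_le h w]
      have t2 := hT p hp (h + w) (by linarith)
      have t3 := hT p hp h (by linarith)
      have t2' : K * ‖h + w‖ ^ 3 ≤ K * (2 * ‖h‖) ^ 3 := by gcongr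
      have e : (L (p + h) - L p - A p h) w
          = -(2 : ℝ)⁻¹ • (A (p + h) - A p) w w
            - (f (p + h + w) - (f (p + h) + L (p + h) w + (2 : ℝ)⁻¹ • A (p + h) w w))
            + (f (p + (h + w)) - (f p + L p (h + w) + (2 : ℝ)⁻¹ • A p (h + w) (h + w)))
            - (f (p + h) - (f p + L p h + (2 : ℝ)⁻¹ • A p h h)) := by
        have e1 : A p (h + w) (h + w) = A p h h + (2 : ℝ) • A p h w + A p w w := by
          rw [map_add, map_add, add_apply, add_apply, hA p hp w h, two_smul]; abel
        rw [e1, add_assoc p h w]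
        simp only [sub_apply, map_add, smul_add, smul_sub, smul_smul, neg_smul]
        norm_num
        abel
      have t4 : ‖(2 : ℝ)⁻¹ • (A (p + h) - A p) w w‖ ≤ ‖A (p + h) - A p‖ * ‖h‖ * ‖w‖ := by
        rw [norm_smul, norm_inv, Real.norm_ofNat]
        have := (A (p + h) - A p).le_opNorm₂ w w
        rw [hw] at this ⊢
        have h0 : 0 ≤ ‖A (p + h) - A p‖ * ‖h‖ * ‖h‖ := by positivity
        linarith
      rw [e]
      have n3 : ∀ a b c d : V, ‖-a - b + c - d‖ ≤ ‖a‖ + ‖b‖ + ‖c‖ + ‖d‖ := fun a b c d => by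
        refine (norm_sub_le _ _).trans ?_
        gcongr
        refine (norm_add_le _ _).trans ?_
        gcongr
        simpa using norm_sub_le (-a) b
      rw [neg_smul]
      refine (n3 _ _ _ _).trans ?_
      rw [hw] at t1 t4 ⊢
      linarith
    refine ContinuousLinearMap.opNorm_le_bound _ (by positivity) fun w => ?_
    rcases eq_or_ne w 0 with rfl | w0
    · simp
    have hwpos : 0 < ‖w‖ := norm_pos_iff.2 w0
    have := step ((‖h‖ / ‖w‖) • w) (by
      rw [norm_smul, Real.norm_of_nonneg (by positivity)]; field_simp)
    rw [map_smul, norm_smul, norm_smul, Real.norm_of_nonneg (by positivity)] at this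
    have hpos : 0 < ‖h‖ / ‖w‖ := by positivity
    refine le_of_mul_le_mul_left (this.trans_eq ?_) hpos
    ring
  rw [hasFDerivAt_iff_isLittleO_nhds_zero]
  have hlim : Tendsto (fun h : V => ‖A (p + h) - A p‖ + 10 * K * ‖h‖) (𝓝 0) (𝓝 0) := by
    have h3 := tendsto_norm_add_sub (W := V →L[ℝ] V →L[ℝ] V) hAc
    have h4 : Tendsto (fun h : V => 10 * K * ‖h‖) (𝓝 0) (𝓝 0) :=
      Continuous.tendsto' (by fun_prop) 0 0 (by simp)
    simpa using h3.add h4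
  have hev : ∀ᶠ h in 𝓝 (0 : V), p + h ∈ U ∧ ‖h‖ ≤ r / 2 := by
    refine Filter.Eventually.and ?_ ?_
    · have h1 : ContinuousAt (fun h : V => p + h) 0 := by fun_prop
      exact h1 (by simpa using hU.mem_nhds hp)
    · filter_upwards [Metric.closedBall_mem_nhds (0 : V) (half_pos hr)] with h hh
      simpa using hh
  refine Asymptotics.isLittleO_iff.2 fun c hc => ?_
  filter_upwards [hev, hlim.eventually (gt_mem_nhds hc)] with h hh hlt
  exact (main h hh.1 hh.2).trans (by gcongr)

/-- A continuous family of local isometries, parametrized by a set `s`, with inverses. -/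
structure IsIsomFamily {S : Type*} [TopologicalSpace S] (G : V → V →L[ℝ] V →L[ℝ] ℝ) (B : Set V)
    (d : ℝ) (U : Set V) (s : Set S) (f f' : S → V → V) (L L' : S → V → V →L[ℝ] V) : Prop where
  isOpen : IsOpen U
  isom : ∀ a ∈ s, ∀ p ∈ U, IsIsomPair G B d p (f a) (f' a) (L a) (L' a)
  continuousOn : ContinuousOn (uncurry f) (s ×ˢ U)

namespace IsIsomFamily

variable {S : Type*} [TopologicalSpace S] {G : V → V →L[ℝ] V →L[ℝ] ℝ}
  {Γ : V → V →L[ℝ] V →L[ℝ] V} {B : Set V} {m C d : ℝ} {U : Set V} {s : Set S}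
  {f f' : S → V → V} {L L' : S → V → V →L[ℝ] V}
  (hb : MetricBounds G Γ B m C) (hf : IsIsomFamily G B d U s f f' L L') (hd : 0 < d)

include hb hf hd

lemma norm_isomHessian_apply_le {a : S} (ha : a ∈ s) {p : V} (hp : p ∈ U) (u : V) :
    ‖isomHessian Γ p (f a p) (L a p) u u‖ ≤ (√(C / m) * C + C * √(C / m) ^ 2) * ‖u‖ ^ 2 := by
  have h := hf.isom a ha p hp
  have hC := hb.C_pos
  have hL := h.fwd.norm_le hb (Metric.mem_ball_self hd)
  have h1 := hb.gamma_le (h.fwd.mem_base hd) u u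
  have h2 := hb.gamma_le (h.fwd.mem_base' hd) (L a p u) (L a p u)
  have h3 := (L a p).le_of_opNorm_le hL u
  have h4 := (L a p).le_of_opNorm_le hL (Γ p u u)
  have h5 : √(C / m) * ‖Γ p u u‖ ≤ √(C / m) * (C * ‖u‖ * ‖u‖) := by gcongr
  have h6 : C * ‖L a p u‖ * ‖L a p u‖ ≤ C * (√(C / m) * ‖u‖) * (√(C / m) * ‖u‖) := by gcongr
  rw [isomHessian_apply]
  refine (norm_sub_le _ _).trans ?_
  nlinarith

/-- The derivative of a continuous family of local isometries is jointly continuous. -/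
theorem continuousOn_deriv [FiniteDimensional ℝ V] : ContinuousOn (uncurry L) (s ×ˢ U) := by
  obtain ⟨K, r, hK, hr, hT⟩ := exists_isom_taylor hb hd
  set K' := K * r + (√(C / m) * C + C * √(C / m) ^ 2) with hK'
  have hC := hb.C_pos
  have hK'0 : 0 ≤ K' := by positivity
  have happ : ∀ a ∈ s, ∀ p ∈ U, ∀ u : V, ‖u‖ ≤ r →
      ‖L a p u - (f a (p + u) - f a p)‖ ≤ K' * ‖u‖ ^ 2 := by
    intro a ha p hp u hu
    have h1 := hT p _ _ _ _ (hf.isom a ha p hp) u hu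
    have h2 := hf.norm_isomHessian_apply_le hb hd ha hp u
    rw [isomHessian_apply] at h2
    have h3 : L a p u - (f a (p + u) - f a p) = -(f a (p + u) - (f a p + L a p u
        + (2 : ℝ)⁻¹ • (L a p (Γ p u u) - Γ (f a p) (L a p u) (L a p u))))
        - (2 : ℝ)⁻¹ • (L a p (Γ p u u) - Γ (f a p) (L a p u) (L a p u)) := by abel
    rw [h3]
    refine (norm_sub_le _ _).trans ?_
    rw [norm_neg, norm_smul, norm_inv, Real.norm_ofNat]
    have h4 : K * ‖u‖ ^ 3 ≤ K * r * ‖u‖ ^ 2 := by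
      have : K * ‖u‖ ^ 3 = K * ‖u‖ * ‖u‖ ^ 2 := by ring
      rw [this]; gcongr
    have h5 := norm_nonneg (L a p (Γ p u u) - Γ (f a p) (L a p u) (L a p u))
    rw [hK']
    nlinarith
  refine continuousOn_clm_apply.2 fun u => ?_
  rintro ⟨a₀, p₀⟩ ⟨ha₀, hp₀⟩
  refine continuousWithinAt_of_locally_uniform_approx_of_continuousWithinAt ⟨ha₀, hp₀⟩ ?_
  intro W hW
  obtain ⟨ε, hε, hεW⟩ := Metric.mem_uniformity_dist.1 hW
  obtain ⟨δ, hδ, hδU⟩ := Metric.isOpen_iff.1 hf.isOpen p₀ hp₀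
  obtain ⟨t, ht0, htr, htε, htδ⟩ : ∃ t : ℝ, 0 < t ∧ t * ‖u‖ ≤ r ∧ K' * t * ‖u‖ ^ 2 < ε ∧
      t * ‖u‖ < δ := by
    have c1 : Tendsto (fun t : ℝ => t * ‖u‖) (𝓝[>] 0) (𝓝 0) :=
      ((continuous_id.mul continuous_const).tendsto' 0 0 (by simp)).mono_left nhdsWithin_le_nhds
    have c2 : Tendsto (fun t : ℝ => K' * t * ‖u‖ ^ 2) (𝓝[>] 0) (𝓝 0) :=
      (Continuous.tendsto' (by fun_prop) 0 0 (by simp)).mono_left nhdsWithin_le_nhds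
    have c0 : ∀ᶠ t : ℝ in 𝓝[>] 0, t ∈ Set.Ioi (0 : ℝ) := self_mem_nhdsWithin
    obtain ⟨t, ht⟩ := (c0.and ((c1.eventually (gt_mem_nhds hr)).and
      ((c2.eventually (gt_mem_nhds hε)).and (c1.eventually (gt_mem_nhds hδ))))).exists
    exact ⟨t, ht.1, ht.2.1.le, ht.2.2.1, ht.2.2.2⟩
  have htu : ‖t • u‖ = t * ‖u‖ := by rw [norm_smul, Real.norm_of_nonneg ht0.le]
  refine ⟨s ×ˢ U, self_mem_nhdsWithin,
    fun z => t⁻¹ • (f z.1 (z.2 + t • u) - f z.1 z.2), ?_, ?_⟩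
  · refine ContinuousWithinAt.const_smul (ContinuousWithinAt.sub ?_
      (hf.continuousOn (a₀, p₀) ⟨ha₀, hp₀⟩)) _
    have hmem : (a₀, p₀ + t • u) ∈ s ×ˢ U := ⟨ha₀, hδU (by simpa [htu] using htδ)⟩
    have hc : ContinuousWithinAt (uncurry f) (s ×ˢ U) (a₀, p₀ + t • u) :=
      hf.continuousOn _ hmem
    have hc' : ContinuousWithinAt (uncurry f) (s ×ˢ univ) (a₀, p₀ + t • u) := by
      refine hc.mono_of_mem_nhdsWithin ?_
      have : s ×ˢ U = (s ×ˢ univ) ∩ (Prod.snd ⁻¹' U) := by ext; simp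
      rw [this]
      exact inter_mem_nhdsWithin _ ((hf.isOpen.preimage continuous_snd).mem_nhds hmem.2)
    exact hc'.comp (f := fun z : S × V => (z.1, z.2 + t • u)) (t := s ×ˢ univ) (x := (a₀, p₀))
      (by fun_prop) (fun z hz => ⟨hz.1, mem_univ _⟩)
  · rintro ⟨a, p⟩ ⟨ha, hp⟩
    refine hεW ?_
    rw [dist_eq_norm]
    have h1 := happ a ha p hp (t • u) (by rw [htu]; exact htr)
    have h2 : L a p u - t⁻¹ • (f a (p + t • u) - f a p)
        = t⁻¹ • (L a p (t • u) - (f a (p + t • u) - f a p)) := by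
      rw [smul_sub t⁻¹ (L a p (t • u)), map_smul, inv_smul_smul₀ ht0.ne']
    change ‖L a p u - t⁻¹ • (f a (p + t • u) - f a p)‖ < ε
    rw [h2, norm_smul, norm_inv, Real.norm_of_nonneg ht0.le]
    rw [htu] at h1
    calc t⁻¹ * ‖L a p (t • u) - (f a (p + t • u) - f a p)‖
        ≤ t⁻¹ * (K' * (t * ‖u‖) ^ 2) := by gcongr
      _ = K' * t * ‖u‖ ^ 2 := by field_simp
      _ < ε := htε

/-- The derivative of a local isometry is differentiable, and its derivative is determined by
the 1-jet of the isometry. -/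
theorem hasFDerivAt_deriv [FiniteDimensional ℝ V] (hΓ : ContinuousOn Γ B) (hB : IsOpen B)
    {a : S} (ha : a ∈ s) {p : V} (hp : p ∈ U) :
    HasFDerivAt (L a) (isomHessian Γ p (f a p) (L a p)) p := by
  obtain ⟨K, r, hK, hr, hT⟩ := exists_isom_taylor hb hd
  have hpB := (hf.isom a ha p hp).fwd.mem_base hd
  have hqB := (hf.isom a ha p hp).fwd.mem_base' hd
  refine hasFDerivAt_of_taylor (A := fun p => isomHessian Γ p (f a p) (L a p)) hr hf.isOpen ?_
    (fun p hp u hu => hT p _ _ _ _ (hf.isom a ha p hp) u hu) hp ?_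
  · intro p hp u v
    have h := hf.isom a ha p hp
    rw [isomHessian_apply, isomHessian_apply, hb.gamma_symm _ (h.fwd.mem_base hd) u,
      hb.gamma_symm _ (h.fwd.mem_base' hd) (L a p u)]
  · have hLc : ContinuousAt (L a) p := by
      have h1 := (hf.continuousOn_deriv hb hd).comp (f := fun z : V => (a, z)) (s := U)
        (by fun_prop) (fun z hz => ⟨ha, hz⟩)
      exact h1.continuousAt (hf.isOpen.mem_nhds hp)
    have hfc : ContinuousAt (f a) p :=
      ((hf.isom a ha p hp).fwd.hasFDerivAt p (Metric.mem_ball_self hd)).continuousAt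
    have hΓp : ContinuousAt Γ p := hΓ.continuousAt (hB.mem_nhds hpB)
    have hΓq : ContinuousAt (fun z => Γ (f a z)) p :=
      ContinuousAt.comp (g := Γ) (hΓ.continuousAt (hB.mem_nhds hqB)) hfc
    refine continuousAt_clm_apply.2 fun u => continuousAt_clm_apply.2 fun v => ?_
    simp only [isomHessian_apply]
    exact (hLc.clm_apply ((hΓp.clm_apply continuousAt_const).clm_apply continuousAt_const)).sub
      ((hΓq.clm_apply (hLc.clm_apply continuousAt_const)).clm_apply
        (hLc.clm_apply continuousAt_const))

end IsIsomFamily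

end IsometryFamilies

section Christoffel

open Filter Topology
open scoped ContDiff

set_option maxSynthPendingDepth 3

variable {V : Type*} [NormedAddCommGroup V] [NormedSpace ℝ V]

/-- The Christoffel symbols of the first kind. -/
def koszulForm (A : V →L[ℝ] V →L[ℝ] V →L[ℝ] ℝ) : V →L[ℝ] V →L[ℝ] V →L[ℝ] ℝ :=
  (2 : ℝ)⁻¹ • (A + A.flip - (ContinuousLinearMap.flipₗᵢ ℝ V V ℝ :
    (V →L[ℝ] V →L[ℝ] ℝ) →L[ℝ] (V →L[ℝ] V →L[ℝ] ℝ)).comp A.flip)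

lemma koszulForm_apply (A : V →L[ℝ] V →L[ℝ] V →L[ℝ] ℝ) (h u v : V) :
    koszulForm A h u v = 2⁻¹ * (A h u v + A u h v - A v h u) := rfl

/-- The Christoffel symbols of a field of inner products. -/
def christoffel (G : V → V →L[ℝ] V →L[ℝ] ℝ) (x : V) : V →L[ℝ] V →L[ℝ] V :=
  (ContinuousLinearMap.compL ℝ V (V →L[ℝ] ℝ) V (G x).inverse).comp (koszulForm (fderiv ℝ G x))

lemma christoffel_apply (G : V → V →L[ℝ] V →L[ℝ] ℝ) (x h u : V) :
    christoffel G x h u = (G x).inverse (koszulForm (fderiv ℝ G x) h u) := rfl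

lemma contDiffAt_clm_of_apply {W F X : Type*} [NormedAddCommGroup W] [NormedSpace ℝ W]
    [NormedAddCommGroup F] [NormedSpace ℝ F] [NormedAddCommGroup X] [NormedSpace ℝ X]
    [FiniteDimensional ℝ W] {n : WithTop ℕ∞} {f : X → W →L[ℝ] F} {x : X}
    (h : ∀ y, ContDiffAt ℝ n (fun x => f x y) x) : ContDiffAt ℝ n f x := by
  let d := finrank ℝ W
  have hd : d = finrank ℝ (Fin d → ℝ) := (finrank_fin_fun ℝ).symm
  let e₁ := ContinuousLinearEquiv.ofFinrankEq hd
  let e₂ := (e₁.arrowCongr (1 : F ≃L[ℝ] F)).trans (ContinuousLinearEquiv.piRing (Fin d))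
  rw [← id_comp f, ← e₂.symm_comp_self]
  exact e₂.symm.contDiff.contDiffAt.comp x (contDiffAt_pi.mpr fun i => h _)

variable [FiniteDimensional ℝ V]

lemma isInvertible_of_posDef {b : V →L[ℝ] V →L[ℝ] ℝ} (hb : ∀ v, v ≠ 0 → 0 < b v v) :
    b.IsInvertible := by
  have hinj : Function.Injective (b : V →ₗ[ℝ] (V →L[ℝ] ℝ)) := by
    rw [injective_iff_map_eq_zero]
    intro v hv
    by_contra hne
    have h1 : b v = 0 := hv
    have := hb v hne
    rw [h1] at this
    simp at this
  have hfr : Module.finrank ℝ V = Module.finrank ℝ (V →L[ℝ] ℝ) := by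
    rw [← (LinearMap.toContinuousLinearMap (𝕜 := ℝ) (E := V) (F' := ℝ)).finrank_eq]
    exact (Subspace.dual_finrank_eq).symm
  refine ⟨(LinearEquiv.ofInjectiveOfFinrankEq (b : V →ₗ[ℝ] (V →L[ℝ] ℝ)) hinj
    hfr).toContinuousLinearEquiv, ?_⟩
  ext v w
  rfl

lemma contDiffAt_christoffel {G : V → V →L[ℝ] V →L[ℝ] ℝ} {x : V} (hG : ContDiffAt ℝ ∞ G x)
    (hpos : ∀ v, v ≠ 0 → 0 < G x v v) : ContDiffAt ℝ ∞ (christoffel G) x := by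
  have h1 : ContDiffAt ℝ ∞ (fun x => (G x).inverse) x := by
    obtain ⟨e, he⟩ := isInvertible_of_posDef hpos
    have : ContDiffAt ℝ ∞ ContinuousLinearMap.inverse (G x) := he ▸ contDiffAt_map_inverse e
    exact this.comp x hG
  have h2 : ContDiffAt ℝ ∞ (fderiv ℝ G) x := hG.fderiv_right (by simp)
  refine contDiffAt_clm_of_apply fun h => contDiffAt_clm_of_apply fun u => ?_
  simp only [christoffel_apply]
  refine h1.clm_apply (contDiffAt_clm_of_apply fun v => ?_)
  simp only [koszulForm_apply]
  have h3 : ∀ a b c : V, ContDiffAt ℝ ∞ (fun x => fderiv ℝ G x a b c) x := fun a b c =>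
    ((h2.clm_apply contDiffAt_const).clm_apply contDiffAt_const).clm_apply contDiffAt_const
  exact contDiffAt_const.mul (((h3 _ _ _).add (h3 _ _ _)).sub (h3 _ _ _))

lemma exists_pos_lower_bound {b : V →L[ℝ] V →L[ℝ] ℝ} (hb : ∀ v, v ≠ 0 → 0 < b v v) :
    ∃ m : ℝ, 0 < m ∧ ∀ v, m * ‖v‖ ^ 2 ≤ b v v := by
  have hcont : Continuous fun v => b v v := by fun_prop
  rcases (Metric.sphere (0 : V) 1).eq_empty_or_nonempty with he | hne
  · refine ⟨1, one_pos, fun v => ?_⟩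
    have : v = 0 := by
      by_contra hv
      have : ‖v‖⁻¹ • v ∈ Metric.sphere (0 : V) 1 := by
        simp [norm_smul, hv]
      rw [he] at this
      exact this
    simp [this]
  · obtain ⟨v₀, hv₀, hmin⟩ := (isCompact_sphere (0 : V) 1).exists_isMinOn hne hcont.continuousOn
    refine ⟨b v₀ v₀, hb v₀ (by rintro rfl; simp at hv₀), fun v => ?_⟩
    rcases eq_or_ne v 0 with rfl | hv
    · simp
    have hv' : ‖v‖⁻¹ • v ∈ Metric.sphere (0 : V) 1 := by simp [norm_smul, hv]
    have h1 : b v₀ v₀ ≤ b (‖v‖⁻¹ • v) (‖v‖⁻¹ • v) := hmin hv'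
    have hpos : 0 < ‖v‖ := norm_pos_iff.2 hv
    rw [map_smul, map_smul, FunLike.coe_smul, Pi.smul_apply, smul_eq_mul, smul_eq_mul] at h1
    calc b v₀ v₀ * ‖v‖ ^ 2 ≤ ‖v‖⁻¹ * (‖v‖⁻¹ * b v v) * ‖v‖ ^ 2 := by gcongr
      _ = b v v := by field_simp

/-- Near every point, a smooth field of inner products satisfies the uniform bounds. -/
theorem exists_metricBounds {G : V → V →L[ℝ] V →L[ℝ] ℝ} {O : Set V} (hO : IsOpen O) {y₀ : V}
    (hy₀ : y₀ ∈ O) (hG : ∀ x ∈ O, ContDiffAt ℝ ∞ G x) (hsymm : ∀ x ∈ O, ∀ u v, G x u v = G x v u)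
    (hpos : ∀ x ∈ O, ∀ v, v ≠ 0 → 0 < G x v v) :
    ∃ ρ m C : ℝ, 0 < ρ ∧ Metric.ball y₀ ρ ⊆ O ∧
      MetricBounds G (christoffel G) (Metric.ball y₀ ρ) m C := by
  obtain ⟨m, hm, hlow⟩ := exists_pos_lower_bound (hpos y₀ hy₀)
  obtain ⟨K, t, ht, hK⟩ : ∃ K, ∃ t ∈ 𝓝 y₀, LipschitzOnWith K (fderiv ℝ G) t :=
    (((hG y₀ hy₀).fderiv_right (m := ∞) (by simp)).of_le
      (by exact_mod_cast le_top : (1 : WithTop ℕ∞) ≤ ∞)).exists_lipschitzOnWith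
  have c1 : Tendsto (fun h : V => ‖G (y₀ + h) - G y₀‖) (𝓝 0) (𝓝 0) :=
    tendsto_norm_add_sub (W := V →L[ℝ] V →L[ℝ] ℝ) (hG y₀ hy₀).continuousAt
  have c2 : Tendsto (fun h : V => ‖christoffel G (y₀ + h) - christoffel G y₀‖) (𝓝 0) (𝓝 0) :=
    tendsto_norm_add_sub (W := V →L[ℝ] V →L[ℝ] V)
      (contDiffAt_christoffel (hG y₀ hy₀) (hpos y₀ hy₀)).continuousAt
  have c3 : Tendsto (fun h : V => y₀ + h) (𝓝 0) (𝓝 y₀) :=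
    Continuous.tendsto' (by fun_prop) _ _ (by simp)
  have hev : ∀ᶠ h in 𝓝 (0 : V), ‖G (y₀ + h) - G y₀‖ < min 1 (m / 2) ∧
      ‖christoffel G (y₀ + h) - christoffel G y₀‖ < 1 ∧ y₀ + h ∈ O ∧ y₀ + h ∈ t :=
    (c1.eventually (gt_mem_nhds (by positivity))).and ((c2.eventually (gt_mem_nhds one_pos)).and
      ((c3.eventually (hO.mem_nhds hy₀)).and (c3.eventually ht)))
  obtain ⟨ρ, hρ, hball⟩ := Metric.eventually_nhds_iff_ball.1 hev
  have hball' : ∀ x ∈ Metric.ball y₀ ρ, ‖G x - G y₀‖ < min 1 (m / 2) ∧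
      ‖christoffel G x - christoffel G y₀‖ < 1 ∧ x ∈ O ∧ x ∈ t := by
    intro x hx
    have := hball (x - y₀) (by simpa [dist_eq_norm] using hx)
    rwa [add_sub_cancel] at this
  have hGx : ∀ x ∈ O, HasFDerivAt G (fderiv ℝ G x) x := fun x hx =>
    ((hG x hx).differentiableAt (by simp)).hasFDerivAt
  have happ : ∀ x ∈ O, ∀ u v, HasFDerivAt (fun z => G z u v)
      (((fderiv ℝ G x).flip u).flip v) x := by
    intro x hx u v
    refine (((hGx x hx).clm_apply (hasFDerivAt_const u x)).clm_apply
      (hasFDerivAt_const v x)).congr_fderiv ?_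
    ext; simp
  have hdsymm : ∀ x ∈ O, ∀ h u v, fderiv ℝ G x h u v = fderiv ℝ G x h v u := by
    intro x hx h u v
    have h1 := (happ x hx u v).congr_of_eventuallyEq (f₁ := fun z => G z v u)
      (by filter_upwards [hO.mem_nhds hx] with z hz using hsymm z hz v u)
    exact congrArg (fun ξ : V →L[ℝ] ℝ => ξ h) (h1.unique (happ x hx v u))
  have hinv : ∀ x ∈ O, ∀ ξ, G x ((G x).inverse ξ) = ξ := fun x hx ξ =>
    (isInvertible_of_posDef (hpos x hx)).self_apply_inverse ξ
  refine ⟨ρ, m / 2, 1 + ‖G y₀‖ + ‖christoffel G y₀‖ + K, hρ, fun x hx => (hball' x hx).2.2.1,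
    ⟨by positivity, ?_, ?_, ?_, ?_, ?_, ?_, ?_⟩⟩
  · have := norm_nonneg (G y₀); have := norm_nonneg (christoffel G y₀); have := K.2
    have : (0 : ℝ) ≤ K := K.2
    linarith
  · exact fun x hx => hsymm x (hball' x hx).2.2.1
  · intro x hx v
    have h1 : |(G x - G y₀) v v| ≤ m / 2 * ‖v‖ * ‖v‖ :=
      ((G x - G y₀).le_opNorm₂ v v).trans (by
        gcongr; exact (hball' x hx).1.le.trans (min_le_right _ _))
    have h2 : (G x - G y₀) v v = G x v v - G y₀ v v := rfl
    rw [h2, abs_le] at h1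
    nlinarith [hlow v]
  · intro x hx
    have h1 := (hball' x hx).1.le.trans (min_le_left _ _)
    have h2 := norm_le_norm_add_norm_sub' (G x) (G y₀)
    have := norm_nonneg (christoffel G y₀)
    have : (0 : ℝ) ≤ K := K.2
    linarith
  · intro x hx u v
    have hxO := (hball' x hx).2.2.1
    rw [christoffel_apply, christoffel_apply]
    congr 1
    ext w
    rw [koszulForm_apply, koszulForm_apply, hdsymm x hxO w u v]
    ring
  · intro x hx
    have h1 := (hball' x hx).2.1.le
    have h2 := norm_le_norm_add_norm_sub' (christoffel G x) (christoffel G y₀)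
    have := norm_nonneg (G y₀)
    have : (0 : ℝ) ≤ K := K.2
    linarith
  · intro x hx h hxh u
    have hxO := (hball' x hx).2.2.1
    have h1 : 2 * G x (christoffel G x h u) u = fderiv ℝ G x h u u := by
      rw [christoffel_apply, hinv x hxO, koszulForm_apply, hdsymm x hxO u h u]; ring
    rw [h1]
    have hseg : segment ℝ x (x + h) ⊆ Metric.ball y₀ ρ :=
      (convex_ball y₀ ρ).segment_subset hx hxh
    have h2 := (convex_segment x (x + h)).norm_image_sub_le_of_norm_hasFDerivWithin_le'
      (f := G) (f' := fderiv ℝ G) (φ := fderiv ℝ G x) (C := K * ‖h‖)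
      (fun z hz => (hGx z (hball' z (hseg hz)).2.2.1).hasFDerivWithinAt)
      (fun z hz => by
        have h3 := hK.norm_sub_le (hball' z (hseg hz)).2.2.2 (hball' x hx).2.2.2
        refine h3.trans ?_
        gcongr
        have := norm_sub_le_of_mem_segment hz
        simpa using this)
      (left_mem_segment ℝ x (x + h)) (right_mem_segment ℝ x (x + h))
    rw [add_sub_cancel_left] at h2
    have h3 : |(G (x + h) - G x - fderiv ℝ G x h) u u| ≤ K * ‖h‖ * ‖h‖ * ‖u‖ * ‖u‖ :=
      ((G (x + h) - G x - fderiv ℝ G x h).le_opNorm₂ u u).trans (by gcongr)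
    have h4 : (G (x + h) - G x - fderiv ℝ G x h) u u
      = G (x + h) u u - G x u u - fderiv ℝ G x h u u := rfl
    rw [h4] at h3
    refine h3.trans ?_
    have := norm_nonneg (G y₀); have := norm_nonneg (christoffel G y₀)
    calc K * ‖h‖ * ‖h‖ * ‖u‖ * ‖u‖ = K * ‖h‖ ^ 2 * ‖u‖ ^ 2 := by ring
      _ ≤ _ := by gcongr; linarith

end Christoffel

section ParametricIntegrals

open Filter Topology MeasureTheory intervalIntegral
open scoped ContDiff

set_option maxSynthPendingDepth 3

variable {V : Type*} [NormedAddCommGroup V] [NormedSpace ℝ V] [FiniteDimensional ℝ V]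
  {F : Type*} [NormedAddCommGroup F] [NormedSpace ℝ F]

omit [NormedSpace ℝ F] in
lemma ContinuousOn.slice_right {X : Type*} [TopologicalSpace X] {J : ℝ → X → F}
    {a b : ℝ} {U : Set X} (hJ : ContinuousOn (uncurry J) (uIcc a b ×ˢ U)) {y : X} (hy : y ∈ U) :
    ContinuousOn (fun t => J t y) (uIcc a b) :=
  hJ.comp (f := fun t : ℝ => (t, y)) (by fun_prop) fun _ ht => ⟨ht, hy⟩

lemma hasFDerivAt_intervalIntegral {J : ℝ → V → F} {J' : ℝ → V → V →L[ℝ] F} {a b : ℝ} {U : Set V}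
    (hU : IsOpen U) (hJ : ContinuousOn (uncurry J) (uIcc a b ×ˢ U))
    (hJ' : ContinuousOn (uncurry J') (uIcc a b ×ˢ U))
    (hd : ∀ t ∈ uIcc a b, ∀ y ∈ U, HasFDerivAt (J t) (J' t y) y) {y : V} (hy : y ∈ U) :
    HasFDerivAt (fun y => ∫ t in a..b, J t y) (∫ t in a..b, J' t y) y := by
  obtain ⟨r, hr, hrU⟩ := Metric.nhds_basis_closedBall.mem_iff.1 (hU.mem_nhds hy)
  have hcpt : IsCompact (uIcc a b ×ˢ Metric.closedBall y r) :=
    isCompact_uIcc.prod (isCompact_closedBall y r)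
  obtain ⟨C, hC⟩ := hcpt.exists_bound_of_continuousOn
    (hJ'.mono (prod_mono_right hrU))
  have hmeas : ∀ {F' : Type _} [NormedAddCommGroup F'] [NormedSpace ℝ F'] {K : ℝ → F'},
      ContinuousOn K (uIcc a b) → AEStronglyMeasurable K (volume.restrict (uIoc a b)) := by
    intro F' _ _ K hK
    exact (hK.mono uIoc_subset_uIcc).aestronglyMeasurable measurableSet_uIoc
  refine hasFDerivAt_integral_of_dominated_of_fderiv_le (bound := fun _ => C)
    (F' := fun y t => J' t y)
    (Metric.closedBall_mem_nhds y hr) ?_ ?_ ?_ ?_ ?_ ?_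
  · filter_upwards [hU.mem_nhds hy] with z hz
    exact hmeas (hJ.slice_right hz)
  · exact (hJ.slice_right hy).intervalIntegrable
  · exact (hJ'.slice_right hy |>.mono uIoc_subset_uIcc).aestronglyMeasurable
      measurableSet_uIoc
  · exact Eventually.of_forall fun t ht z hz => hC (t, z) ⟨uIoc_subset_uIcc ht, hz⟩
  · exact intervalIntegrable_const
  · exact Eventually.of_forall fun t ht z hz => hd t (uIoc_subset_uIcc ht) z (hrU hz)

end ParametricIntegrals

section Jets

open Filter Topology MeasureTheory intervalIntegral
open scoped ContDiff

universe u

set_option maxSynthPendingDepth 3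

variable {V W : Type u} [NormedAddCommGroup V] [NormedSpace ℝ V]
  [NormedAddCommGroup W] [NormedSpace ℝ W]

/-- Solutions of a smooth closed first order system are smooth. -/
lemma contDiffOn_of_closed_system {j : V → W} {S : V × W → V →L[ℝ] W} {Ω : Set (V × W)} {U : Set V}
    (hU : IsOpen U) (hmem : ∀ y ∈ U, (y, j y) ∈ Ω)
    (hd : ∀ y ∈ U, HasFDerivAt j (S (y, j y)) y) (hS : ContDiffOn ℝ ∞ S Ω) :
    ContDiffOn ℝ ∞ j U := by
  rw [contDiffOn_infty]
  intro n
  induction n with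
  | zero =>
    exact contDiffOn_zero.2 fun y hy => (hd y hy).continuousAt.continuousWithinAt
  | succ n ih =>
    rw [Nat.cast_add, Nat.cast_one, contDiffOn_succ_iff_fderiv_of_isOpen hU]
    refine ⟨fun y hy => (hd y hy).differentiableAt.differentiableWithinAt, by simp, ?_⟩
    have : ContDiffOn ℝ n (fun y => S (y, j y)) U :=
      (hS.of_le (by exact_mod_cast le_top)).comp (contDiffOn_id.prodMk ih) fun y hy => hmem y hy
    exact this.congr fun y hy => (hd y hy).fderiv

variable [FiniteDimensional ℝ V]

lemma contDiffOn_integral_jet_nat {J : ℝ → V → W} {S : V × W → V →L[ℝ] W} {Ω : Set (V × W)}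
    {U : Set V} {a b : ℝ} (hΩ : IsOpen Ω) (hU : IsOpen U)
    (hJ : ContinuousOn (uncurry J) (uIcc a b ×ˢ U))
    (hmem : ∀ t ∈ uIcc a b, ∀ y ∈ U, (y, J t y) ∈ Ω)
    (hd : ∀ t ∈ uIcc a b, ∀ y ∈ U, HasFDerivAt (J t) (S (y, J t y)) y)
    (hS : ContDiffOn ℝ ∞ S Ω) (n : ℕ) :
    ∀ {F : Type u} [NormedAddCommGroup F] [NormedSpace ℝ F] (K : V × W → F),
      ContDiffOn ℝ ∞ K Ω → ContDiffOn ℝ n (fun y => ∫ t in a..b, K (y, J t y)) U := by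
  have hgraph : ContinuousOn (fun z : ℝ × V => (z.2, J z.1 z.2)) (uIcc a b ×ˢ U) :=
    continuousOn_snd.prodMk hJ
  have hmaps : MapsTo (fun z : ℝ × V => (z.2, J z.1 z.2)) (uIcc a b ×ˢ U) Ω :=
    fun z hz => hmem z.1 hz.1 z.2 hz.2
  have key : ∀ {F : Type u} [NormedAddCommGroup F] [NormedSpace ℝ F] (K : V × W → F),
      ContDiffOn ℝ ∞ K Ω →
      ContDiffOn ℝ ∞ (fun z => (fderiv ℝ K z).comp ((ContinuousLinearMap.id ℝ V).prod (S z))) Ω ∧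
      ∀ y ∈ U, HasFDerivAt (fun y => ∫ t in a..b, K (y, J t y))
        (∫ t in a..b, (fun z => (fderiv ℝ K z).comp
          ((ContinuousLinearMap.id ℝ V).prod (S z))) (y, J t y)) y := by
    intro F _ _ K hK
    have h1 : ContDiffOn ℝ ∞
        (fun z => (fderiv ℝ K z).comp ((ContinuousLinearMap.id ℝ V).prod (S z))) Ω := by
      refine ContDiffOn.clm_comp (hK.fderiv_of_isOpen hΩ (by simp)) ?_
      exact ((ContinuousLinearMap.prodₗᵢ ℝ (𝕜 := ℝ) (E := V) (F := V) (G := W)).contDiff).comp_contDiffOn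
        (contDiffOn_const.prodMk hS)
    refine ⟨h1, fun y hy => ?_⟩
    refine hasFDerivAt_intervalIntegral (J := fun t y => K (y, J t y))
      (J' := fun t y => (fderiv ℝ K (y, J t y)).comp
        ((ContinuousLinearMap.id ℝ V).prod (S (y, J t y)))) hU ?_ ?_ ?_ hy
    · exact hK.continuousOn.comp hgraph hmaps
    · exact h1.continuousOn.comp hgraph hmaps
    · intro t ht y hy
      have hK' : HasFDerivAt K (fderiv ℝ K (y, J t y)) (y, J t y) :=
        ((hK.differentiableOn (by simp)).differentiableAt
          (hΩ.mem_nhds (hmem t ht y hy))).hasFDerivAt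
      exact hK'.comp y ((hasFDerivAt_id y).prodMk (hd t ht y hy))
  induction n with
  | zero =>
    intro F _ _ K hK
    exact contDiffOn_zero.2 fun y hy => ((key K hK).2 y hy).continuousAt.continuousWithinAt
  | succ n ih =>
    intro F _ _ K hK
    rw [Nat.cast_add, Nat.cast_one, contDiffOn_succ_iff_fderiv_of_isOpen hU]
    refine ⟨fun y hy => ((key K hK).2 y hy).differentiableAt.differentiableWithinAt, by simp, ?_⟩
    exact (ih _ (key K hK).1).congr fun y hy => ((key K hK).2 y hy).fderiv

lemma contDiffOn_integral_jet {J : ℝ → V → W} {S : V × W → V →L[ℝ] W} {Ω : Set (V × W)}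
    {U : Set V} {a b : ℝ} (hΩ : IsOpen Ω) (hU : IsOpen U)
    (hJ : ContinuousOn (uncurry J) (uIcc a b ×ˢ U))
    (hmem : ∀ t ∈ uIcc a b, ∀ y ∈ U, (y, J t y) ∈ Ω)
    (hd : ∀ t ∈ uIcc a b, ∀ y ∈ U, HasFDerivAt (J t) (S (y, J t y)) y)
    (hS : ContDiffOn ℝ ∞ S Ω) {F : Type u} [NormedAddCommGroup F] [NormedSpace ℝ F] {K : V × W → F}
    (hK : ContDiffOn ℝ ∞ K Ω) : ContDiffOn ℝ ∞ (fun y => ∫ t in a..b, K (y, J t y)) U :=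
  contDiffOn_infty.2 fun n => contDiffOn_integral_jet_nat hΩ hU hJ hmem hd hS n K hK

end Jets

section Generators

open Filter Topology MeasureTheory intervalIntegral
open scoped ContDiff

set_option maxSynthPendingDepth 3

universe u

variable {V : Type u} [NormedAddCommGroup V] [NormedSpace ℝ V] [FiniteDimensional ℝ V]

/-- The closed first order system satisfied by the `1`-jet of an isometry. -/
def isomSystem (Γ : V → V →L[ℝ] V →L[ℝ] V) (z : V × (V × (V →L[ℝ] V))) :
    V →L[ℝ] V × (V →L[ℝ] V) :=
  z.2.2.prod (isomHessian Γ z.1 z.2.1 z.2.2)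

lemma contDiffOn_isomSystem {Γ : V → V →L[ℝ] V →L[ℝ] V} {B : Set V} (hB : IsOpen B)
    (hΓ : ContDiffOn ℝ ∞ Γ B) :
    ContDiffOn ℝ ∞ (isomSystem Γ) (B ×ˢ (B ×ˢ (univ : Set (V →L[ℝ] V)))) := by
  intro z hz
  refine ContDiffAt.contDiffWithinAt ?_
  have h1 : ContDiffAt ℝ ∞ (fun z : V × (V × (V →L[ℝ] V)) => Γ z.1) z :=
    ContDiffAt.comp z (hΓ.contDiffAt (hB.mem_nhds hz.1)) contDiffAt_fst
  have h2 : ContDiffAt ℝ ∞ (fun z : V × (V × (V →L[ℝ] V)) => Γ z.2.1) z :=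
    ContDiffAt.comp (g := Γ) z (hΓ.contDiffAt (hB.mem_nhds hz.2.1)) (by fun_prop)
  have hL : ContDiffAt ℝ ∞ (fun z : V × (V × (V →L[ℝ] V)) => z.2.2) z := by fun_prop
  refine contDiffAt_clm_of_apply fun u => ?_
  refine ContDiffAt.prodMk (f := fun z : V × (V × (V →L[ℝ] V)) => z.2.2 u)
    (g := fun z : V × (V × (V →L[ℝ] V)) => isomHessian Γ z.1 z.2.1 z.2.2 u)
    (hL.clm_apply contDiffAt_const) ?_
  refine contDiffAt_clm_of_apply fun v => ?_
  simp only [isomHessian_apply]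
  exact (hL.clm_apply ((h1.clm_apply contDiffAt_const).clm_apply contDiffAt_const)).sub
    ((h2.clm_apply (hL.clm_apply contDiffAt_const)).clm_apply (hL.clm_apply contDiffAt_const))

variable {G : V → V →L[ℝ] V →L[ℝ] ℝ} {Γ : V → V →L[ℝ] V →L[ℝ] V} {B U : Set V} {m C d : ℝ}

lemma IsIsomFamily.hasFDerivAt_jet {S : Type*} [TopologicalSpace S] {s : Set S} {f f' : S → V → V}
    {L L' : S → V → V →L[ℝ] V} (hf : IsIsomFamily G B d U s f f' L L')
    (hb : MetricBounds G Γ B m C) (hB : IsOpen B) (hΓ : ContinuousOn Γ B) (hd : 0 < d)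
    {a : S} (ha : a ∈ s) {y : V} (hy : y ∈ U) :
    HasFDerivAt (fun y => (f a y, L a y)) (isomSystem Γ (y, (f a y, L a y))) y :=
  ((hf.isom a ha y hy).fwd.hasFDerivAt y (Metric.mem_ball_self hd)).prodMk
    (hf.hasFDerivAt_deriv hb hd hΓ hB ha hy)

omit [FiniteDimensional ℝ V] in
lemma IsIsomFamily.jet_mem {S : Type*} [TopologicalSpace S] {s : Set S} {f f' : S → V → V}
    {L L' : S → V → V →L[ℝ] V} (hf : IsIsomFamily G B d U s f f' L L') (hd : 0 < d)
    {a : S} (ha : a ∈ s) {y : V} (hy : y ∈ U) :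
    (y, (f a y, L a y)) ∈ B ×ˢ (B ×ˢ (univ : Set (V →L[ℝ] V))) :=
  ⟨(hf.isom a ha y hy).fwd.ball_subset (Metric.mem_ball_self hd),
    (hf.isom a ha y hy).fwd.ball_subset' (Metric.mem_ball_self hd), mem_univ _⟩

lemma IsIsomFamily.contDiffOn {S : Type*} [TopologicalSpace S] {s : Set S} {f f' : S → V → V}
    {L L' : S → V → V →L[ℝ] V} (hf : IsIsomFamily G B d U s f f' L L')
    (hb : MetricBounds G Γ B m C) (hB : IsOpen B) (hΓ : ContDiffOn ℝ ∞ Γ B) (hd : 0 < d)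
    {a : S} (ha : a ∈ s) : ContDiffOn ℝ ∞ (f a) U :=
  (contDiffOn_of_closed_system hf.isOpen (fun _ hy => hf.jet_mem hd ha hy)
    (fun _ hy => hf.hasFDerivAt_jet hb hB hΓ.continuousOn hd ha hy)
    (contDiffOn_isomSystem hB hΓ)).fst

/-- A one-parameter local group of isometries, written in a chart. -/
structure IsIsomFlow (G : V → V →L[ℝ] V →L[ℝ] ℝ) (B : Set V) (d : ℝ) (U : Set V) (ε : ℝ)
    (f : ℝ → V → V) (f' : ℝ → V → V) (L L' : ℝ → V → V →L[ℝ] V) : Prop where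
  family : IsIsomFamily G B d U (Icc (-ε) ε) f f' L L'
  zero : ∀ y ∈ U, f 0 y = y
  add : ∀ t ∈ Icc (-ε) ε, ∀ h ∈ Icc (-ε) ε, t + h ∈ Icc (-ε) ε → ∀ y ∈ U, f h y ∈ U →
    f t (f h y) = f (t + h) y

variable {f f' : ℝ → V → V} {L L' : ℝ → V → V →L[ℝ] V} {ε₀ : ℝ}

lemma isInvertible_of_norm_sub_id_lt {A : V →L[ℝ] V} {c : ℝ} (hc : 0 < c)
    (h : ∀ v, ‖A v - c • v‖ ≤ c / 2 * ‖v‖) : A.IsInvertible := by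
  have hinj : Injective A := by
    rw [injective_iff_map_eq_zero]
    intro v hv
    have h1 := h v
    rw [hv, zero_sub, norm_neg, norm_smul, Real.norm_of_nonneg hc.le] at h1
    have : c * ‖v‖ ≤ 0 := by nlinarith [norm_nonneg v]
    exact norm_le_zero_iff.1 (nonpos_of_mul_nonpos_right this hc)
  exact ⟨(LinearEquiv.ofInjectiveEndo (A : V →ₗ[ℝ] V) hinj).toContinuousLinearEquiv, by ext v; rfl⟩

omit [FiniteDimensional ℝ V] in
lemma IsIsomFlow.deriv_zero (hf : IsIsomFlow G B d U ε₀ f f' L L') (hε₀ : 0 < ε₀) (hd : 0 < d)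
    {y : V} (hy : y ∈ U) : L 0 y = ContinuousLinearMap.id ℝ V := by
  have h1 : HasFDerivAt (f 0) (L 0 y) y :=
    (hf.family.isom 0 ⟨by linarith, hε₀.le⟩ y hy).fwd.hasFDerivAt y (Metric.mem_ball_self hd)
  have h2 : HasFDerivAt (f 0) (ContinuousLinearMap.id ℝ V) y := by
    refine (hasFDerivAt_id y).congr_of_eventuallyEq ?_
    filter_upwards [hf.family.isOpen.mem_nhds hy] with z hz using hf.zero z hz
  exact h1.unique h2

omit [FiniteDimensional ℝ V] in
lemma IsIsomFlow.continuousAt_slice (hf : IsIsomFlow G B d U ε₀ f f' L L') {t : ℝ}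
    (ht : t ∈ Ioo (-ε₀) ε₀) {y : V} (hy : y ∈ U) : ContinuousAt (fun t => f t y) t := by
  have h1 : ContinuousAt (uncurry f) (t, y) := hf.family.continuousOn.continuousAt
    (prod_mem_nhds (Icc_mem_nhds ht.1 ht.2) (hf.family.isOpen.mem_nhds hy))
  exact ContinuousAt.comp (g := uncurry f) (f := fun t : ℝ => (t, y)) h1 (by fun_prop)

/-- A one-parameter local group of isometries is generated by a smooth vector field. -/
lemma IsIsomFlow.exists_generator_aux (hf : IsIsomFlow G B d U ε₀ f f' L L')
    (hb : MetricBounds G Γ B m C) (hB : IsOpen B) (hΓ : ContDiffOn ℝ ∞ Γ B) (hd : 0 < d)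
    (hε₀ : 0 < ε₀) {y₀ : V} (hy₀ : y₀ ∈ U) :
    ∃ (X : V → V) (U' : Set V), IsOpen U' ∧ y₀ ∈ U' ∧ U' ⊆ U ∧ ContDiffOn ℝ ∞ X U' ∧
      ∀ y ∈ U', HasDerivAt (fun t => f t y) (X y) 0 := by
  have hUo := hf.family.isOpen
  have hLc : ContinuousOn (uncurry L) (Icc (-ε₀) ε₀ ×ˢ U) := hf.family.continuousOn_deriv hb hd
  have h0mem : (0 : ℝ) ∈ Icc (-ε₀) ε₀ := ⟨by linarith, hε₀.le⟩
  -- a small averaging interval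
  obtain ⟨ε, hε, hεε₀, hLε⟩ : ∃ ε > 0, ε < ε₀ ∧
      ∀ t ∈ Icc 0 ε, ‖L t y₀ - ContinuousLinearMap.id ℝ V‖ ≤ 1 / 2 := by
    have h1 : ContinuousAt (uncurry L) (0, y₀) := hLc.continuousAt
      (prod_mem_nhds (Icc_mem_nhds (by linarith) hε₀) (hUo.mem_nhds hy₀))
    have h2 : ContinuousAt (fun t => L t y₀) 0 :=
      ContinuousAt.comp (g := uncurry L) (f := fun t : ℝ => (t, y₀)) h1 (by fun_prop)
    have h3 : ∀ᶠ t in 𝓝 (0 : ℝ), ‖L t y₀ - ContinuousLinearMap.id ℝ V‖ < 1 / 2 := by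
      have h4 : ContinuousAt (fun t => ‖L t y₀ - ContinuousLinearMap.id ℝ V‖) 0 := by fun_prop
      refine h4.eventually_lt_const ?_
      show ‖L 0 y₀ - ContinuousLinearMap.id ℝ V‖ < 1 / 2
      rw [hf.deriv_zero hε₀ hd hy₀]
      simp
    obtain ⟨δ, hδ, hδ'⟩ := Metric.eventually_nhds_iff.1 h3
    refine ⟨min (δ / 2) (ε₀ / 2), by positivity, ?_, fun t ht => (hδ' ?_).le⟩
    · exact (min_le_right _ _).trans_lt (by linarith)
    · rw [Real.dist_eq, sub_zero, abs_of_nonneg ht.1]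
      exact (ht.2.trans (min_le_left _ _)).trans_lt (by linarith)
  have hsub : uIcc 0 ε ⊆ Icc (-ε₀) ε₀ := by
    rw [uIcc_of_le hε.le]
    exact Icc_subset_Icc (by linarith) hεε₀.le
  have hfc : ContinuousOn (uncurry f) (uIcc 0 ε ×ˢ U) :=
    hf.family.continuousOn.mono (prod_mono_left hsub)
  have hLc' : ContinuousOn (uncurry L) (uIcc 0 ε ×ˢ U) := hLc.mono (prod_mono_left hsub)
  set F : V → V := fun y => ∫ t in (0 : ℝ)..ε, f t y with hF
  have hFsmooth : ContDiffOn ℝ ∞ F U := by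
    refine contDiffOn_integral_jet (J := fun t y => (f t y, L t y)) (S := isomSystem Γ)
      (K := fun z : V × (V × (V →L[ℝ] V)) => z.2.1)
      (Ω := B ×ˢ (B ×ˢ (univ : Set (V →L[ℝ] V)))) (hB.prod (hB.prod isOpen_univ)) hUo
      (hfc.prodMk hLc') ?_ ?_ (contDiffOn_isomSystem hB hΓ) (by fun_prop)
    · exact fun t ht y hy => hf.family.jet_mem hd (hsub ht) hy
    · exact fun t ht y hy => hf.family.hasFDerivAt_jet hb hB hΓ.continuousOn hd (hsub ht) hy
  have hF' : HasFDerivAt F (∫ t in (0 : ℝ)..ε, L t y₀) y₀ :=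
    hasFDerivAt_intervalIntegral hUo hfc hLc' (fun t ht y hy =>
      (hf.family.isom t (hsub ht) y hy).fwd.hasFDerivAt y (Metric.mem_ball_self hd)) hy₀
  have hinv : (fderiv ℝ F y₀).IsInvertible := by
    rw [hF'.fderiv]
    refine isInvertible_of_norm_sub_id_lt hε fun v => ?_
    have h_integral : IntervalIntegrable (fun t => L t y₀) volume 0 ε :=
      (hLc'.slice_right hy₀).intervalIntegrable
    have e : (∫ t in (0 : ℝ)..ε, L t y₀) v - ε • v
        = (∫ t in (0 : ℝ)..ε, (L t y₀ - ContinuousLinearMap.id ℝ V)) v := by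
      rw [integral_sub h_integral intervalIntegrable_const, intervalIntegral.integral_const]
      simp
    rw [e]
    refine ContinuousLinearMap.le_of_opNorm_le _ ?_ v
    have h1 := norm_integral_le_of_norm_le_const (a := (0 : ℝ)) (b := ε) (C := 1 / 2)
      (f := fun t => L t y₀ - ContinuousLinearMap.id ℝ V) fun t ht => hLε t (by
        rw [uIoc_of_le hε.le] at ht; exact ⟨ht.1.le, ht.2⟩)
    rw [sub_zero, abs_of_pos hε] at h1
    linarith
  have hF'c : ContinuousOn (fderiv ℝ F) U :=
    hFsmooth.continuousOn_fderiv_of_isOpen hUo (by simp)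
  have hopen : IsOpen {A : V →L[ℝ] V | A.IsInvertible} := by
    have : {A : V →L[ℝ] V | A.IsInvertible} = range ((↑) : (V ≃L[ℝ] V) → V →L[ℝ] V) := rfl
    rw [this]
    exact ContinuousLinearEquiv.isOpen
  refine ⟨fun y => (fderiv ℝ F y).inverse (f ε y - y), U ∩ fderiv ℝ F ⁻¹' {A | A.IsInvertible},
    hF'c.isOpen_inter_preimage hUo hopen, ⟨hy₀, hinv⟩, inter_subset_left, ?_, ?_⟩
  · intro y hy
    refine ContDiffAt.contDiffWithinAt (ContDiffAt.clm_apply ?_ ?_)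
    · obtain ⟨e, he⟩ := hy.2
      refine ContDiffAt.comp (g := ContinuousLinearMap.inverse) y ?_
        ((hFsmooth.contDiffAt (hUo.mem_nhds hy.1)).fderiv_right (m := ∞) (by simp))
      rw [← he]
      exact contDiffAt_map_inverse e
    · exact ((hf.family.contDiffOn hb hB hΓ hd
        ⟨by linarith, hεε₀.le⟩).contDiffAt (hUo.mem_nhds hy.1)).sub contDiffAt_id
  · rintro y ⟨hy, e, he⟩
    have hs : HasStrictFDerivAt F (e : V →L[ℝ] V) y := by
      rw [he]
      exact (hFsmooth.contDiffAt (hUo.mem_nhds hy)).hasStrictFDerivAt (by simp)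
    have hcy : ∀ t ∈ Ioo (-ε₀) ε₀, ContinuousAt (fun t => f t y) t :=
      fun t ht => hf.continuousAt_slice ht hy
    have hc0 : Tendsto (fun h => f h y) (𝓝 0) (𝓝 y) := by
      have := hcy 0 ⟨by linarith, hε₀⟩
      rwa [ContinuousAt, hf.zero y hy] at this
    -- the averaged orbit
    have hFf : ∀ᶠ h in 𝓝 (0 : ℝ), F (f h y) = ∫ t in h..(h + ε), f t y := by
      filter_upwards [hc0 (hUo.mem_nhds hy),
        Ioo_mem_nhds (show -(ε₀ - ε) < (0 : ℝ) by linarith) (show (0 : ℝ) < ε₀ - ε by linarith)]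
        with h hh hhI
      have e1 : F (f h y) = ∫ t in (0 : ℝ)..ε, f (t + h) y := by
        refine integral_congr fun t ht => ?_
        have ht' := hsub ht
        rw [uIcc_of_le hε.le] at ht
        exact hf.add t ht' h ⟨by linarith [hhI.1], by linarith [hhI.2]⟩
          ⟨by linarith [hhI.1, ht.1], by linarith [hhI.2, ht.2]⟩ y hy hh
      rw [e1, integral_comp_add_right (fun t => f t y) h, zero_add, add_comm ε h]
    have hII : ∀ p q : ℝ, p ∈ Ioo (-ε₀) ε₀ → q ∈ Ioo (-ε₀) ε₀ →
        IntervalIntegrable (fun t => f t y) volume p q := by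
      intro p q hp hq
      refine ContinuousOn.intervalIntegrable fun t ht => (hcy t ?_).continuousWithinAt
      exact (ordConnected_Ioo.uIcc_subset hp hq) ht
    have hmeasAt : ∀ p ∈ Ioo (-ε₀) ε₀, StronglyMeasurableAtFilter (fun t => f t y) (𝓝 p) := by
      intro p hp
      exact ContinuousAt.stronglyMeasurableAtFilter isOpen_Ioo hcy p hp
    have hder : HasDerivAt (fun h => ∫ t in h..(h + ε), f t y) (f ε y - y) 0 := by
      have i0 : (0 : ℝ) ∈ Ioo (-ε₀) ε₀ := ⟨by linarith, hε₀⟩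
      have iε : ε ∈ Ioo (-ε₀) ε₀ := ⟨by linarith, hεε₀⟩
      have k1 : HasDerivAt (fun h => ∫ t in (0 : ℝ)..h, f t y) (f 0 y) 0 :=
        integral_hasDerivAt_right (hII 0 0 i0 i0) (hmeasAt 0 i0) (hcy 0 i0)
      have k2 : HasDerivAt (fun h => ∫ t in (0 : ℝ)..h, f t y) (f ε y) (0 + ε) := by
        rw [zero_add]
        exact integral_hasDerivAt_right (hII 0 ε i0 iε) (hmeasAt ε iε) (hcy ε iε)
      have k3 : HasDerivAt (fun h => ∫ t in (0 : ℝ)..(h + ε), f t y) (f ε y) 0 :=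
        k2.comp_add_const 0 ε
      have k4 := k3.sub k1
      rw [hf.zero y hy] at k4
      refine k4.congr_of_eventuallyEq ?_
      filter_upwards [Ioo_mem_nhds (show -(ε₀ - ε) < (0 : ℝ) by linarith)
        (show (0 : ℝ) < ε₀ - ε by linarith)] with h hhI
      exact (integral_interval_sub_left
        (hII 0 (h + ε) i0 ⟨by linarith [hhI.1], by linarith [hhI.2]⟩)
        (hII 0 h i0 ⟨by linarith [hhI.1], by linarith [hhI.2]⟩)).symm
    have hval : (∫ t in (0 : ℝ)..(0 + ε), f t y) = F y := by rw [zero_add]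
    have hinvF : HasFDerivAt (hs.localInverse F e y) (e.symm : V →L[ℝ] V)
        (∫ t in (0 : ℝ)..(0 + ε), f t y) := by
      rw [hval]
      exact hs.to_localInverse.hasFDerivAt
    have hcomp := hinvF.comp_hasDerivAt (0 : ℝ) hder
    have hX : (fderiv ℝ F y).inverse (f ε y - y) = (e.symm : V →L[ℝ] V) (f ε y - y) := by
      rw [← he, ContinuousLinearMap.inverse_equiv]
    simp only [hX]
    refine hcomp.congr_of_eventuallyEq ?_
    filter_upwards [hFf, hc0.eventually hs.eventually_left_inverse] with h h1 h2
    simp only [Function.comp]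
    rw [← h1, h2]

/-- The flow equation and its linearisation for the generator of a local group of isometries. -/
theorem IsIsomFlow.exists_generator (hf : IsIsomFlow G B d U ε₀ f f' L L')
    (hb : MetricBounds G Γ B m C) (hB : IsOpen B) (hΓ : ContDiffOn ℝ ∞ Γ B) (hd : 0 < d)
    (hε₀ : 0 < ε₀) {y₀ : V} (hy₀ : y₀ ∈ U) :
    ∃ (X : V → V) (U' : Set V), IsOpen U' ∧ y₀ ∈ U' ∧ U' ⊆ U ∧ ContDiffOn ℝ ∞ X U' ∧
      (∀ y ∈ U', HasDerivAt (fun t => f t y) (X y) 0) ∧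
      ∀ y ∈ U', HasDerivAt (fun t => L t y) (fderiv ℝ X y) 0 := by
  obtain ⟨X, U', hU'o, hyU', hU'U, hX, hgen⟩ :=
    hf.exists_generator_aux hb hB hΓ hd hε₀ hy₀
  refine ⟨X, U', hU'o, hyU', hU'U, hX, hgen, fun y hy => ?_⟩
  have hUo := hf.family.isOpen
  have hLc : ContinuousOn (uncurry L) (Icc (-ε₀) ε₀ ×ˢ U) := hf.family.continuousOn_deriv hb hd
  have hcont : ContinuousAt (uncurry f) (0, y) := hf.family.continuousOn.continuousAt
    (prod_mem_nhds (Icc_mem_nhds (by linarith) hε₀) (hUo.mem_nhds (hU'U hy)))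
  have hev : ∀ᶠ z : ℝ × V in 𝓝 (0, y), f z.1 z.2 ∈ U' := by
    refine hcont.eventually_mem (hU'o.mem_nhds ?_)
    show f 0 y ∈ U'
    rwa [hf.zero y (hU'U hy)]
  obtain ⟨σ₀, hσ₀, hσ⟩ := Metric.eventually_nhds_iff_ball.1
    (hev.and (prod_mem_nhds (Ioo_mem_nhds (show -ε₀ < 0 by linarith) hε₀) (hU'o.mem_nhds hy)))
  set σ := σ₀ / 2 with hσdef
  have hσpos : 0 < σ := by positivity
  set N := Metric.ball y σ with hN
  have hmem : ∀ t ∈ Icc (-σ) σ, ∀ z ∈ N, f t z ∈ U' ∧ t ∈ Ioo (-ε₀) ε₀ ∧ z ∈ U' := by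
    intro t ht z hz
    have := hσ (t, z) (by
      rw [Metric.mem_ball, Prod.dist_eq, max_lt_iff, Real.dist_eq, sub_zero]
      refine ⟨(abs_le.2 ht).trans_lt (by linarith), ?_⟩
      exact (Metric.mem_ball.1 hz).trans (by linarith))
    exact ⟨this.1, this.2.1, this.2.2⟩
  have hyN : y ∈ N := Metric.mem_ball_self hσpos
  have hder : ∀ t ∈ Icc (-σ) σ, ∀ z ∈ N, HasDerivAt (fun s => f s z) (X (f t z)) t := by
    intro t ht z hz
    obtain ⟨h1, h2, h3⟩ := hmem t ht z hz
    have h4 := hgen _ h1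
    rw [← sub_self t] at h4
    have h5 := h4.comp_sub_const t t
    refine h5.congr_of_eventuallyEq ?_
    have h6 : ∀ᶠ s in 𝓝 t, s - t ∈ Icc (-ε₀) ε₀ := by
      have : Tendsto (fun s : ℝ => s - t) (𝓝 t) (𝓝 0) := by
        have : ContinuousAt (fun s : ℝ => s - t) t := by fun_prop
        simpa [ContinuousAt] using this
      exact this (Icc_mem_nhds (by linarith) hε₀)
    filter_upwards [h6, Icc_mem_nhds h2.1 h2.2] with s hs hs'
    rw [hf.add (s - t) hs t ⟨h2.1.le, h2.2.le⟩ (by simpa using hs') z (hU'U h3) (hU'U h1)]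
    simp
  have hfcN : ContinuousOn (uncurry f) (Icc (-σ) σ ×ˢ N) := hf.family.continuousOn.mono
    fun z hz => ⟨⟨(hmem z.1 hz.1 z.2 hz.2).2.1.1.le, (hmem z.1 hz.1 z.2 hz.2).2.1.2.le⟩,
      hU'U (hmem z.1 hz.1 z.2 hz.2).2.2⟩
  have hLcN : ContinuousOn (uncurry L) (Icc (-σ) σ ×ˢ N) := hLc.mono
    fun z hz => ⟨⟨(hmem z.1 hz.1 z.2 hz.2).2.1.1.le, (hmem z.1 hz.1 z.2 hz.2).2.1.2.le⟩,
      hU'U (hmem z.1 hz.1 z.2 hz.2).2.2⟩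
  have hXf : ContinuousOn (uncurry fun t z => X (f t z)) (Icc (-σ) σ ×ˢ N) :=
    hX.continuousOn.comp hfcN fun z hz => (hmem z.1 hz.1 z.2 hz.2).1
  have hDX : ContinuousOn (fderiv ℝ X) U' := hX.continuousOn_fderiv_of_isOpen hU'o (by simp)
  have hDXf : ContinuousOn (uncurry fun t z => (fderiv ℝ X (f t z)).comp (L t z))
      (Icc (-σ) σ ×ˢ N) :=
    (hDX.comp hfcN fun z hz => (hmem z.1 hz.1 z.2 hz.2).1).clm_comp hLcN
  have h0σ : (0 : ℝ) ∈ Icc (-σ) σ := ⟨by linarith, hσpos.le⟩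
  have hsubσ : ∀ s ∈ Icc (-σ) σ, uIcc 0 s ⊆ Icc (-σ) σ :=
    fun s hs => ordConnected_Icc.uIcc_subset h0σ hs
  have h_integral : ∀ s ∈ Icc (-σ) σ, ∀ z ∈ N, f s z = z + ∫ t in (0 : ℝ)..s, X (f t z) := by
    intro s hs z hz
    rw [integral_eq_sub_of_hasDerivAt (f := fun t => f t z)
      (fun t ht => hder t (hsubσ s hs ht) z hz)
      ((hXf.mono (prod_mono_left (hsubσ s hs))).slice_right hz).intervalIntegrable]
    simp only [hf.zero z (hU'U (hmem s hs z hz).2.2)]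
    abel
  have hfd : ∀ t ∈ Icc (-σ) σ, ∀ z ∈ N, HasFDerivAt (f t) (L t z) z := by
    intro t ht z hz
    obtain ⟨h1, h2, h3⟩ := hmem t ht z hz
    exact (hf.family.isom t ⟨h2.1.le, h2.2.le⟩ z (hU'U h3)).fwd.hasFDerivAt z
      (Metric.mem_ball_self hd)
  have hLint : ∀ s ∈ Icc (-σ) σ, L s y = ContinuousLinearMap.id ℝ V
      + ∫ t in (0 : ℝ)..s, (fderiv ℝ X (f t y)).comp (L t y) := by
    intro s hs
    have k1 := hasFDerivAt_intervalIntegral (J := fun t z => X (f t z)) Metric.isOpen_ball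
      (hXf.mono (prod_mono_left (hsubσ s hs))) (hDXf.mono (prod_mono_left (hsubσ s hs)))
      (fun t ht z hz => by
        have ht' := hsubσ s hs ht
        have : HasFDerivAt X (fderiv ℝ X (f t z)) (f t z) :=
          ((hX.differentiableOn (by simp)).differentiableAt
            (hU'o.mem_nhds (hmem t ht' z hz).1)).hasFDerivAt
        exact this.comp z (hfd t ht' z hz)) hyN
    have k2 : HasFDerivAt (f s) (ContinuousLinearMap.id ℝ V
        + ∫ t in (0 : ℝ)..s, (fderiv ℝ X (f t y)).comp (L t y)) y := by
      refine ((hasFDerivAt_id y).add k1).congr_of_eventuallyEq ?_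
      filter_upwards [Metric.isOpen_ball.mem_nhds hyN] with z hz using h_integral s hs z hz
    exact (hfd s hs y hyN).unique k2
  have hc : ContinuousOn (fun t => (fderiv ℝ X (f t y)).comp (L t y)) (Icc (-σ) σ) :=
    hDXf.comp (f := fun t : ℝ => (t, y)) (by fun_prop) fun t ht => ⟨ht, hyN⟩
  have hnhds : Icc (-σ) σ ∈ 𝓝 (0 : ℝ) := Icc_mem_nhds (by linarith) hσpos
  have hFTC : HasDerivAt (fun s => ∫ t in (0 : ℝ)..s, (fderiv ℝ X (f t y)).comp (L t y))
      ((fderiv ℝ X (f 0 y)).comp (L 0 y)) 0 :=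
    integral_hasDerivAt_right (by simp)
      (ContinuousOn.stronglyMeasurableAtFilter isOpen_Ioo (hc.mono Ioo_subset_Icc_self) 0
        ⟨by linarith, hσpos⟩) (hc.continuousAt hnhds)
  rw [hf.zero y (hU'U hy), hf.deriv_zero hε₀ hd (hU'U hy), ContinuousLinearMap.comp_id] at hFTC
  refine (hFTC.const_add (ContinuousLinearMap.id ℝ V)).congr_of_eventuallyEq ?_
  filter_upwards [hnhds] with s hs using hLint s hs

end Generators

section Charts

open Filter Topology
open scoped ContDiff

variable [I.Boundaryless]

/-- The differential of the preferred chart at `x₀`. -/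
def chartD (I : ModelWithCorners ℝ E H) {M : Type*} [TopologicalSpace M] [ChartedSpace H M]
    (x₀ x : M) : TangentSpace I x →L[ℝ] E :=
  mfderiv I 𝓘(ℝ, E) (extChartAt I x₀) x

/-- The expression of a vector field in the preferred chart at `x₀`. -/
def chartV (I : ModelWithCorners ℝ E H) {M : Type*} [TopologicalSpace M] [ChartedSpace H M]
    (x₀ : M) (V : VF I M) (y : E) : E :=
  chartD I x₀ ((extChartAt I x₀).symm y) (V ((extChartAt I x₀).symm y))

omit [I.Boundaryless] in
lemma isInvertible_chartD {x₀ x : M} (hx : x ∈ (extChartAt I x₀).source) :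
    (chartD I x₀ x).IsInvertible :=
  isInvertible_mfderiv_extChartAt hx

omit [I.Boundaryless] in
lemma chartD_inverse_apply {x₀ x : M} (hx : x ∈ (extChartAt I x₀).source) (u : E) :
    chartD I x₀ x ((chartD I x₀ x).inverse u) = u :=
  (isInvertible_chartD hx).self_apply_inverse u

omit [I.Boundaryless] in
lemma chartD_inverse_chartD {x₀ x : M} (hx : x ∈ (extChartAt I x₀).source)
    (v : TangentSpace I x) : (chartD I x₀ x).inverse (chartD I x₀ x v) = v :=
  (isInvertible_chartD hx).inverse_apply_self v

omit [I.Boundaryless] in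
lemma chartD_injective {x₀ x : M} (hx : x ∈ (extChartAt I x₀).source) :
    Injective (chartD I x₀ x) :=
  LeftInverse.injective (g := (chartD I x₀ x).inverse) (chartD_inverse_chartD hx)

omit [IsManifold I (⊤ : ℕ∞) M] [I.Boundaryless] in
lemma chartV_extChartAt (x₀ : M) (V : VF I M) {x : M} (hx : x ∈ (extChartAt I x₀).source) :
    chartV I x₀ V (extChartAt I x₀ x) = chartD I x₀ x (V x) := by
  rw [chartV, (extChartAt I x₀).left_inv hx]

lemma contMDiffAt_iff_comp_symm {F : Type*} [NormedAddCommGroup F] [NormedSpace ℝ F] {f : M → F}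
    {n : WithTop ℕ∞} (hn : n ≤ (⊤ : ℕ∞)) {x₀ x : M} (hx : x ∈ (extChartAt I x₀).source) :
    ContMDiffAt I 𝓘(ℝ, F) n f x ↔
      ContDiffAt ℝ n (f ∘ (extChartAt I x₀).symm) (extChartAt I x₀ x) := by
  have : IsManifold I n M := IsManifold.of_le hn
  have h := contMDiffAt_iff_source_of_mem_source (I := I) (I' := 𝓘(ℝ, F)) (n := n) (f := f)
    (x := x₀) (x' := x) (by simpa using hx)
  rw [h, I.range_eq_univ, contMDiffWithinAt_univ, contMDiffAt_iff_contDiffAt]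

omit [I.Boundaryless] in
lemma contMDiffAt_vf_iff {V : VF I M} {x₀ x : M} (hx : x ∈ (extChartAt I x₀).source) :
    ContMDiffAt I I.tangent (⊤ : ℕ∞) (fun x => (⟨x, V x⟩ : TangentBundle I M)) x ↔
      ContMDiffAt I 𝓘(ℝ, E) (⊤ : ℕ∞) (fun x => chartD I x₀ x (V x)) x := by
  have : IsManifold I (((⊤ : ℕ∞) : WithTop ℕ∞) + 1) M := ‹IsManifold I (⊤ : ℕ∞) M›
  have hx' : x ∈ (chartAt H x₀).source := by simpa using hx
  have h := (trivializationAt E (TangentSpace I) x₀).contMDiffAt_section_iff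
    (IB := I) (n := (⊤ : ℕ∞)) (s := V) (x₀ := x) (by simpa using hx')
  refine h.trans ?_
  refine Filter.EventuallyEq.contMDiffAt_iff ?_
  filter_upwards [(chartAt H x₀).open_source.mem_nhds hx'] with z hz
  rw [chartD, ← TangentBundle.continuousLinearMapAt_trivializationAt hz]
  rw [Bundle.Trivialization.continuousLinearMapAt_apply, Bundle.Trivialization.coe_linearMapAt_of_mem]
  simpa using hz

/-- A vector field is smooth iff its expressions in charts are. -/
lemma contMDiffAt_vf_iff_chartV {V : VF I M} {x₀ x : M} (hx : x ∈ (extChartAt I x₀).source) :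
    ContMDiffAt I I.tangent (⊤ : ℕ∞) (fun x => (⟨x, V x⟩ : TangentBundle I M)) x ↔
      ContDiffAt ℝ (⊤ : ℕ∞) (chartV I x₀ V) (extChartAt I x₀ x) := by
  rw [contMDiffAt_vf_iff hx, contMDiffAt_iff_comp_symm le_rfl hx]
  rfl

lemma SmoothVF.contDiffAt_chartV {V : VF I M} (hV : SmoothVF I V) {x₀ x : M}
    (hx : x ∈ (extChartAt I x₀).source) : ContDiffAt ℝ ∞ (chartV I x₀ V) (extChartAt I x₀ x) :=
  (contMDiffAt_vf_iff_chartV hx).1 (hV x)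

lemma smoothVF_of_chartV {V : VF I M}
    (h : ∀ x₀, ContDiffAt ℝ ∞ (chartV I x₀ V) (extChartAt I x₀ x₀)) : SmoothVF I V :=
  fun x => (contMDiffAt_vf_iff_chartV (mem_extChartAt_source x)).2 (h x)

lemma vderiv_eq_fderiv {V : VF I M} {f : M → ℝ} {x₀ : M}
    (hf : MDifferentiableAt I 𝓘(ℝ) f x₀) :
    vderiv I V f x₀ = fderiv ℝ (f ∘ (extChartAt I x₀).symm) (extChartAt I x₀ x₀)
      (chartV I x₀ V (extChartAt I x₀ x₀)) := by
  obtain ⟨L, hL⟩ : ∃ L : E →L[ℝ] ℝ, L = mfderiv I 𝓘(ℝ) f x₀ := ⟨_, rfl⟩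
  have h : HasFDerivWithinAt (f ∘ (extChartAt I x₀).symm) L (range I) (extChartAt I x₀ x₀) := by
    rw [hL]
    exact hf.hasMFDerivAt.2
  rw [I.range_eq_univ, hasFDerivWithinAt_univ] at h
  rw [vderiv, chartV_extChartAt _ _ (mem_extChartAt_source x₀), chartD, mfderiv_extChartAt_self]
  rw [h.fderiv, hL]
  rfl

lemma chartD_vfLie (V W : VF I M) (x₀ : M) :
    chartD I x₀ x₀ (vfLie I V W x₀)
      = VectorField.lieBracket ℝ (chartV I x₀ V) (chartV I x₀ W) (extChartAt I x₀ x₀) := by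
  have h := mfderiv_extChartAt_comp_mfderivWithin_extChartAt_symm' (I := I)
    (mem_extChartAt_source (I := I) x₀)
  rw [I.range_eq_univ, mfderivWithin_univ] at h
  exact DFunLike.congr_fun h _

lemma vfLie_eq_mlieBracket (V W : VF I M) : vfLie I V W = VectorField.mlieBracket I V W := by
  funext x₀
  apply chartD_injective (I := I) (mem_extChartAt_source x₀)
  rw [chartD_vfLie, ← VectorField.mlieBracketWithin_univ, VectorField.mlieBracketWithin_apply]
  erw [chartD_inverse_apply (I := I) (mem_extChartAt_source x₀)]
  rw [preimage_univ, univ_inter, I.range_eq_univ]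
  have key : ∀ V : VF I M, chartV I x₀ V =ᶠ[𝓝 (extChartAt I x₀ x₀)]
      VectorField.mpullbackWithin 𝓘(ℝ, E) I (extChartAt I x₀).symm V univ := by
    intro V
    filter_upwards [extChartAt_target_mem_nhds (I := I) x₀] with y hy
    rw [VectorField.mpullbackWithin_apply, chartV]
    have h1 := isInvertible_mfderivWithin_extChartAt_symm (I := I) hy
    have h2 := mfderiv_extChartAt_comp_mfderivWithin_extChartAt_symm (I := I) hy
    rw [I.range_eq_univ] at h1 h2
    obtain ⟨e, he⟩ := h1
    rw [← he] at h2 ⊢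
    rw [ContinuousLinearMap.inverse_equiv]
    have h3 := DFunLike.congr_fun h2 (e.symm (V ((extChartAt I x₀).symm y)))
    have h4 : chartD I x₀ ((extChartAt I x₀).symm y)
        (e (e.symm (V ((extChartAt I x₀).symm y)))) = e.symm (V ((extChartAt I x₀).symm y)) := h3
    rw [e.apply_symm_apply] at h4
    exact h4
  exact (Filter.EventuallyEq.lieBracket_vectorField_eq (key V) (key W)).trans
    (congrFun (VectorField.lieBracketWithin_univ (𝕜 := ℝ)) _).symm

end Charts

section Calculus

open Filter Topology
open scoped ContDiff

lemma SmoothFn.add {f h : M → ℝ} (hf : SmoothFn I f) (hh : SmoothFn I h) :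
    SmoothFn I (fun x => f x + h x) := ContMDiff.add hf hh

lemma SmoothFn.sub {f h : M → ℝ} (hf : SmoothFn I f) (hh : SmoothFn I h) :
    SmoothFn I (fun x => f x - h x) := ContMDiff.sub hf hh

lemma SmoothFn.mul {f h : M → ℝ} (hf : SmoothFn I f) (hh : SmoothFn I h) :
    SmoothFn I (fun x => f x * h x) := ContMDiff.mul hf hh

lemma SmoothFn.inv {f : M → ℝ} (hf : SmoothFn I f) (h0 : ∀ x, f x ≠ 0) :
    SmoothFn I (fun x => (f x)⁻¹) := fun x =>
  (contDiffAt_inv ℝ (h0 x)).contMDiffAt.comp x (hf x)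

lemma SmoothFn.mdifferentiableAt {f : M → ℝ} (hf : SmoothFn I f) (x : M) :
    MDifferentiableAt I 𝓘(ℝ) f x := (hf x).mdifferentiableAt (by simp)

lemma SmoothVF.mdifferentiableAt {V : VF I M} (hV : SmoothVF I V) (x : M) :
    MDifferentiableAt I I.tangent (fun x => (⟨x, V x⟩ : TangentBundle I M)) x :=
  (hV x).mdifferentiableAt (by simp)

variable (I M) in
lemma isManifold_add_one : IsManifold I (((⊤ : ℕ∞) : WithTop ℕ∞) + 1) M :=
  ‹IsManifold I (⊤ : ℕ∞) M›

lemma SmoothVF.add {V W : VF I M} (hV : SmoothVF I V) (hW : SmoothVF I W) :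
    SmoothVF I (V + W) :=
  have := isManifold_add_one I M
  ContMDiff.add_section hV hW

lemma SmoothVF.sub {V W : VF I M} (hV : SmoothVF I V) (hW : SmoothVF I W) :
    SmoothVF I (V - W) :=
  have := isManifold_add_one I M
  ContMDiff.sub_section hV hW

lemma SmoothVF.smul {f : M → ℝ} {V : VF I M} (hf : SmoothFn I f) (hV : SmoothVF I V) :
    SmoothVF I (f • V) :=
  have := isManifold_add_one I M
  ContMDiff.smul_section hf hV

lemma SmoothVF.const_smul (c : ℝ) {V : VF I M} (hV : SmoothVF I V) :
    SmoothVF I (c • V) :=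
  have := isManifold_add_one I M
  ContMDiff.const_smul_section hV

variable (I M) in
lemma smoothVF_zero : SmoothVF I (0 : VF I M) :=
  have := isManifold_add_one I M
  Bundle.contMDiff_zeroSection ℝ (TangentSpace I)

variable [I.Boundaryless] [CompleteSpace E]

variable (I M) in
lemma isManifold_minSmoothness : IsManifold I (minSmoothness ℝ 2) M :=
  IsManifold.of_le (n := (⊤ : ℕ∞)) (by
    rw [minSmoothness_of_isRCLikeNormedField]; exact WithTop.coe_le_coe.2 (le_top : (2 : ℕ∞) ≤ ⊤))

lemma SmoothVF.vfLie {V W : VF I M} (hV : SmoothVF I V) (hW : SmoothVF I W) :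
    SmoothVF I (vfLie I V W) := by
  have := isManifold_add_one I M
  have := isManifold_minSmoothness I M
  rw [vfLie_eq_mlieBracket]
  exact fun x => ContMDiffAt.mlieBracket_vectorField (n := ⊤) (hV x) (hW x) (by simp)

lemma vfLie_add_right (V : VF I M) {W W' : VF I M} (hW : SmoothVF I W) (hW' : SmoothVF I W')
    (x : M) : vfLie I V (W + W') x = vfLie I V W x + vfLie I V W' x := by
  have := isManifold_minSmoothness I M
  simp only [vfLie_eq_mlieBracket]
  exact VectorField.mlieBracket_add_right (hW.mdifferentiableAt x) (hW'.mdifferentiableAt x)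

lemma vfLie_smul_right (V : VF I M) {f : M → ℝ} {W : VF I M} (hf : SmoothFn I f)
    (hW : SmoothVF I W) (x : M) :
    vfLie I V (f • W) x = vderiv I V f x • W x + f x • vfLie I V W x := by
  have := isManifold_minSmoothness I M
  simp only [vfLie_eq_mlieBracket]
  exact VectorField.mlieBracket_smul_right (hf.mdifferentiableAt x) (hW.mdifferentiableAt x)

lemma vfLie_self (V : VF I M) (x : M) : vfLie I V V x = 0 := by
  rw [vfLie_eq_mlieBracket, VectorField.mlieBracket_self]; rfl

end Calculus

section Frames

open Filter Topology
open scoped ContDiff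

set_option maxSynthPendingDepth 3

/-- Every tangent vector is the value of a global smooth vector field. -/
def HasSpanningVF (I : ModelWithCorners ℝ E H) (M : Type*) [TopologicalSpace M]
    [ChartedSpace H M] [IsManifold I (⊤ : ℕ∞) M] : Prop :=
  ∀ (x : M) (v : TangentSpace I x), ∃ V : VF I M, SmoothVF I V ∧ V x = v

variable [I.Boundaryless] [CompleteSpace E]

/-- An Engel manifold carries enough global vector fields. -/
lemma IsEngel.hasSpanningVF {D : TangentDist I M} (hD : IsEngel I D) : HasSpanningVF I M := by
  intro x
  let S : Submodule ℝ (TangentSpace I x) :=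
    { carrier := {v | ∃ V : VF I M, SmoothVF I V ∧ V x = v}
      add_mem' := by
        rintro _ _ ⟨V, hV, rfl⟩ ⟨W, hW, rfl⟩
        exact ⟨V + W, hV.add hW, rfl⟩
      zero_mem' := ⟨0, smoothVF_zero I M, rfl⟩
      smul_mem' := by
        rintro c _ ⟨V, hV, rfl⟩
        exact ⟨c • V, hV.const_smul c, rfl⟩ }
  have h : derivedDist I (derivedDist I D) x ≤ S := by
    refine Submodule.span_le.2 ?_
    rintro v (⟨V, hV, rfl⟩ | ⟨V, W, hV, hW, rfl⟩)
    · exact ⟨V, hV.1, rfl⟩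
    · exact ⟨_, hV.1.vfLie hW.1, rfl⟩
  rw [hD.2.2 x] at h
  exact fun v => h (Submodule.mem_top (x := v))

variable [FiniteDimensional ℝ E]

/-- A field of linear maps is smooth in a chart as soon as its values on global smooth vector
fields are. -/
lemma contDiffAt_of_chartV (hM : HasSpanningVF I M) {F : Type*} [NormedAddCommGroup F]
    [NormedSpace ℝ F] {x₀ x : M} (hx : x ∈ (extChartAt I x₀).source) {Λ : E → E →L[ℝ] F}
    (h : ∀ V, SmoothVF I V →
      ContDiffAt ℝ ∞ (fun y => Λ y (chartV I x₀ V y)) (extChartAt I x₀ x)) :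
    ContDiffAt ℝ ∞ Λ (extChartAt I x₀ x) := by
  set p := extChartAt I x₀ x
  let b := Module.finBasis ℝ E
  choose V hV hVb using fun i => hM x ((chartD I x₀ x).inverse (b i))
  have hVp : ∀ i, chartV I x₀ (V i) p = b i := fun i => by
    rw [chartV_extChartAt _ _ hx, hVb, chartD_inverse_apply hx]
  let A : E → E →L[ℝ] E := fun y =>
    ∑ i, (LinearMap.toContinuousLinearMap (b.coord i)).smulRight (chartV I x₀ (V i) y)
  have hA : ContDiffAt ℝ ∞ A p := by
    refine ContDiffAt.sum fun i _ => ?_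
    exact contDiffAt_const.smulRight ((hV i).contDiffAt_chartV hx)
  have hAp : A p = ContinuousLinearMap.id ℝ E := by
    ext u
    simp only [A, FunLike.coe_sum, Finset.sum_apply, ContinuousLinearMap.smulRight_apply,
      hVp, LinearMap.coe_toContinuousLinearMap', Basis.coord_apply, ContinuousLinearMap.id_apply]
    exact b.sum_repr u
  have hB : ContDiffAt ℝ ∞ (fun y => (A y).inverse) p := by
    have h1 : ContDiffAt ℝ ∞ ContinuousLinearMap.inverse (A p) := by
      rw [hAp]
      exact contDiffAt_map_inverse (ContinuousLinearEquiv.refl ℝ E)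
    exact h1.comp p hA
  have hinv : ∀ᶠ y in 𝓝 p, (A y).IsInvertible := by
    have h1 := (ContinuousLinearEquiv.refl ℝ E).nhds
    have h2 : Tendsto A (𝓝 p) (𝓝 ((ContinuousLinearEquiv.refl ℝ E : E →L[ℝ] E))) := by
      have := hA.continuousAt.tendsto
      rwa [hAp] at this
    filter_upwards [h2 h1] with y hy
    exact hy
  have hΛA : ContDiffAt ℝ ∞ (fun y => (Λ y).comp (A y)) p := by
    refine contDiffAt_clm_of_apply fun u => ?_
    have : (fun y => (Λ y).comp (A y) u) = fun y => ∑ i, b.repr u i • Λ y (chartV I x₀ (V i) y) := by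
      funext y
      simp [A, FunLike.coe_sum]
    rw [this]
    exact ContDiffAt.sum fun i _ => contDiffAt_const.smul (h _ (hV i))
  refine (hΛA.clm_comp hB).congr_of_eventuallyEq ?_
  filter_upwards [hinv] with y hy
  ext u
  simp [hy.self_apply_inverse]

omit [I.Boundaryless] [CompleteSpace E] [FiniteDimensional ℝ E] in
lemma chartV_symm (x₀ : M) (V : VF I M) (y : E) :
    chartV I x₀ V y = chartD I x₀ ((extChartAt I x₀).symm y) (V ((extChartAt I x₀).symm y)) := rfl

/-- The expression of a one-form in the preferred chart at `x₀`. -/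
def formC (x₀ : M) (η : OneForm I M) (y : E) : E →L[ℝ] ℝ :=
  LinearMap.toContinuousLinearMap (E := E) ((η.val ((extChartAt I x₀).symm y)).comp
    (chartD I x₀ ((extChartAt I x₀).symm y)).inverse.toLinearMap)

omit [I.Boundaryless] [CompleteSpace E] in
lemma formC_apply (x₀ : M) (η : OneForm I M) (y u : E) :
    formC x₀ η y u = η.val ((extChartAt I x₀).symm y)
      ((chartD I x₀ ((extChartAt I x₀).symm y)).inverse u) := rfl

omit [I.Boundaryless] [CompleteSpace E] in
lemma formC_extChartAt {x₀ x : M} (hx : x ∈ (extChartAt I x₀).source) (η : OneForm I M)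
    (v : TangentSpace I x) :
    formC x₀ η (extChartAt I x₀ x) (chartD I x₀ x v) = η.val x v := by
  rw [formC_apply, (extChartAt I x₀).left_inv hx, chartD_inverse_chartD hx]

omit [I.Boundaryless] [CompleteSpace E] in
lemma formC_chartV {x₀ : M} {y : E} (hy : y ∈ (extChartAt I x₀).target) (η : OneForm I M)
    (V : VF I M) : formC x₀ η y (chartV I x₀ V y)
      = η.val ((extChartAt I x₀).symm y) (V ((extChartAt I x₀).symm y)) := by
  rw [formC_apply, chartV_symm, chartD_inverse_chartD ((extChartAt I x₀).map_target hy)]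

omit [CompleteSpace E] in
lemma contDiffAt_formC (hM : HasSpanningVF I M) (η : OneForm I M) {x₀ x : M}
    (hx : x ∈ (extChartAt I x₀).source) : ContDiffAt ℝ ∞ (formC x₀ η) (extChartAt I x₀ x) := by
  refine contDiffAt_of_chartV hM hx fun V hV => ?_
  refine ((contMDiffAt_iff_comp_symm le_rfl hx).1 (η.smooth' V hV x)).congr_of_eventuallyEq ?_
  filter_upwards [(isOpen_extChartAt_target x₀).mem_nhds
    ((extChartAt I x₀).map_source hx)] with y hy
  exact formC_chartV hy η V

/-- The expression of a metric in the preferred chart at `x₀`. -/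
def metricC (x₀ : M) (g : RMetric I M) (y : E) : E →L[ℝ] E →L[ℝ] ℝ :=
  LinearMap.toContinuousLinearMap (E := E) (LinearMap.toContinuousLinearMap.toLinearMap ∘ₗ
    (g.val ((extChartAt I x₀).symm y)).compl₁₂
      (chartD I x₀ ((extChartAt I x₀).symm y)).inverse.toLinearMap
      (chartD I x₀ ((extChartAt I x₀).symm y)).inverse.toLinearMap)

omit [I.Boundaryless] [CompleteSpace E] in
lemma metricC_apply (x₀ : M) (g : RMetric I M) (y u v : E) :
    metricC x₀ g y u v = g.val ((extChartAt I x₀).symm y)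
      ((chartD I x₀ ((extChartAt I x₀).symm y)).inverse u)
      ((chartD I x₀ ((extChartAt I x₀).symm y)).inverse v) := rfl

omit [I.Boundaryless] [CompleteSpace E] in
lemma metricC_extChartAt {x₀ x : M} (hx : x ∈ (extChartAt I x₀).source) (g : RMetric I M)
    (v w : TangentSpace I x) :
    metricC x₀ g (extChartAt I x₀ x) (chartD I x₀ x v) (chartD I x₀ x w) = g.val x v w := by
  rw [metricC_apply, (extChartAt I x₀).left_inv hx, chartD_inverse_chartD hx,
    chartD_inverse_chartD hx]

omit [I.Boundaryless] [CompleteSpace E] in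
lemma metricC_chartV {x₀ : M} {y : E} (hy : y ∈ (extChartAt I x₀).target) (g : RMetric I M)
    (V W : VF I M) : metricC x₀ g y (chartV I x₀ V y) (chartV I x₀ W y)
      = g.val ((extChartAt I x₀).symm y) (V ((extChartAt I x₀).symm y))
        (W ((extChartAt I x₀).symm y)) := by
  rw [metricC_apply, chartV_symm, chartV_symm,
    chartD_inverse_chartD ((extChartAt I x₀).map_target hy),
    chartD_inverse_chartD ((extChartAt I x₀).map_target hy)]

omit [CompleteSpace E] in
lemma contDiffAt_metricC (hM : HasSpanningVF I M) (g : RMetric I M) {x₀ x : M}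
    (hx : x ∈ (extChartAt I x₀).source) : ContDiffAt ℝ ∞ (metricC x₀ g) (extChartAt I x₀ x) := by
  refine contDiffAt_of_chartV hM hx fun V hV => contDiffAt_of_chartV hM hx fun W hW => ?_
  refine ((contMDiffAt_iff_comp_symm le_rfl hx).1
    (g.smooth' V W hV hW x)).congr_of_eventuallyEq ?_
  filter_upwards [(isOpen_extChartAt_target x₀).mem_nhds
    ((extChartAt I x₀).map_source hx)] with y hy
  exact metricC_chartV hy g V W

end Frames

section ChartFormulas

open Filter Topology
open scoped ContDiff

set_option maxSynthPendingDepth 3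

variable [I.Boundaryless] [FiniteDimensional ℝ E]

lemma ContDiffAt.differentiableAt_infty {F F' : Type*} [NormedAddCommGroup F] [NormedSpace ℝ F]
    [NormedAddCommGroup F'] [NormedSpace ℝ F'] {f : F → F'} {y : F} (hf : ContDiffAt ℝ ∞ f y) :
    DifferentiableAt ℝ f y := hf.differentiableAt (by simp)

lemma hasFDerivAt_chartV {V : VF I M} (hV : SmoothVF I V) (x₀ : M) :
    HasFDerivAt (chartV I x₀ V) (fderiv ℝ (chartV I x₀ V) (extChartAt I x₀ x₀))
      (extChartAt I x₀ x₀) :=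
  (hV.contDiffAt_chartV (mem_extChartAt_source x₀)).differentiableAt_infty.hasFDerivAt

lemma hasFDerivAt_formC (hM : HasSpanningVF I M) (η : OneForm I M) (x₀ : M) :
    HasFDerivAt (formC x₀ η) (fderiv ℝ (formC x₀ η) (extChartAt I x₀ x₀))
      (extChartAt I x₀ x₀) :=
  (contDiffAt_formC hM η (mem_extChartAt_source x₀)).differentiableAt_infty.hasFDerivAt

lemma hasFDerivAt_metricC (hM : HasSpanningVF I M) (g : RMetric I M) (x₀ : M) :
    HasFDerivAt (metricC x₀ g) (fderiv ℝ (metricC x₀ g) (extChartAt I x₀ x₀))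
      (extChartAt I x₀ x₀) :=
  (contDiffAt_metricC hM g (mem_extChartAt_source x₀)).differentiableAt_infty.hasFDerivAt

lemma vderiv_form_eq (hM : HasSpanningVF I M) (η : OneForm I M) (V : VF I M) {W : VF I M}
    (hW : SmoothVF I W) (x₀ : M) :
    vderiv I V (fun x => η.val x (W x)) x₀
      = fderiv ℝ (formC x₀ η) (extChartAt I x₀ x₀) (chartD I x₀ x₀ (V x₀)) (chartD I x₀ x₀ (W x₀))
        + formC x₀ η (extChartAt I x₀ x₀)
          (fderiv ℝ (chartV I x₀ W) (extChartAt I x₀ x₀) (chartD I x₀ x₀ (V x₀))) := by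
  have h1 : (fun x => η.val x (W x)) ∘ (extChartAt I x₀).symm =ᶠ[𝓝 (extChartAt I x₀ x₀)]
      fun y => formC x₀ η y (chartV I x₀ W y) := by
    filter_upwards [extChartAt_target_mem_nhds (I := I) x₀] with y hy
    exact (formC_chartV hy η W).symm
  rw [vderiv_eq_fderiv ((η.smooth' W hW).mdifferentiableAt x₀), h1.fderiv_eq,
    ((hasFDerivAt_formC hM η x₀).clm_apply (hasFDerivAt_chartV hW x₀)).fderiv,
    chartV_extChartAt _ _ (mem_extChartAt_source x₀),
    chartV_extChartAt _ _ (mem_extChartAt_source x₀)]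
  simp [add_comm]

lemma vderiv_metric_eq (hM : HasSpanningVF I M) (g : RMetric I M) (V : VF I M) {W W' : VF I M}
    (hW : SmoothVF I W) (hW' : SmoothVF I W') (x₀ : M) :
    vderiv I V (fun x => g.val x (W x) (W' x)) x₀
      = fderiv ℝ (metricC x₀ g) (extChartAt I x₀ x₀) (chartD I x₀ x₀ (V x₀))
          (chartD I x₀ x₀ (W x₀)) (chartD I x₀ x₀ (W' x₀))
        + metricC x₀ g (extChartAt I x₀ x₀)
          (fderiv ℝ (chartV I x₀ W) (extChartAt I x₀ x₀) (chartD I x₀ x₀ (V x₀)))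
          (chartD I x₀ x₀ (W' x₀))
        + metricC x₀ g (extChartAt I x₀ x₀) (chartD I x₀ x₀ (W x₀))
          (fderiv ℝ (chartV I x₀ W') (extChartAt I x₀ x₀) (chartD I x₀ x₀ (V x₀))) := by
  have h1 : (fun x => g.val x (W x) (W' x)) ∘ (extChartAt I x₀).symm =ᶠ[𝓝 (extChartAt I x₀ x₀)]
      fun y => metricC x₀ g y (chartV I x₀ W y) (chartV I x₀ W' y) := by
    filter_upwards [extChartAt_target_mem_nhds (I := I) x₀] with y hy
    exact (metricC_chartV hy g W W').symm
  rw [vderiv_eq_fderiv ((g.smooth' W W' hW hW').mdifferentiableAt x₀), h1.fderiv_eq,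
    (((hasFDerivAt_metricC hM g x₀).clm_apply (hasFDerivAt_chartV hW x₀)).clm_apply
      (hasFDerivAt_chartV hW' x₀)).fderiv]
  simp only [chartV_extChartAt _ _ (mem_extChartAt_source x₀)]
  simp
  ring

lemma form_vfLie_eq (η : OneForm I M) (V W : VF I M) (x₀ : M) :
    η.val x₀ (vfLie I V W x₀) = formC x₀ η (extChartAt I x₀ x₀)
        (fderiv ℝ (chartV I x₀ W) (extChartAt I x₀ x₀) (chartD I x₀ x₀ (V x₀)))
      - formC x₀ η (extChartAt I x₀ x₀)
        (fderiv ℝ (chartV I x₀ V) (extChartAt I x₀ x₀) (chartD I x₀ x₀ (W x₀))) := by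
  rw [← formC_extChartAt (mem_extChartAt_source x₀), chartD_vfLie, VectorField.lieBracket,
    map_sub, chartV_extChartAt _ _ (mem_extChartAt_source x₀),
    chartV_extChartAt _ _ (mem_extChartAt_source x₀)]

lemma metric_vfLie_eq (g : RMetric I M) (V W : VF I M) (x₀ : M) (w : TangentSpace I x₀) :
    g.val x₀ (vfLie I V W x₀) w = metricC x₀ g (extChartAt I x₀ x₀)
        (fderiv ℝ (chartV I x₀ W) (extChartAt I x₀ x₀) (chartD I x₀ x₀ (V x₀)))
        (chartD I x₀ x₀ w)
      - metricC x₀ g (extChartAt I x₀ x₀)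
        (fderiv ℝ (chartV I x₀ V) (extChartAt I x₀ x₀) (chartD I x₀ x₀ (W x₀)))
        (chartD I x₀ x₀ w) := by
  rw [← metricC_extChartAt (mem_extChartAt_source x₀), chartD_vfLie, VectorField.lieBracket,
    map_sub, sub_apply, chartV_extChartAt _ _ (mem_extChartAt_source x₀),
    chartV_extChartAt _ _ (mem_extChartAt_source x₀)]

lemma lieOneForm_eq (hM : HasSpanningVF I M) (η : OneForm I M) (X : VF I M) {V : VF I M}
    (hV : SmoothVF I V) (x₀ : M) :
    lieOneForm I η X V x₀
      = fderiv ℝ (formC x₀ η) (extChartAt I x₀ x₀) (chartD I x₀ x₀ (X x₀)) (chartD I x₀ x₀ (V x₀))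
        + formC x₀ η (extChartAt I x₀ x₀)
          (fderiv ℝ (chartV I x₀ X) (extChartAt I x₀ x₀) (chartD I x₀ x₀ (V x₀))) := by
  rw [lieOneForm, vderiv_form_eq hM η X hV, form_vfLie_eq]
  ring

/-- The exterior derivative of a one-form as a bilinear form on a tangent space. -/
def OneForm.dAt (η : OneForm I M) (x : M) : TangentSpace I x →ₗ[ℝ] TangentSpace I x →ₗ[ℝ] ℝ :=
  LinearMap.mk₂ ℝ (fun v w =>
      fderiv ℝ (formC x η) (extChartAt I x x) (chartD I x x v) (chartD I x x w)
      - fderiv ℝ (formC x η) (extChartAt I x x) (chartD I x x w) (chartD I x x v))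
    (fun _ _ _ => by simp only [map_add, add_apply]; ring)
    (fun _ _ _ => by simp only [map_smul, FunLike.coe_smul, Pi.smul_apply, smul_sub])
    (fun _ _ _ => by simp only [map_add, add_apply]; ring)
    (fun _ _ _ => by simp only [map_smul, FunLike.coe_smul, Pi.smul_apply, smul_sub])

lemma OneForm.d_eq_dAt (hM : HasSpanningVF I M) (η : OneForm I M) {V W : VF I M}
    (hV : SmoothVF I V) (hW : SmoothVF I W) (x : M) : η.d V W x = η.dAt x (V x) (W x) := by
  rw [OneForm.d, dOfFun, vderiv_form_eq hM η V hW, vderiv_form_eq hM η W hV, form_vfLie_eq]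
  show _ = fderiv ℝ (formC x η) (extChartAt I x x) (chartD I x x (V x)) (chartD I x x (W x))
    - fderiv ℝ (formC x η) (extChartAt I x x) (chartD I x x (W x)) (chartD I x x (V x))
  ring

lemma OneForm.dAt_swap (η : OneForm I M) (x : M) (v w : TangentSpace I x) :
    η.dAt x v w = - η.dAt x w v :=
  (neg_sub _ _).symm

end ChartFormulas

section IsometricFamilies

open Filter Topology Metric
open scoped ContDiff

set_option maxSynthPendingDepth 3

/-- The expression of a self-map in the preferred chart at `x₀`. -/
def chartMap (I : ModelWithCorners ℝ E H) {M : Type*} [TopologicalSpace M] [ChartedSpace H M]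
    (x₀ : M) (F : M → M) (y : E) : E :=
  extChartAt I x₀ (F ((extChartAt I x₀).symm y))

/-- The differential of a self-map in the preferred chart at `x₀`. -/
def chartMapD (I : ModelWithCorners ℝ E H) {M : Type*} [TopologicalSpace M] [ChartedSpace H M]
    (x₀ : M) (F : M → M) (y : E) : E →L[ℝ] E :=
  (chartD I x₀ (F ((extChartAt I x₀).symm y))).comp
    ((mfderiv I I F ((extChartAt I x₀).symm y)).comp
      (chartD I x₀ ((extChartAt I x₀).symm y)).inverse)

variable [I.Boundaryless]

lemma hasMFDerivAt_extChartAt_symm {x₀ : M} {y : E} (hy : y ∈ (extChartAt I x₀).target) :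
    HasMFDerivAt 𝓘(ℝ, E) I (extChartAt I x₀).symm y
      (chartD I x₀ ((extChartAt I x₀).symm y)).inverse := by
  have h1 : MDifferentiableAt 𝓘(ℝ, E) I (extChartAt I x₀).symm y := by
    have := mdifferentiableWithinAt_extChartAt_symm (I := I) hy
    rwa [I.range_eq_univ, mdifferentiableWithinAt_univ] at this
  have h2 := mfderiv_extChartAt_comp_mfderivWithin_extChartAt_symm (I := I) hy
  rw [I.range_eq_univ, mfderivWithin_univ] at h2
  suffices h3 : (chartD I x₀ ((extChartAt I x₀).symm y)).inverse
      = mfderiv 𝓘(ℝ, E) I (extChartAt I x₀).symm y by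
    rw [h3]
    exact h1.hasMFDerivAt
  ext u
  apply chartD_injective (I := I) ((extChartAt I x₀).map_target hy)
  rw [chartD_inverse_apply ((extChartAt I x₀).map_target hy)]
  exact (DFunLike.congr_fun h2 u).symm

lemma hasFDerivAt_chartMap {x₀ : M} {F : M → M} {y : E} (hy : y ∈ (extChartAt I x₀).target)
    (hF : MDifferentiableAt I I F ((extChartAt I x₀).symm y))
    (hFy : F ((extChartAt I x₀).symm y) ∈ (extChartAt I x₀).source) :
    HasFDerivAt (chartMap I x₀ F) (chartMapD I x₀ F y) y := by
  have h1 := (mdifferentiableAt_extChartAt (I := I) (by simpa using hFy)).hasMFDerivAt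
  exact (h1.comp y (hF.hasMFDerivAt.comp y (hasMFDerivAt_extChartAt_symm hy))).hasFDerivAt

variable [FiniteDimensional ℝ E]

/-- A continuous family of bijective isometries, together with the family of inverses. -/
structure IsometricFamily {S : Type*} [TopologicalSpace S] (g : RMetric I M)
    (act act' : S → M → M) : Prop where
  continuous : Continuous (uncurry act)
  continuous' : Continuous (uncurry act')
  left_inv : ∀ a x, act' a (act a x) = x
  right_inv : ∀ a x, act a (act' a x) = x
  isom : ∀ a x v w, g.val (act a x) (mfderiv I I (act a) x v) (mfderiv I I (act a) x w)
    = g.val x v w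
  isom' : ∀ a x v w, g.val (act' a x) (mfderiv I I (act' a) x v) (mfderiv I I (act' a) x w)
    = g.val x v w

omit [I.Boundaryless] [FiniteDimensional ℝ E] in
lemma mdifferentiableAt_of_isom [Nontrivial E] {g : RMetric I M} {F : M → M} {x : M}
    (h : ∀ v w, g.val (F x) (mfderiv I I F x v) (mfderiv I I F x w) = g.val x v w) :
    MDifferentiableAt I I F x := by
  by_contra hF
  obtain ⟨v, hv⟩ := exists_ne (0 : E)
  have h1 := h v v
  rw [mfderiv_zero_of_not_mdifferentiableAt hF] at h1
  have h2 := g.posdef x v hv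
  rw [← h1] at h2
  have h3 : (0 : TangentSpace I x →L[ℝ] TangentSpace I (F x)) v = 0 := rfl
  rw [h3, map_zero] at h2
  exact lt_irrefl _ h2

omit [I.Boundaryless] in
lemma metricC_chartMapD {g : RMetric I M} {F : M → M} {x₀ : M} {y : E}
    (hFy : F ((extChartAt I x₀).symm y) ∈ (extChartAt I x₀).source)
    (h : ∀ x v w, g.val (F x) (mfderiv I I F x v) (mfderiv I I F x w) = g.val x v w) (u w : E) :
    metricC x₀ g (chartMap I x₀ F y) (chartMapD I x₀ F y u) (chartMapD I x₀ F y w)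
      = metricC x₀ g y u w := by
  rw [metricC_apply x₀ g y, ← h]
  exact metricC_extChartAt hFy g _ _

omit [I.Boundaryless] in
lemma metricC_symm (x₀ : M) (g : RMetric I M) (y u v : E) :
    metricC x₀ g y u v = metricC x₀ g y v u := g.symm _ _ _

omit [I.Boundaryless] in
lemma metricC_pos {x₀ : M} (g : RMetric I M) {y : E} (hy : y ∈ (extChartAt I x₀).target) {v : E}
    (hv : v ≠ 0) : 0 < metricC x₀ g y v v := by
  refine g.posdef _ _ fun h => hv ?_
  rw [← chartD_inverse_apply ((extChartAt I x₀).map_target hy) v]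
  exact (congrArg _ h).trans (map_zero _)

variable {S : Type*} [TopologicalSpace S] {g : RMetric I M} {act act' : S → M → M} {a₀ : S}

omit [FiniteDimensional ℝ E] in
lemma continuousAt_chartMap (h : Continuous (uncurry act)) {x₀ : M} {a : S} {y : E}
    (hy : y ∈ (extChartAt I x₀).target)
    (hay : act a ((extChartAt I x₀).symm y) ∈ (extChartAt I x₀).source) :
    ContinuousAt (uncurry fun a => chartMap I x₀ (act a)) (a, y) ∧
      ∀ᶠ p : S × E in 𝓝 (a, y), act p.1 ((extChartAt I x₀).symm p.2) ∈ (extChartAt I x₀).source := by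
  have h1 : ContinuousAt (fun p : S × E => (extChartAt I x₀).symm p.2) (a, y) :=
    ContinuousAt.comp (g := (extChartAt I x₀).symm) (f := Prod.snd)
      (continuousAt_extChartAt_symm'' hy) continuousAt_snd
  have h2 : ContinuousAt (fun p : S × E => act p.1 ((extChartAt I x₀).symm p.2)) (a, y) :=
    ContinuousAt.comp (g := uncurry act) (f := fun p : S × E => (p.1, (extChartAt I x₀).symm p.2))
      h.continuousAt (continuousAt_fst.prodMk h1)
  refine ⟨?_, h2.eventually_mem ((isOpen_extChartAt_source x₀).mem_nhds hay)⟩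
  exact ContinuousAt.comp (g := extChartAt I x₀)
    (f := fun p : S × E => act p.1 ((extChartAt I x₀).symm p.2))
    (continuousAt_extChartAt' hay) h2

omit [I.Boundaryless] [IsManifold I (⊤ : ℕ∞) M] [FiniteDimensional ℝ E] in
lemma chartMap_of_id (h0 : ∀ x, act a₀ x = x) {x₀ : M} {y : E}
    (hy : y ∈ (extChartAt I x₀).target) : chartMap I x₀ (act a₀) y = y := by
  rw [chartMap, h0, (extChartAt I x₀).right_inv hy]

lemma eventually_chartMap_close (h : Continuous (uncurry act)) (h0 : ∀ x, act a₀ x = x)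
    {x₀ : M} {K : Set E} (hK : IsCompact K) (hKt : K ⊆ (extChartAt I x₀).target) {r : ℝ}
    (hr : 0 < r) : ∀ᶠ a in 𝓝 a₀, ∀ y ∈ K,
      act a ((extChartAt I x₀).symm y) ∈ (extChartAt I x₀).source ∧
      dist (chartMap I x₀ (act a) y) y < r := by
  refine hK.eventually_forall_of_forall_eventually fun y hy => ?_
  have h1 := continuousAt_chartMap (I := I) h (a := a₀) (hKt hy)
    (by rw [h0]; exact (extChartAt I x₀).map_target (hKt hy))
  have h2 : ContinuousAt (fun p : S × E => dist (chartMap I x₀ (act p.1) p.2) p.2) (a₀, y) :=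
    Filter.Tendsto.dist h1.1 continuousAt_snd
  have h3 : dist (chartMap I x₀ (act a₀) y) y < r := by
    rwa [chartMap_of_id h0 (hKt hy), dist_self]
  exact h1.2.and (h2.eventually_lt_const h3)

/-- In a chart, a continuous family of isometries near the identity is a local family of
isometries with uniform bounds. -/
lemma IsometricFamily.exists_isIsomFamily [Nontrivial E] (hM : HasSpanningVF I M)
    (hact : IsometricFamily g act act') (h0 : ∀ x, act a₀ x = x) (x₀ : M) :
    ∃ ρ m C : ℝ, ∃ s ∈ 𝓝 a₀, 0 < ρ ∧ ball (extChartAt I x₀ x₀) ρ ⊆ (extChartAt I x₀).target ∧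
      MetricBounds (metricC x₀ g) (christoffel (metricC x₀ g)) (ball (extChartAt I x₀ x₀) ρ) m C ∧
      ContDiffOn ℝ ∞ (christoffel (metricC x₀ g)) (ball (extChartAt I x₀ x₀) ρ) ∧
      (∀ a ∈ s, ∀ y ∈ ball (extChartAt I x₀ x₀) (ρ / 4),
        act a ((extChartAt I x₀).symm y) ∈ (extChartAt I x₀).source) ∧
      IsIsomFamily (metricC x₀ g) (ball (extChartAt I x₀ x₀) ρ) (ρ / 4)
        (ball (extChartAt I x₀ x₀) (ρ / 4)) s (fun a => chartMap I x₀ (act a))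
        (fun a => chartMap I x₀ (act' a)) (fun a => chartMapD I x₀ (act a))
        (fun a => chartMapD I x₀ (act' a)) := by
  set y₀ := extChartAt I x₀ x₀ with hy₀
  have hsm : ∀ y ∈ (extChartAt I x₀).target, ContDiffAt ℝ ∞ (metricC x₀ g) y := fun y hy => by
    have := contDiffAt_metricC hM g ((extChartAt I x₀).map_target hy)
    rwa [(extChartAt I x₀).right_inv hy] at this
  obtain ⟨ρ, m, C, hρ, hBt, hb⟩ := exists_metricBounds (isOpen_extChartAt_target (I := I) x₀)
    (mem_extChartAt_target x₀) hsm (fun y _ => metricC_symm x₀ g y)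
    (fun y hy v hv => metricC_pos g hy hv)
  have h0' : ∀ x, act' a₀ x = x := fun x => by
    have := hact.left_inv a₀ x
    rwa [h0] at this
  have hKB : closedBall y₀ (3 * ρ / 4) ⊆ ball y₀ ρ := closedBall_subset_ball (by linarith)
  have e1 := eventually_chartMap_close (I := I) (x₀ := x₀) hact.continuous h0
    (isCompact_closedBall y₀ (3 * ρ / 4)) (hKB.trans hBt) (show 0 < ρ / 4 by linarith)
  have e2 := eventually_chartMap_close (I := I) (x₀ := x₀) hact.continuous' h0'
    (isCompact_closedBall y₀ (3 * ρ / 4)) (hKB.trans hBt) (show 0 < ρ / 4 by linarith)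
  refine ⟨ρ, m, C, _, e1.and e2, hρ, hBt, hb, fun y hy => ?_, fun a ha y hy => ?_, ?_⟩
  · exact (contDiffAt_christoffel (hsm y (hBt hy))
      (fun v hv => metricC_pos g (hBt hy) hv)).contDiffWithinAt
  · exact (ha.1 y ((ball_subset_closedBall.trans (closedBall_subset_closedBall (by linarith))) hy)).1
  have key : ∀ (F : M → M), (∀ x v w, g.val (F x) (mfderiv I I F x v) (mfderiv I I F x w)
        = g.val x v w) →
      (∀ y ∈ closedBall y₀ (3 * ρ / 4), F ((extChartAt I x₀).symm y) ∈ (extChartAt I x₀).source ∧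
        dist (chartMap I x₀ F y) y < ρ / 4) → ∀ p, dist p y₀ < ρ / 2 →
      dist (chartMap I x₀ F p) y₀ < 3 * ρ / 4 →
      IsIsomAt (metricC x₀ g) (ball y₀ ρ) (ρ / 4) p (chartMap I x₀ F) (chartMapD I x₀ F) := by
    intro F hF hcl p hp hfp
    have hin : ∀ x ∈ ball p (ρ / 4), x ∈ closedBall y₀ (3 * ρ / 4) := fun x hx => by
      rw [mem_closedBall]
      have := dist_triangle x p y₀
      rw [mem_ball] at hx
      linarith
    refine ⟨fun x hx => hKB (hin x hx), fun x hx => ?_, fun x hx => ?_, fun x hx => ?_,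
      fun x hx u v => ?_⟩
    · rw [mem_ball] at hx ⊢
      have := dist_triangle x (chartMap I x₀ F p) y₀
      linarith
    · have h1 := (hcl x (hin x hx)).2
      have h2 := hin x hx
      rw [mem_closedBall] at h2
      rw [mem_ball]
      have := dist_triangle (chartMap I x₀ F x) x y₀
      linarith
    · exact hasFDerivAt_chartMap (hBt (hKB (hin x hx)))
        (mdifferentiableAt_of_isom (hF _)) (hcl x (hin x hx)).1
    · exact metricC_chartMapD (hcl x (hin x hx)).1 hF u v
  have hinv : ∀ F F' : M → M, (∀ x, F' (F x) = x) → ∀ y ∈ (extChartAt I x₀).target,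
      F ((extChartAt I x₀).symm y) ∈ (extChartAt I x₀).source →
      chartMap I x₀ F' (chartMap I x₀ F y) = y := by
    intro F F' h y hy hFy
    rw [chartMap, chartMap, (extChartAt I x₀).left_inv hFy, h, (extChartAt I x₀).right_inv hy]
  refine ⟨isOpen_ball, fun a ha p hp => ?_, ?_⟩
  · rw [mem_ball] at hp
    have hpK : p ∈ closedBall y₀ (3 * ρ / 4) := by rw [mem_closedBall]; linarith
    have hfp : dist (chartMap I x₀ (act a) p) y₀ < ρ / 2 := by
      have := dist_triangle (chartMap I x₀ (act a) p) p y₀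
      have := (ha.1 p hpK).2
      linarith
    have hpp : chartMap I x₀ (act' a) (chartMap I x₀ (act a) p) = p :=
      hinv _ _ (hact.left_inv a) p (hBt (hKB hpK)) (ha.1 p hpK).1
    refine ⟨key _ (hact.isom a) ha.1 p (by linarith) (by linarith),
      key _ (hact.isom' a) ha.2 _ (by linarith) (by rw [hpp]; linarith), fun x hx _ => ?_,
      fun x hx _ => ?_⟩
    · have hxK : x ∈ closedBall y₀ (3 * ρ / 4) := by
        rw [mem_closedBall]
        rw [mem_ball] at hx
        have := dist_triangle x p y₀
        linarith
      exact hinv _ _ (hact.left_inv a) x (hBt (hKB hxK)) (ha.1 x hxK).1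
    · have hxK : x ∈ closedBall y₀ (3 * ρ / 4) := by
        rw [mem_closedBall]
        rw [mem_ball] at hx
        have := dist_triangle x (chartMap I x₀ (act a) p) y₀
        linarith
      exact hinv _ _ (hact.right_inv a) x (hBt (hKB hxK)) (ha.2 x hxK).1
  · rintro ⟨a, y⟩ ⟨ha, hy⟩
    have hyK : y ∈ closedBall y₀ (3 * ρ / 4) :=
      (ball_subset_closedBall.trans (closedBall_subset_closedBall (by linarith))) hy
    exact (continuousAt_chartMap hact.continuous (hBt (hKB hyK)) (ha.1 y hyK).1).1.continuousWithinAt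

end IsometricFamilies

section IsometricFlows

open Filter Topology Metric
open scoped ContDiff

set_option maxSynthPendingDepth 3

/-- A continuous one-parameter group of isometries. -/
structure IsometricFlow (g : RMetric I M) (φ : ℝ → M → M) : Prop where
  continuous : Continuous (uncurry φ)
  zero : ∀ x, φ 0 x = x
  add : ∀ s t x, φ (s + t) x = φ s (φ t x)
  isom : ∀ t x v w, g.val (φ t x) (mfderiv I I (φ t) x v) (mfderiv I I (φ t) x w)
    = g.val x v w

lemma IsometricFlow.family {g : RMetric I M} {φ : ℝ → M → M} (h : IsometricFlow g φ) :
    IsometricFamily g φ (fun t => φ (-t)) where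
  continuous := h.continuous
  continuous' := h.continuous.comp (by fun_prop : Continuous fun p : ℝ × M => (-p.1, p.2))
  left_inv t x := by rw [← h.add, neg_add_cancel, h.zero]
  right_inv t x := by rw [← h.add, add_neg_cancel, h.zero]
  isom := h.isom
  isom' t := h.isom (-t)

variable [I.Boundaryless]

omit [I.Boundaryless] [IsManifold I (⊤ : ℕ∞) M] in
lemma smulRight_one_congr {z z' : M} (hz : z = z') (x₀ : M) (v : E) :
    ((chartD I x₀ z).inverse.comp ((1 : ℝ →L[ℝ] ℝ).smulRight v) : ℝ →L[ℝ] E)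
      = (1 : ℝ →L[ℝ] ℝ).smulRight ((chartD I x₀ z').inverse v : E) := by
  subst hz
  ext
  exact (congrArg (chartD I x₀ z).inverse (one_smul ℝ v)).trans (one_smul ℝ _).symm

lemma hasMFDerivAt_of_hasDerivAt_chart {x₀ : M} {c : ℝ → M} {t : ℝ} {v : E}
    (hc : ∀ᶠ s in 𝓝 t, c s ∈ (extChartAt I x₀).source)
    (h : HasDerivAt (fun s => extChartAt I x₀ (c s)) v t) :
    HasMFDerivAt 𝓘(ℝ) I c t
      ((1 : ℝ →L[ℝ] ℝ).smulRight ((chartD I x₀ (c t)).inverse v)) := by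
  have hct := hc.self_of_nhds
  have h0 : HasFDerivAt (fun s => extChartAt I x₀ (c s)) ((1 : ℝ →L[ℝ] ℝ).smulRight v) t := by
    have e : (1 : ℝ →L[ℝ] ℝ).smulRight v = ContinuousLinearMap.toSpanSingleton ℝ v := by
      ext; simp
    rw [e]
    exact h.hasFDerivAt
  have h2 := (hasMFDerivAt_extChartAt_symm ((extChartAt I x₀).map_source hct)).comp t
    h0.hasMFDerivAt
  have h3 : c =ᶠ[𝓝 t] (extChartAt I x₀).symm ∘ fun s => extChartAt I x₀ (c s) := by
    filter_upwards [hc] with s hs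
    exact ((extChartAt I x₀).left_inv hs).symm
  have h4 := h2.congr_of_eventuallyEq h3
  have h5 := smulRight_one_congr (I := I) ((extChartAt I x₀).left_inv hct) x₀ v
  exact h5 ▸ h4

lemma hasDerivAt_chart_of_hasMFDerivAt {x₀ : M} {c : ℝ → M} {t : ℝ} {v : TangentSpace I (c t)}
    (hc : c t ∈ (extChartAt I x₀).source)
    (h : HasMFDerivAt 𝓘(ℝ) I c t ((1 : ℝ →L[ℝ] ℝ).smulRight v)) :
    HasDerivAt (fun s => extChartAt I x₀ (c s)) (chartD I x₀ (c t) v) t := by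
  have h1 := (mdifferentiableAt_extChartAt (I := I) (x := x₀) (by simpa using hc)).hasMFDerivAt
  obtain ⟨L, hL⟩ : ∃ L : ℝ →L[ℝ] E, L = (chartD I x₀ (c t)).comp
    ((1 : ℝ →L[ℝ] ℝ).smulRight v) := ⟨_, rfl⟩
  have h2 : HasFDerivAt (fun s => extChartAt I x₀ (c s)) L t := by
    rw [hL]
    exact (h1.comp t h).hasFDerivAt
  have h3 : L 1 = chartD I x₀ (c t) v := by
    rw [hL]
    exact congrArg (chartD I x₀ (c t)) (one_smul ℝ v)
  rw [← h3]
  exact h2.hasDerivAt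

omit [I.Boundaryless] [IsManifold I (⊤ : ℕ∞) M] in
lemma hasMFDerivAt_comp_sub {c : ℝ → M} {t : ℝ} {v : E}
    (h : HasMFDerivAt 𝓘(ℝ) I c 0 ((1 : ℝ →L[ℝ] ℝ).smulRight v : ℝ →L[ℝ] E)) :
    HasMFDerivAt 𝓘(ℝ) I (fun s => c (s - t)) t ((1 : ℝ →L[ℝ] ℝ).smulRight v : ℝ →L[ℝ] E) := by
  have h0 : ∀ r : ℝ, r = 0 →
      HasMFDerivAt 𝓘(ℝ) I c r ((1 : ℝ →L[ℝ] ℝ).smulRight v : ℝ →L[ℝ] E) := by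
    rintro r rfl; exact h
  have h1 : HasFDerivAt (fun s : ℝ => s - t) (ContinuousLinearMap.id ℝ ℝ) t :=
    (hasFDerivAt_id t).sub_const t
  exact HasMFDerivAt.comp (f := fun s : ℝ => s - t) (g := c) t (h0 (t - t) (sub_self t))
    h1.hasMFDerivAt

variable [FiniteDimensional ℝ E] [Nontrivial E]

/-- A continuous one-parameter group of isometries is the flow of a smooth vector field, and the
linearised flow is generated by the derivative of that vector field. -/
theorem IsometricFlow.exists_generator (hM : HasSpanningVF I M) {g : RMetric I M}
    {φ : ℝ → M → M} (h : IsometricFlow g φ) :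
    ∃ X : VF I M, SmoothVF I X ∧ IsFlowOf I X φ ∧
      ∀ x₀, HasDerivAt (fun t => chartMapD I x₀ (φ t) (extChartAt I x₀ x₀))
        (fderiv ℝ (chartV I x₀ X) (extChartAt I x₀ x₀)) 0 := by
  let X : VF I M := fun x => (chartD I x x).inverse (deriv (fun t => extChartAt I x (φ t x)) 0)
  have hcont : ∀ x, Continuous fun t => φ t x := fun x =>
    h.continuous.comp (by fun_prop : Continuous fun t : ℝ => (t, x))
  have hsrc : ∀ x₀ x, x ∈ (extChartAt I x₀).source →
      ∀ᶠ t in 𝓝 (0 : ℝ), φ t x ∈ (extChartAt I x₀).source := fun x₀ x hx =>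
    (hcont x).continuousAt.eventually_mem
      ((isOpen_extChartAt_source x₀).mem_nhds (by rwa [h.zero]))
  have hX : ∀ x (v : E), HasMFDerivAt 𝓘(ℝ) I (fun t => φ t x) 0
      ((1 : ℝ →L[ℝ] ℝ).smulRight v : ℝ →L[ℝ] E) → X x = v := by
    intro x v hv
    have h1 := hasDerivAt_chart_of_hasMFDerivAt (I := I) (x₀ := x) (c := fun t => φ t x)
      (by rw [h.zero]; exact mem_extChartAt_source x) hv
    show (chartD I x x).inverse (deriv (fun t => extChartAt I x (φ t x)) 0) = v
    rw [h1.deriv]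
    have h2 : ∀ z, z = x → (chartD I x x).inverse (chartD I x z v) = v := by
      rintro z rfl
      exact chartD_inverse_chartD (mem_extChartAt_source z) _
    exact h2 _ (h.zero x)
  have hloc : ∀ x₀, ∃ (Y : E → E) (U' : Set E), IsOpen U' ∧ extChartAt I x₀ x₀ ∈ U' ∧
      U' ⊆ (extChartAt I x₀).target ∧ ContDiffOn ℝ ∞ Y U' ∧
      (∀ y ∈ U', HasDerivAt (fun t => chartMap I x₀ (φ t) y) (Y y) 0) ∧
      ∀ y ∈ U', HasDerivAt (fun t => chartMapD I x₀ (φ t) y) (fderiv ℝ Y y) 0 := by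
    intro x₀
    obtain ⟨ρ, m, C, s, hs, hρ, hBt, hb, hΓ, hsrc', hfam⟩ :=
      h.family.exists_isIsomFamily hM h.zero x₀
    obtain ⟨ε, hε, hεs⟩ := Metric.nhds_basis_closedBall.mem_iff.1 hs
    rw [Real.closedBall_eq_Icc, zero_sub, zero_add] at hεs
    have hUB : ball (extChartAt I x₀ x₀) (ρ / 4) ⊆ ball (extChartAt I x₀ x₀) ρ :=
      ball_subset_ball (by linarith)
    have hflow : IsIsomFlow (metricC x₀ g) (ball (extChartAt I x₀ x₀) ρ) (ρ / 4)
        (ball (extChartAt I x₀ x₀) (ρ / 4)) ε (fun a => chartMap I x₀ (φ a))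
        (fun a => chartMap I x₀ (φ (-a))) (fun a => chartMapD I x₀ (φ a))
        (fun a => chartMapD I x₀ (φ (-a))) := by
      refine ⟨⟨hfam.isOpen, fun a ha => hfam.isom a (hεs ha),
        hfam.continuousOn.mono (prod_mono hεs le_rfl)⟩, fun y hy => ?_, fun t _ r hr _ y hy _ => ?_⟩
      · exact chartMap_of_id h.zero (hBt (hUB hy))
      · rw [chartMap, chartMap, (extChartAt I x₀).left_inv (hsrc' r (hεs hr) y hy), chartMap,
          h.add]
    obtain ⟨Y, U', hU', hyU', hU'U, hY, h1, h2⟩ := hflow.exists_generator hb isOpen_ball hΓ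
      (by positivity) hε (mem_ball_self (by positivity))
    exact ⟨Y, U', hU', hyU', (hU'U.trans hUB).trans hBt, hY, h1, h2⟩
  have hchart : ∀ x₀ (Y : E → E) (U' : Set E), U' ⊆ (extChartAt I x₀).target →
      (∀ y ∈ U', HasDerivAt (fun t => chartMap I x₀ (φ t) y) (Y y) 0) →
      ∀ y ∈ U', chartV I x₀ X y = Y y ∧ HasMFDerivAt 𝓘(ℝ) I
        (fun t => φ t ((extChartAt I x₀).symm y)) 0
        ((1 : ℝ →L[ℝ] ℝ).smulRight (X ((extChartAt I x₀).symm y) : E) : ℝ →L[ℝ] E) := by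
    intro x₀ Y U' hU't hY y hy
    have hz := (extChartAt I x₀).map_target (hU't hy)
    have h1 := hasMFDerivAt_of_hasDerivAt_chart (hsrc x₀ _ hz) (hY y hy)
    have h2 := hX _ _ h1
    refine ⟨?_, ?_⟩
    · rw [chartV_symm, h2]
      have h3 : ∀ z, z = (extChartAt I x₀).symm y →
          chartD I x₀ ((extChartAt I x₀).symm y) ((chartD I x₀ z).inverse (Y y)) = Y y := by
        rintro z rfl
        exact chartD_inverse_apply hz _
      exact h3 _ (h.zero _)
    · rw [h2]
      exact h1
  have hev : ∀ x₀, ∃ Y : E → E, chartV I x₀ X =ᶠ[𝓝 (extChartAt I x₀ x₀)] Y ∧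
      ContDiffAt ℝ ∞ Y (extChartAt I x₀ x₀) ∧
      HasDerivAt (fun t => chartMapD I x₀ (φ t) (extChartAt I x₀ x₀))
        (fderiv ℝ Y (extChartAt I x₀ x₀)) 0 := by
    intro x₀
    obtain ⟨Y, U', hU', hyU', hU't, hY, h1, h2⟩ := hloc x₀
    refine ⟨Y, ?_, hY.contDiffAt (hU'.mem_nhds hyU'), h2 _ hyU'⟩
    filter_upwards [hU'.mem_nhds hyU'] with y hy
    exact (hchart x₀ Y U' hU't h1 y hy).1
  have hder0 : ∀ x, HasMFDerivAt 𝓘(ℝ) I (fun t => φ t x) 0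
      ((1 : ℝ →L[ℝ] ℝ).smulRight (X x : E) : ℝ →L[ℝ] E) := by
    intro x
    obtain ⟨Y, U', hU', hyU', hU't, hY, h1, h2⟩ := hloc x
    have h3 := (hchart x Y U' hU't h1 _ hyU').2
    rwa [(extChartAt I x).left_inv (mem_extChartAt_source x)] at h3
  refine ⟨X, smoothVF_of_chartV fun x₀ => ?_, ⟨h.continuous, h.zero, h.add, fun x t => ?_⟩,
    fun x₀ => ?_⟩
  · obtain ⟨Y, hY, hYs, -⟩ := hev x₀
    exact hYs.congr_of_eventuallyEq hY
  · have h1 := hasMFDerivAt_comp_sub (t := t) (hder0 (φ t x))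
    have h2 : (fun s => φ (s - t) (φ t x)) = fun s => φ s x := by
      funext s
      rw [← h.add, sub_add_cancel]
    rw [h2] at h1
    exact h1
  · obtain ⟨Y, hY, -, hYd⟩ := hev x₀
    rwa [hY.fderiv_eq]

end IsometricFlows

section Generators

open Filter Topology Metric
open scoped ContDiff

set_option maxSynthPendingDepth 3

variable [I.Boundaryless]

/-- `X` generates the flow `φ`, and its derivative generates the linearised flow. -/
structure IsGenerator (X : VF I M) (φ : ℝ → M → M) : Prop where
  smooth : SmoothVF I X
  flow : IsFlowOf I X φ
  lin : ∀ x₀, HasDerivAt (fun t => chartMapD I x₀ (φ t) (extChartAt I x₀ x₀))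
    (fderiv ℝ (chartV I x₀ X) (extChartAt I x₀ x₀)) 0

omit [I.Boundaryless] in
lemma IsFlowOf.eventually_mem_source {X : VF I M} {φ : ℝ → M → M} (h : IsFlowOf I X φ) (x₀ : M) :
    ∀ᶠ t in 𝓝 (0 : ℝ), φ t x₀ ∈ (extChartAt I x₀).source := by
  have h1 : Continuous fun t => φ t x₀ := h.1.comp (by fun_prop : Continuous fun t : ℝ => (t, x₀))
  exact h1.continuousAt.eventually_mem
    ((isOpen_extChartAt_source x₀).mem_nhds (by rw [h.2.1]; exact mem_extChartAt_source x₀))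

lemma IsFlowOf.hasDerivAt_chart {X : VF I M} {φ : ℝ → M → M} (h : IsFlowOf I X φ) (x₀ : M) :
    HasDerivAt (fun t => extChartAt I x₀ (φ t x₀)) (chartD I x₀ x₀ (X x₀)) 0 := by
  have h1 := hasDerivAt_chart_of_hasMFDerivAt (I := I) (x₀ := x₀) (c := fun t => φ t x₀)
    (by rw [h.2.1]; exact mem_extChartAt_source x₀) (h.2.2.2 x₀ 0)
  have h2 : ∀ z, z = x₀ → (chartD I x₀ z (X z) : E) = chartD I x₀ x₀ (X x₀) := by
    rintro z rfl; rfl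
  rwa [h2 _ (h.2.1 x₀)] at h1

/-- The generator of a flow is unique. -/
lemma IsFlowOf.unique {X Y : VF I M} {φ : ℝ → M → M} (hX : IsFlowOf I X φ)
    (hY : IsFlowOf I Y φ) : X = Y := by
  funext x
  exact chartD_injective (mem_extChartAt_source x)
    ((hX.hasDerivAt_chart x).unique (hY.hasDerivAt_chart x))

omit [I.Boundaryless] in
lemma chartMapD_extChartAt {x₀ : M} (F : M → M) (v : TangentSpace I x₀) :
    chartMapD I x₀ F (extChartAt I x₀ x₀) (chartD I x₀ x₀ v)
      = chartD I x₀ (F x₀) (mfderiv I I F x₀ v) := by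
  have h1 : ∀ z, z = x₀ → ∀ u : E, u = chartD I x₀ x₀ v →
      (chartD I x₀ (F z) (mfderiv I I F z ((chartD I x₀ z).inverse u)) : E)
        = chartD I x₀ (F x₀) (mfderiv I I F x₀ v) := by
    rintro z rfl u rfl
    rw [chartD_inverse_chartD (mem_extChartAt_source z)]
  exact h1 _ ((extChartAt I x₀).left_inv (mem_extChartAt_source x₀)) _ rfl

variable [FiniteDimensional ℝ E]

lemma IsGenerator.hasDerivAt_form (hM : HasSpanningVF I M) {X : VF I M} {φ : ℝ → M → M}
    (h : IsGenerator X φ) (η : OneForm I M) {V : VF I M} (hV : SmoothVF I V) (x₀ : M) :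
    HasDerivAt (fun t => η.val (φ t x₀) (mfderiv I I (φ t) x₀ (V x₀)))
      (lieOneForm I η X V x₀) 0 := by
  have h0 : extChartAt I x₀ (φ 0 x₀) = extChartAt I x₀ x₀ := by rw [h.flow.2.1]
  have hf := hasFDerivAt_formC hM η x₀
  rw [← h0] at hf
  have h1 := hf.comp_hasDerivAt (0 : ℝ) (h.flow.hasDerivAt_chart x₀)
  have h2 := (h.lin x₀).clm_apply (hasDerivAt_const (0 : ℝ) (chartD I x₀ x₀ (V x₀) : E))
  have h3 := h1.clm_apply h2
  have hid : chartMapD I x₀ (φ 0) (extChartAt I x₀ x₀) (chartD I x₀ x₀ (V x₀))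
      = chartD I x₀ x₀ (V x₀) := by
    have : φ 0 = id := funext h.flow.2.1
    rw [this, chartMapD_extChartAt, mfderiv_id]; rfl
  have h4 : HasDerivAt (fun t => formC x₀ η (extChartAt I x₀ (φ t x₀))
      (chartMapD I x₀ (φ t) (extChartAt I x₀ x₀) (chartD I x₀ x₀ (V x₀))))
      (lieOneForm I η X V x₀) 0 := by
    rw [lieOneForm_eq hM η X hV]
    refine h3.congr_deriv ?_
    simp only [comp_apply, h0, hid, map_zero, add_zero]
  refine h4.congr_of_eventuallyEq ?_
  filter_upwards [h.flow.eventually_mem_source x₀] with t ht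
  rw [chartMapD_extChartAt]
  exact (formC_extChartAt ht η _).symm

lemma IsGenerator.hasDerivAt_metric (hM : HasSpanningVF I M) {X : VF I M} {φ : ℝ → M → M}
    (h : IsGenerator X φ) (g : RMetric I M) {V W : VF I M} (hV : SmoothVF I V)
    (hW : SmoothVF I W) (x₀ : M) :
    HasDerivAt (fun t => g.val (φ t x₀) (mfderiv I I (φ t) x₀ (V x₀))
        (mfderiv I I (φ t) x₀ (W x₀)))
      (vderiv I X (fun y => g.val y (V y) (W y)) x₀
        - g.val x₀ (vfLie I X V x₀) (W x₀) - g.val x₀ (V x₀) (vfLie I X W x₀)) 0 := by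
  have h0 : extChartAt I x₀ (φ 0 x₀) = extChartAt I x₀ x₀ := by rw [h.flow.2.1]
  have hf := hasFDerivAt_metricC hM g x₀
  rw [← h0] at hf
  have h1 := hf.comp_hasDerivAt (0 : ℝ) (h.flow.hasDerivAt_chart x₀)
  have h2 := (h.lin x₀).clm_apply (hasDerivAt_const (0 : ℝ) (chartD I x₀ x₀ (V x₀) : E))
  have h2' := (h.lin x₀).clm_apply (hasDerivAt_const (0 : ℝ) (chartD I x₀ x₀ (W x₀) : E))
  have h3 := (h1.clm_apply h2).clm_apply h2'
  have hid : ∀ v : TangentSpace I x₀,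
      chartMapD I x₀ (φ 0) (extChartAt I x₀ x₀) (chartD I x₀ x₀ v) = chartD I x₀ x₀ v := by
    intro v
    have : φ 0 = id := funext h.flow.2.1
    rw [this, chartMapD_extChartAt, mfderiv_id]; rfl
  have h4 : HasDerivAt (fun t => metricC x₀ g (extChartAt I x₀ (φ t x₀))
      (chartMapD I x₀ (φ t) (extChartAt I x₀ x₀) (chartD I x₀ x₀ (V x₀)))
      (chartMapD I x₀ (φ t) (extChartAt I x₀ x₀) (chartD I x₀ x₀ (W x₀))))
      (vderiv I X (fun y => g.val y (V y) (W y)) x₀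
        - g.val x₀ (vfLie I X V x₀) (W x₀) - g.val x₀ (V x₀) (vfLie I X W x₀)) 0 := by
    rw [vderiv_metric_eq hM g X hV hW, metric_vfLie_eq, g.symm x₀ (V x₀), metric_vfLie_eq,
      metricC_symm x₀ g _ _ (chartD I x₀ x₀ (V x₀)), metricC_symm x₀ g _ _ (chartD I x₀ x₀ (V x₀))]
    refine h3.congr_deriv ?_
    simp only [comp_apply, h0, hid, map_zero, add_zero, add_apply]
    ring
  refine h4.congr_of_eventuallyEq ?_
  filter_upwards [h.flow.eventually_mem_source x₀] with t ht
  rw [chartMapD_extChartAt, chartMapD_extChartAt]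
  exact (metricC_extChartAt ht g _ _).symm

/-- The generator of a flow of isometries is a Killing vector field. -/
lemma IsGenerator.isKilling (hM : HasSpanningVF I M) {X : VF I M} {φ : ℝ → M → M}
    (h : IsGenerator X φ) {g : RMetric I M} (hφ : IsometricFlow g φ) : IsKilling I g X := by
  intro V W hV hW x
  have h1 := h.hasDerivAt_metric hM g hV hW x
  simp only [hφ.isom] at h1
  linarith [h1.unique (hasDerivAt_const (0 : ℝ) (g.val x (V x) (W x)))]

/-- A form which is invariant under a flow has vanishing Lie derivative. -/
lemma IsGenerator.lieOneForm_eq_zero (hM : HasSpanningVF I M) {X : VF I M} {φ : ℝ → M → M}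
    (h : IsGenerator X φ) {η : OneForm I M} {V : VF I M} (hV : SmoothVF I V) {x₀ : M} {c : ℝ}
    (hη : ∀ t, η.val (φ t x₀) (mfderiv I I (φ t) x₀ (V x₀)) = c) :
    lieOneForm I η X V x₀ = 0 := by
  have h1 := h.hasDerivAt_form hM η hV x₀
  simp only [hη] at h1
  exact h1.unique (hasDerivAt_const (0 : ℝ) c)

end Generators

section IsometricActions

open Filter Topology Metric
open scoped ContDiff

set_option maxSynthPendingDepth 3

lemma OneForm.val_mfderiv_comp (η : OneForm I M) {F G K : M → M} (hK : ∀ x, K x = F (G x)) {x : M}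
    (hF : MDifferentiableAt I I F (G x)) (hG : MDifferentiableAt I I G x) (v : TangentSpace I x) :
    η.val (K x) (mfderiv I I K x v) = η.val (F (G x)) (mfderiv I I F (G x) (mfderiv I I G x v)) := by
  obtain rfl : K = F ∘ G := funext hK
  rw [mfderiv_comp x hF hG]
  rfl

/-- A continuous action of a topological group by isometries. -/
structure IsometricAction {A : Type*} [TopologicalSpace A] [Group A] (g : RMetric I M)
    (act : A → M → M) : Prop where
  continuous : Continuous (uncurry act)
  one : ∀ x, act 1 x = x
  mul : ∀ a b x, act (a * b) x = act a (act b x)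
  isom : ∀ a x v w, g.val (act a x) (mfderiv I I (act a) x v) (mfderiv I I (act a) x w)
    = g.val x v w

variable {A : Type*} [TopologicalSpace A] [Group A] {g : RMetric I M} {act : A → M → M}

lemma IsometricAction.family [ContinuousInv A] (h : IsometricAction g act) :
    IsometricFamily g act (fun a => act a⁻¹) where
  continuous := h.continuous
  continuous' := h.continuous.comp (by fun_prop : Continuous fun p : A × M => (p.1⁻¹, p.2))
  left_inv a x := by rw [← h.mul, inv_mul_cancel, h.one]
  right_inv a x := by rw [← h.mul, mul_inv_cancel, h.one]
  isom := h.isom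
  isom' a := h.isom a⁻¹

variable [I.Boundaryless] [FiniteDimensional ℝ E] [Nontrivial E]

/-- Under a continuous action by isometries, the pullbacks of a form depend continuously on the
group element. -/
lemma IsometricAction.continuous_form [IsTopologicalGroup A] (hM : HasSpanningVF I M)
    (h : IsometricAction g act) (η : OneForm I M) (x : M) (v : TangentSpace I x) :
    Continuous fun a => η.val (act a x) (mfderiv I I (act a) x v) := by
  have key : ∀ (x₀ : M) (w : TangentSpace I x₀),
      ContinuousAt (fun a => η.val (act a x₀) (mfderiv I I (act a) x₀ w)) 1 := by
    intro x₀ w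
    obtain ⟨ρ, m, C, s, hs, hρ, hball, hb, -, -, hf⟩ :=
      h.family.exists_isIsomFamily hM h.one x₀
    set y₀ := extChartAt I x₀ x₀ with hy₀
    have hy₀t : y₀ ∈ (extChartAt I x₀).target := hball (mem_ball_self hρ)
    have hsymm : (extChartAt I x₀).symm y₀ = x₀ :=
      (extChartAt I x₀).left_inv (mem_extChartAt_source x₀)
    have h1 := (hf.continuousOn_deriv hb (by positivity)).continuousAt
      (prod_mem_nhds hs (hf.isOpen.mem_nhds (mem_ball_self (by positivity))))
    have h2 : ContinuousAt (fun a => chartMapD I x₀ (act a) y₀) 1 :=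
      ContinuousAt.comp (f := fun a : A => (a, y₀))
        (g := uncurry fun a => chartMapD I x₀ (act a)) h1 (by fun_prop)
    obtain ⟨h3, h4⟩ := continuousAt_chartMap (I := I) h.continuous (a := 1) hy₀t
      (by rw [hsymm, h.one]; exact mem_extChartAt_source x₀)
    have h5 : ContinuousAt (fun a => extChartAt I x₀ (act a x₀)) 1 := by
      have := ContinuousAt.comp (f := fun a : A => (a, y₀))
        (g := uncurry fun a => chartMap I x₀ (act a)) h3 (by fun_prop)
      refine this.congr (Eventually.of_forall fun a => ?_)
      show extChartAt I x₀ (act a ((extChartAt I x₀).symm y₀)) = _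
      rw [hsymm]
    have h6 : ContinuousAt (fun a => formC x₀ η (extChartAt I x₀ (act a x₀))) 1 := by
      refine ContinuousAt.comp (f := fun a => extChartAt I x₀ (act a x₀)) (g := formC x₀ η) ?_ h5
      rw [h.one]
      exact (contDiffAt_formC hM η (mem_extChartAt_source x₀)).continuousAt
    have h7 : ContinuousAt (fun a => formC x₀ η (extChartAt I x₀ (act a x₀))
        (chartMapD I x₀ (act a) y₀ (chartD I x₀ x₀ w))) 1 :=
      h6.clm_apply (h2.clm_apply continuousAt_const)
    refine h7.congr ?_
    have h8 : ∀ᶠ a : A in 𝓝 1, act a ((extChartAt I x₀).symm y₀) ∈ (extChartAt I x₀).source :=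
      (by fun_prop : ContinuousAt (fun a : A => (a, y₀)) 1).eventually h4
    filter_upwards [h8] with a ha
    rw [hsymm] at ha
    rw [chartMapD_extChartAt]
    exact formC_extChartAt ha η _
  refine continuous_iff_continuousAt.2 fun a₁ => ?_
  have h1 := key (act a₁ x) (mfderiv I I (act a₁) x v)
  have h2 : ContinuousAt (fun a : A => a * a₁⁻¹) a₁ := by fun_prop
  have h3 : (fun a => η.val (act a x) (mfderiv I I (act a) x v)) = (fun b =>
      η.val (act b (act a₁ x)) (mfderiv I I (act b) (act a₁ x) (mfderiv I I (act a₁) x v))) ∘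
      fun a => a * a₁⁻¹ := by
    funext a
    refine η.val_mfderiv_comp (fun z => ?_) (mdifferentiableAt_of_isom (h.isom _ _))
      (mdifferentiableAt_of_isom (h.isom _ _)) v
    rw [← h.mul, inv_mul_cancel_right]
  rw [h3]
  exact ContinuousAt.comp (by simpa only [mul_inv_cancel] using h1) h2

/-- If the Lie derivative of a form along the generator of an isometric flow is a multiple of the
form, then the flow preserves the kernel of the form. -/
lemma IsGenerator.form_eq_zero (hM : HasSpanningVF I M) {X : VF I M} {φ : ℝ → M → M}
    (h : IsGenerator X φ) (hφ : IsometricFlow g φ) {η : OneForm I M} {F : M → ℝ}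
    (hF : Continuous F)
    (hL : ∀ V, SmoothVF I V → ∀ x, lieOneForm I η X V x = F x * η.val x (V x))
    {x : M} {v : TangentSpace I x} (hv : η.val x v = 0) (t : ℝ) :
    η.val (φ t x) (mfderiv I I (φ t) x v) = 0 := by
  set u : ℝ → ℝ := fun t => η.val (φ t x) (mfderiv I I (φ t) x v) with hu
  have hder : ∀ t, HasDerivAt u (F (φ t x) * u t) t := by
    intro t
    obtain ⟨V, hV, hVx⟩ := hM (φ t x) (mfderiv I I (φ t) x v)
    have h1 := h.hasDerivAt_form hM η hV (φ t x)
    rw [hL V hV, hVx] at h1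
    have h2 : HasDerivAt (fun s : ℝ => s - t) 1 t := (hasDerivAt_id t).sub_const t
    have h3 := HasDerivAt.comp (h := fun s : ℝ => s - t) t (by rw [sub_self]; exact h1) h2
    rw [mul_one] at h3
    refine h3.congr_of_eventuallyEq (Eventually.of_forall fun s => ?_)
    refine η.val_mfderiv_comp (fun z => ?_) (mdifferentiableAt_of_isom (hφ.isom _ _))
      (mdifferentiableAt_of_isom (hφ.isom _ _)) v
    rw [← hφ.add, sub_add_cancel]
  have hFc : Continuous fun t => F (φ t x) :=
    hF.comp (hφ.continuous.comp (by fun_prop : Continuous fun t : ℝ => (t, x)))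
  have hG : ∀ t, HasDerivAt (fun t => ∫ s in (0 : ℝ)..t, F (φ s x)) (F (φ t x)) t := fun t =>
    intervalIntegral.integral_hasDerivAt_right (hFc.intervalIntegrable _ _)
      hFc.stronglyMeasurable.stronglyMeasurableAtFilter hFc.continuousAt
  have hw : ∀ t, HasDerivAt (fun t => Real.exp (-∫ s in (0 : ℝ)..t, F (φ s x)) * u t) 0 t := by
    intro t
    refine ((hG t).neg.exp.mul (hder t)).congr_deriv ?_
    ring
  have hconst := is_const_of_deriv_eq_zero (fun t => (hw t).differentiableAt)
    (fun t => (hw t).deriv) t 0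
  have hu0 : u 0 = 0 := by
    have h0 : ∀ f : M → M, f = id → η.val (f x) (mfderiv I I f x v) = 0 := by
      rintro f rfl
      rw [mfderiv_id]
      exact hv
    exact h0 _ (funext hφ.zero)
  simpa [hu0, Real.exp_ne_zero] using hconst

end IsometricActions

section CommutingFlows

open Filter Topology Metric
open scoped ContDiff

set_option maxSynthPendingDepth 3

variable [I.Boundaryless] {X Y Z : VF I M} {φ ψ : ℝ → M → M}

lemma IsFlowOf.hasDerivAt_chart' (h : IsFlowOf I X φ) {x₀ x : M} {t : ℝ}
    (hx : φ t x ∈ (extChartAt I x₀).source) :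
    HasDerivAt (fun s => extChartAt I x₀ (φ s x))
      (chartV I x₀ X (extChartAt I x₀ (φ t x))) t := by
  rw [chartV_extChartAt x₀ X hx]
  exact hasDerivAt_chart_of_hasMFDerivAt (c := fun s => φ s x) hx (h.2.2.2 x t)

/-- The composition of two commuting flows is generated by the sum of the generators. -/
lemma IsFlowOf.eq_add (hX : SmoothVF I X) (hY : SmoothVF I Y) (hφ : IsFlowOf I X φ)
    (hψ : IsFlowOf I Y ψ) (hZ : IsFlowOf I Z fun t x => φ t (ψ t x))
    (hcomm : ∀ s t x, φ s (ψ t x) = ψ t (φ s x)) : Z = X + Y := by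
  funext x₀
  set y₀ := extChartAt I x₀ x₀ with hy₀
  have hF : Continuous fun p : ℝ × ℝ => φ p.1 (ψ p.2 x₀) :=
    hφ.1.comp (continuous_fst.prodMk
      (hψ.1.comp (by fun_prop : Continuous fun p : ℝ × ℝ => (p.2, x₀))))
  have h0 : φ 0 (ψ 0 x₀) = x₀ := by rw [hφ.2.1, hψ.2.1]
  have hsrc : ∀ᶠ p : ℝ × ℝ in 𝓝 (0, 0), φ p.1 (ψ p.2 x₀) ∈ (extChartAt I x₀).source :=
    hF.continuousAt.eventually_mem ((isOpen_extChartAt_source x₀).mem_nhds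
      (by rw [h0]; exact mem_extChartAt_source x₀))
  have hc : ContinuousAt (fun p : ℝ × ℝ => extChartAt I x₀ (φ p.1 (ψ p.2 x₀))) (0, 0) :=
    ContinuousAt.comp (g := extChartAt I x₀)
      (by rw [h0]; exact continuousAt_extChartAt x₀) hF.continuousAt
  have hcV : ∀ {V : VF I M}, SmoothVF I V → ContinuousAt
      (fun p : ℝ × ℝ => chartV I x₀ V (extChartAt I x₀ (φ p.1 (ψ p.2 x₀)))) (0, 0) := by
    intro V hV
    refine ContinuousAt.comp (g := chartV I x₀ V) ?_ hc
    rw [h0]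
    exact (hV.contDiffAt_chartV (mem_extChartAt_source x₀)).continuousAt
  have hsm : ∀ {V : VF I M}, SmoothVF I V → ContinuousAt
      (↿fun s t : ℝ => ContinuousLinearMap.toSpanSingleton ℝ
        (chartV I x₀ V (extChartAt I x₀ (φ s (ψ t x₀))))) (0, 0) := by
    intro V hV
    exact (ContinuousLinearMap.toSpanSingletonCLE (𝕜 := ℝ) (E := E)).continuous.continuousAt.comp
      (hcV hV)
  have hstrict := hasStrictFDerivAt_uncurry_coprod (u := ((0 : ℝ), (0 : ℝ)))
    (f := fun s t => extChartAt I x₀ (φ s (ψ t x₀)))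
    (f₁ := fun s t => ContinuousLinearMap.toSpanSingleton ℝ
      (chartV I x₀ X (extChartAt I x₀ (φ s (ψ t x₀)))))
    (f₂ := fun s t => ContinuousLinearMap.toSpanSingleton ℝ
      (chartV I x₀ Y (extChartAt I x₀ (φ s (ψ t x₀)))))
    (by
      filter_upwards [hsrc] with p hp
      exact (hφ.hasDerivAt_chart' hp).hasFDerivAt)
    (by
      filter_upwards [hsrc] with p hp
      show HasFDerivAt (fun t => extChartAt I x₀ (φ p.1 (ψ t x₀)))
        (ContinuousLinearMap.toSpanSingleton ℝ
          (chartV I x₀ Y (extChartAt I x₀ (φ p.1 (ψ p.2 x₀))))) p.2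
      simp only [hcomm] at hp ⊢
      exact (hψ.hasDerivAt_chart' hp).hasFDerivAt)
    (hsm hX) (hsm hY)
  have hd : HasDerivAt (fun t : ℝ => (t, t)) ((1 : ℝ), (1 : ℝ)) 0 :=
    (hasDerivAt_id _).prodMk (hasDerivAt_id _)
  have h1 := HasFDerivAt.comp_hasDerivAt (f := fun t : ℝ => (t, t)) (0 : ℝ) hstrict.hasFDerivAt hd
  have h2 := (hZ.hasDerivAt_chart x₀).unique h1
  refine chartD_injective (I := I) (mem_extChartAt_source x₀) (h2.trans ?_)
  show (1 : ℝ) • chartV I x₀ X (extChartAt I x₀ (φ 0 (ψ 0 x₀)))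
    + (1 : ℝ) • chartV I x₀ Y (extChartAt I x₀ (φ 0 (ψ 0 x₀))) = _
  rw [h0, one_smul, one_smul, chartV_extChartAt x₀ X (mem_extChartAt_source x₀),
    chartV_extChartAt x₀ Y (mem_extChartAt_source x₀)]
  exact (map_add _ _ _).symm

lemma IsFlowOf.eq_smul (hφ : IsFlowOf I X φ) {c : ℝ} (hZ : IsFlowOf I Z fun t => φ (c * t)) :
    Z = c • X := by
  funext x₀
  have h1 := hφ.hasDerivAt_chart x₀
  have hd : HasDerivAt (fun t : ℝ => c * t) c 0 := by
    simpa using (hasDerivAt_id (0 : ℝ)).const_mul c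
  have h2 : HasDerivAt (fun t => extChartAt I x₀ (φ (c * t) x₀))
      (c • (chartD I x₀ x₀ (X x₀) : E)) 0 :=
    HasDerivAt.scomp (h := fun t : ℝ => c * t) (g₁ := fun t => extChartAt I x₀ (φ t x₀)) 0
      (by rwa [mul_zero]) hd
  exact chartD_injective (I := I) (mem_extChartAt_source x₀)
    (((hZ.hasDerivAt_chart x₀).unique h2).trans (map_smul _ _ _).symm)

/-- A map commuting with a flow preserves its generator. -/
lemma IsFlowOf.mfderiv_apply (hφ : IsFlowOf I X φ) {F : M → M} {x : M}
    (hF : MDifferentiableAt I I F x) (hcomm : ∀ t, F (φ t x) = φ t (F x)) :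
    mfderiv I I F x (X x) = X (F x) := by
  have hbase : ∀ w z, z = w → HasMFDerivAt 𝓘(ℝ) I (fun s => φ s w) 0
      ((1 : ℝ →L[ℝ] ℝ).smulRight (X z) : ℝ →L[ℝ] E) →
      HasMFDerivAt 𝓘(ℝ) I (fun s => φ s w) 0
      ((1 : ℝ →L[ℝ] ℝ).smulRight (X w) : ℝ →L[ℝ] E) := by
    rintro w z rfl h
    exact h
  have h1 := hbase x _ (hφ.2.1 x) (hφ.2.2.2 x 0)
  have h2 := hbase (F x) _ (hφ.2.1 (F x)) (hφ.2.2.2 (F x) 0)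
  obtain ⟨L, hL⟩ : ∃ L : E →L[ℝ] E, L = mfderiv I I F x := ⟨_, rfl⟩
  have h3 : ∀ z, z = x → HasMFDerivAt I I F z L := by
    rintro z rfl
    rw [hL]
    exact hF.hasMFDerivAt
  have h4 := HasMFDerivAt.comp (g := F) (f := fun s => φ s x) (0 : ℝ) (h3 _ (hφ.2.1 x)) h1
  have h5 : F ∘ (fun s => φ s x) = fun s => φ s (F x) := funext hcomm
  rw [h5] at h4
  have h6 : (L.comp ((1 : ℝ →L[ℝ] ℝ).smulRight (X x) : ℝ →L[ℝ] E))
    = ((1 : ℝ →L[ℝ] ℝ).smulRight (X (F x)) : ℝ →L[ℝ] E) := hasMFDerivAt_unique h4 h2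
  have h7 := DFunLike.congr_fun h6 1
  have h8 : L ((1 : ℝ) • (X x : E)) = (1 : ℝ) • (X (F x) : E) := h7
  rw [one_smul, one_smul, hL] at h8
  exact h8

end CommutingFlows

section TorusSubgroups

open Filter Topology Metric
open scoped ContDiff

set_option maxSynthPendingDepth 3

/-- A continuous one-parameter subgroup of the circle is of the form `t ↦ exp (i t θ)`. -/
lemma exists_eq_circleExp {f : ℝ → Circle} (hf : Continuous f)
    (hadd : ∀ s t, f (s + t) = f s * f t) : ∃ θ : ℝ, ∀ t, f t = Circle.exp (t * θ) := by
  have hFc : Continuous fun t => (f t : ℂ) := continuous_subtype_val.comp hf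
  have hF0 : (f 0 : ℂ) = 1 := by
    have := hadd 0 0
    rw [add_zero, left_eq_mul] at this
    rw [this, Circle.coe_one]
  have hG : ∀ t, HasDerivAt (fun t => ∫ s in (0 : ℝ)..t, (f s : ℂ)) (f t) t := fun t =>
    intervalIntegral.integral_hasDerivAt_right (hFc.intervalIntegrable _ _)
      hFc.stronglyMeasurable.stronglyMeasurableAtFilter hFc.continuousAt
  obtain ⟨ε, hε⟩ : ∃ ε : ℝ, ∫ s in (0 : ℝ)..ε, (f s : ℂ) ≠ 0 := by
    by_contra! h
    have h1 := hG 0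
    simp only [h, hF0] at h1
    exact one_ne_zero (h1.unique (hasDerivAt_const _ _))
  set c := ∫ s in (0 : ℝ)..ε, (f s : ℂ) with hc
  have hfc : ∀ t, (f t : ℂ) = ((∫ s in (0 : ℝ)..t + ε, (f s : ℂ)) - ∫ s in (0 : ℝ)..t, (f s : ℂ)) / c := by
    intro t
    rw [eq_div_iff hε, intervalIntegral.integral_interval_sub_left (hFc.intervalIntegrable _ _)
      (hFc.intervalIntegrable _ _), hc, ← intervalIntegral.integral_const_mul]
    have h1 := intervalIntegral.integral_comp_add_left (a := 0) (b := ε) (fun s => (f s : ℂ)) t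
    rw [add_zero] at h1
    rw [← h1]
    simp only [hadd, Circle.coe_mul]
  set l := ((f ε : ℂ) - 1) / c with hl
  have hder : ∀ t, HasDerivAt (fun t => (f t : ℂ)) (l * f t) t := by
    intro t
    have h1 : HasDerivAt (fun t : ℝ => ∫ s in (0 : ℝ)..t + ε, (f s : ℂ)) (f (t + ε)) t :=
      (hG (t + ε)).comp_add_const t ε
    have h2 := (h1.sub (hG t)).div_const c
    have h3 : (fun t => (f t : ℂ)) = fun t =>
      ((∫ s in (0 : ℝ)..t + ε, (f s : ℂ)) - ∫ s in (0 : ℝ)..t, (f s : ℂ)) / c := funext hfc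
    rw [h3]
    refine h2.congr_deriv ?_
    simp only [hadd, Circle.coe_mul, hl]
    ring
  have hexp : ∀ t : ℝ, HasDerivAt (fun t : ℝ => Complex.exp (-(l * t))) (-l * Complex.exp (-(l * t))) t := by
    intro t
    have h1 : HasDerivAt (fun t : ℝ => -(l * (t : ℂ))) (-l) t := by
      refine (((Complex.ofRealCLM.hasDerivAt (x := t)).const_mul l).neg).congr_deriv ?_
      simp
    refine h1.cexp.congr_deriv (mul_comm _ _)
  have hconst : ∀ t, (f t : ℂ) = Complex.exp (l * t) := by
    intro t
    have h1 : ∀ t, HasDerivAt (fun t : ℝ => (f t : ℂ) * Complex.exp (-(l * t))) 0 t := fun t =>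
      ((hder t).mul (hexp t)).congr_deriv (by ring)
    have h2 := is_const_of_deriv_eq_zero (fun t => (h1 t).differentiableAt)
      (fun t => (h1 t).deriv) t 0
    simp only [hF0, Complex.ofReal_zero, mul_zero, neg_zero, Complex.exp_zero, mul_one] at h2
    rw [Complex.exp_neg, ← div_eq_mul_inv, div_eq_one_iff_eq (Complex.exp_ne_zero _)] at h2
    exact h2
  have hre : l.re = 0 := by
    have h1 := Circle.norm_coe (f 1)
    rw [hconst, Complex.norm_exp] at h1
    simpa using h1
  refine ⟨l.im, fun t => Circle.ext ?_⟩
  rw [hconst, Circle.coe_exp]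
  congr 1
  apply Complex.ext <;> simp [hre, mul_comm]

/-- The one-parameter subgroup of the torus with velocity `θ`. -/
def torusExp {k : ℕ} (θ : Fin k → ℝ) (t : ℝ) : Torus k := fun i => Circle.exp (t * θ i)

lemma continuous_torusExp {k : ℕ} (θ : Fin k → ℝ) : Continuous (torusExp θ) :=
  continuous_pi fun i => Circle.exp.continuous.comp (by fun_prop)

lemma torusExp_zero {k : ℕ} (θ : Fin k → ℝ) : torusExp θ 0 = 1 := by
  funext i
  simp [torusExp]

lemma torusExp_add {k : ℕ} (θ : Fin k → ℝ) (s t : ℝ) :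
    torusExp θ (s + t) = torusExp θ s * torusExp θ t := by
  funext i
  simp [torusExp, add_mul]

lemma torusExp_add_left {k : ℕ} (θ θ' : Fin k → ℝ) (t : ℝ) :
    torusExp (θ + θ') t = torusExp θ t * torusExp θ' t := by
  funext i
  simp [torusExp, mul_add]

lemma torusExp_smul {k : ℕ} (c : ℝ) (θ : Fin k → ℝ) (t : ℝ) :
    torusExp (c • θ) t = torusExp θ (c * t) := by
  funext i
  simp only [torusExp, Pi.smul_apply, smul_eq_mul]
  ring_nf

lemma eq_zero_of_torusExp_eq_one {k : ℕ} {θ : Fin k → ℝ}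
    (h : ∀ᶠ t in 𝓝 (0 : ℝ), torusExp θ t = 1) : θ = 0 := by
  funext i
  by_contra hθ
  have h1 : Tendsto (fun s : ℝ => s / θ i) (𝓝 0) (𝓝 0) := by
    have : Continuous fun s : ℝ => s / θ i := by fun_prop
    simpa using this.tendsto 0
  obtain ⟨ε, hε, hs⟩ := Metric.eventually_nhds_iff.1 (h1.eventually h)
  set s := min (ε / 2) 1 with hs'
  have hs0 : 0 < s := by positivity
  have h2 := congrFun (@hs s (by
    rw [Real.dist_eq, sub_zero, abs_of_pos hs0]
    exact (min_le_left _ _).trans_lt (by linarith))) i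
  simp only [torusExp, Pi.one_apply, div_mul_cancel₀ _ hθ] at h2
  obtain ⟨n, hn⟩ := Circle.exp_eq_one.1 h2
  have h3 : s ≤ 1 := min_le_right _ _
  have hpi := Real.pi_gt_three
  have h4 : (0 : ℝ) < n := by
    by_contra! hn0
    nlinarith
  have h5 : (1 : ℝ) ≤ n := by exact_mod_cast h4
  nlinarith

lemma torusExp_intCast {k : ℕ} {θ : Fin k → ℝ} {N : ℕ} {m : Fin k → ℤ}
    (h : ∀ i, N * θ i = m i) : torusExp θ (2 * Real.pi * N) = 1 := by
  funext i
  refine Circle.exp_eq_one.2 ⟨m i, ?_⟩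
  rw [← h]
  ring

/-- A one-parameter group of homeomorphisms contained in a free torus action whose orbits are the
closures of its orbits is given by a dense one-parameter subgroup of the torus. -/
lemma PrincipalTorusBundle.exists_torusExp {k n : ℕ} {M : Type*} [TopologicalSpace M] [Nonempty M]
    (P : PrincipalTorusBundle k n M) {φ : ℝ → M → M}
    (hc : Continuous fun p : ℝ × M => φ p.1 p.2)
    (hadd : ∀ s t x, φ (s + t) x = φ s (φ t x))
    (hflow : ∀ t : ℝ, ∃ a : Torus k, ∀ x, φ t x = P.act a x)
    (horb : ∀ x, {y | ∃ a : Torus k, P.act a x = y} = closure (Set.range fun t : ℝ => φ t x)) :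
    ∃ θ : Fin k → ℝ, (∀ t x, φ t x = P.act (torusExp θ t) x) ∧
      ∀ a, a ∈ closure (range (torusExp θ)) := by
  obtain ⟨x⟩ := ‹Nonempty M›
  choose a ha using hflow
  have hinj : ∀ u w : Torus k, P.act u x = P.act w x → u = w := by
    intro u w h
    have h1 : P.act (w⁻¹ * u) x = x := by
      rw [P.act_mul, h, ← P.act_mul, inv_mul_cancel, P.act_one]
    have h2 := P.free _ _ h1
    rwa [inv_mul_eq_one, eq_comm] at h2
  have hamul : ∀ s t, a (s + t) = a s * a t := fun s t => hinj _ _ (by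
    rw [P.act_mul, ← ha, ← ha, ← ha, hadd])
  letI := P.tB
  obtain ⟨e, hb, he⟩ := P.loc_triv (P.proj x)
  have hx : x ∈ e.source := e.mem_source.2 hb
  have hact : ∀ u : Torus k, (e (P.act u x)).2 * (e x).2⁻¹ = u := fun u => by
    rw [(he u x hx).2, mul_inv_cancel_right]
  have hecont : ContinuousOn (fun z => (e z).2 * (e x).2⁻¹) e.source :=
    (continuous_snd.comp_continuousOn e.continuousOn_toFun).mul continuousOn_const
  have hacont : Continuous a := by
    have h1 : Continuous fun t => φ t x := hc.comp (by fun_prop : Continuous fun t : ℝ => (t, x))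
    have h2 : Continuous fun t => (e (φ t x)).2 * (e x).2⁻¹ :=
      hecont.comp_continuous h1 fun t => by rw [ha]; exact (he _ x hx).1
    refine h2.congr fun t => ?_
    rw [ha, hact]
  choose θ hθ using fun i => exists_eq_circleExp (f := fun t => a t i)
    ((continuous_apply i).comp hacont) (fun s t => by rw [hamul]; rfl)
  have haθ : ∀ t, a t = torusExp θ t := fun t => funext fun i => hθ i t
  refine ⟨θ, fun t z => by rw [ha, haθ], fun u => ?_⟩
  rw [_root_.mem_closure_iff]
  intro U hU hu
  have hO : IsOpen (e.source ∩ (fun z => (e z).2 * (e x).2⁻¹) ⁻¹' U) :=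
    hecont.isOpen_inter_preimage e.open_source hU
  have hmem : P.act u x ∈ closure (range fun t : ℝ => φ t x) := by
    rw [← horb]; exact ⟨u, rfl⟩
  obtain ⟨z, ⟨hz, hzU⟩, t, rfl⟩ := _root_.mem_closure_iff.1 hmem _ hO
    ⟨(he u x hx).1, by rw [mem_preimage, hact]; exact hu⟩
  refine ⟨torusExp θ t, ?_, t, rfl⟩
  simp only [mem_preimage, ha, hact] at hzU
  rwa [← haθ]

end TorusSubgroups

section TorusGenerators

open Filter Topology Metric
open scoped ContDiff

set_option maxSynthPendingDepth 3

variable [I.Boundaryless]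

/-- A point at which the generator vanishes along the whole orbit is locally fixed by the flow. -/
lemma IsFlowOf.eventually_eq_self {X : VF I M} {φ : ℝ → M → M} (h : IsFlowOf I X φ) {x : M}
    (hx : ∀ t, X (φ t x) = 0) : ∀ᶠ t in 𝓝 (0 : ℝ), φ t x = x := by
  obtain ⟨ε, hε, hs⟩ := Metric.eventually_nhds_iff_ball.1 (h.eventually_mem_source x)
  have hd : ∀ t ∈ ball (0 : ℝ) ε, HasDerivAt (fun s => extChartAt I x (φ s x)) 0 t := by
    intro t ht
    refine (h.hasDerivAt_chart' (hs t ht)).congr_deriv ?_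
    rw [chartV_extChartAt x X (hs t ht), hx]
    exact map_zero _
  filter_upwards [ball_mem_nhds (0 : ℝ) hε] with t ht
  have h1 : extChartAt I x (φ t x) = extChartAt I x (φ 0 x) :=
    isOpen_ball.is_const_of_deriv_eq_zero (convex_ball (0 : ℝ) ε).isPreconnected
      (fun s hs => (hd s hs).differentiableAt.differentiableWithinAt)
      (fun s hs => (hd s hs).deriv) ht (mem_ball_self hε)
  rw [h.2.1] at h1
  exact (extChartAt I x).injOn (hs t ht) (mem_extChartAt_source x) h1

variable [FiniteDimensional ℝ E] [Nontrivial E] {k : ℕ} {g : RMetric I M} {act : Torus k → M → M}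

omit [I.Boundaryless] [FiniteDimensional ℝ E] [Nontrivial E] in
lemma IsometricAction.isometricFlow (h : IsometricAction g act) (θ : Fin k → ℝ) :
    IsometricFlow g (fun t => act (torusExp θ t)) where
  continuous := h.continuous.comp
    (((continuous_torusExp θ).comp continuous_fst).prodMk continuous_snd)
  zero x := by rw [torusExp_zero, h.one]
  add s t x := by rw [torusExp_add, h.mul]
  isom t := h.isom _

/-- The infinitesimal generators of a torus action by isometries depend linearly on the velocity,
and they are pointwise linearly independent if the action is free. -/
theorem IsometricAction.exists_generators (hM : HasSpanningVF I M) (h : IsometricAction g act) :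
    ∃ X : (Fin k → ℝ) →ₗ[ℝ] VF I M,
      (∀ θ, IsGenerator (X θ) fun t => act (torusExp θ t)) ∧
      ((∀ a x, act a x = x → a = 1) → ∀ x θ, X θ x = 0 → θ = 0) := by
  choose X hX1 hX2 hX3 using fun θ => (h.isometricFlow θ).exists_generator hM
  have hgen : ∀ θ, IsGenerator (X θ) fun t => act (torusExp θ t) := fun θ =>
    ⟨hX1 θ, hX2 θ, hX3 θ⟩
  have hcomm : ∀ a b x, act a (act b x) = act b (act a x) := fun a b x => by
    rw [← h.mul, mul_comm, h.mul]
  refine ⟨⟨⟨X, fun θ θ' => ?_⟩, fun c θ => ?_⟩, hgen, fun hfree x θ hx => ?_⟩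
  · refine (hX2 θ).eq_add (hX1 θ) (hX1 θ') (hX2 θ') ?_ (fun s t x => hcomm _ _ _)
    have h1 : (fun t => act (torusExp (θ + θ') t))
        = fun t x => act (torusExp θ t) (act (torusExp θ' t) x) := by
      funext t x
      rw [torusExp_add_left, h.mul]
    rw [← h1]
    exact hX2 (θ + θ')
  · refine (hX2 θ).eq_smul (c := c) ?_
    have := hX2 (c • θ)
    simpa only [torusExp_smul] using this
  · refine eq_zero_of_torusExp_eq_one ?_
    have h1 := (hX2 θ).eventually_eq_self (x := x) fun t => by
      have h2 := (hX2 θ).mfderiv_apply (F := act (torusExp θ t)) (x := x)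
        (mdifferentiableAt_of_isom (h.isom _ _)) (fun s => hcomm _ _ _)
      rw [← h2]
      exact (congrArg _ hx).trans (map_zero _)
    filter_upwards [h1] with t ht
    exact hfree _ _ ht

end TorusGenerators

section EngelSymmetries

open Filter Topology Metric
open scoped ContDiff

set_option maxSynthPendingDepth 3

lemma vderiv_of_forall_eq {f : M → ℝ} {c : ℝ} (hf : ∀ x, f x = c) (V : VF I M) (x : M) :
    vderiv I V f x = 0 := by
  obtain rfl : f = fun _ => c := funext hf
  rw [vderiv, mfderiv_const]
  rfl

/-- A Killing field of a K-Engel structure is dual to the form `α`. -/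
lemma IsKEngel.metric_reeb {D : TangentDist I M} {g : RMetric I M} {R : VF I M}
    (hK : IsKEngel I D g R) {α β : OneForm I M} (hforms : EngelDefiningForms I D α β)
    (hR : ∀ x, α.val x (R x) = 1) (x : M) (v : TangentSpace I x) :
    g.val x (R x) v = α.val x v * g.val x (R x) (R x) := by
  have h1 : v - α.val x v • R x ∈ derivedDist I D x := by
    rw [hforms.2, LinearMap.mem_ker, map_sub, map_smul, hR, smul_eq_mul, mul_one, sub_self]
  have h2 := hK.orth x _ h1
  rw [map_sub, map_smul, smul_eq_mul, sub_eq_zero] at h2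
  exact h2

/-- The Lie derivative of `β` along the Reeb field `R` is a multiple of `β`. -/
lemma IsReebPair.exists_lie_beta [I.Boundaryless] [CompleteSpace E] {α β : OneForm I M}
    {T R : VF I M} (h : IsReebPair I α β T R) : ∃ F : M → ℝ, Continuous F ∧
      ∀ V, SmoothVF I V → ∀ x, lieOneForm I β R V x = F x * β.val x (V x) := by
  have hd : ∀ V x, lieOneForm I β R V x = β.d R V x := fun V x => by
    rw [lieOneForm, OneForm.d, dOfFun, vderiv_of_forall_eq h.betaR, sub_zero]
  refine ⟨fun x => lieOneForm I β R T x, ?_, fun V hV x => ?_⟩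
  · have h1 : (fun x => lieOneForm I β R T x) = fun x => - β.val x (vfLie I R T x) := by
      funext x
      rw [lieOneForm, vderiv_of_forall_eq h.betaT, zero_sub]
    rw [h1]
    exact (β.smooth' _ (h.smoothR.vfLie h.smoothT)).continuous.neg
  · have h1 := h.insR V T hV h.smoothT x
    rw [wedge1_2, h.betaR, h.betaT] at h1
    show lieOneForm I β R V x = lieOneForm I β R T x * β.val x (V x)
    rw [hd, hd]
    linarith

variable [I.Boundaryless] [FiniteDimensional ℝ E] [Nontrivial E] {k : ℕ} {g : RMetric I M}
  {act : Torus k → M → M}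

/-- Let the Reeb field of a K-Engel structure generate a dense one-parameter subgroup of a torus
acting by isometries.  Then every generator of the torus action is an Engel and Killing vector
field preserving the form `α`. -/
theorem IsKEngel.torus_generator (hM : HasSpanningVF I M) {D : TangentDist I M} {R : VF I M}
    (hK : IsKEngel I D g R) {α β : OneForm I M} (hforms : EngelDefiningForms I D α β)
    {T : VF I M} (hTR : IsReebPair I α β T R) (hact : IsometricAction g act) {θ₀ : Fin k → ℝ}
    (hR : IsGenerator R fun t => act (torusExp θ₀ t))
    (hdense : ∀ a, a ∈ closure (range (torusExp θ₀))) {X : VF I M} {θ : Fin k → ℝ}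
    (hX : IsGenerator X fun t => act (torusExp θ t)) :
    (∀ V, SmoothVF I V → ∀ x, lieOneForm I α X V x = 0) ∧ IsEngelVF I D X ∧ IsKilling I g X := by
  have hcomm : ∀ a b x, act a (act b x) = act b (act a x) := fun a b x => by
    rw [← hact.mul, mul_comm, hact.mul]
  have hpush : ∀ a x, mfderiv I I (act a) x (R x) = R (act a x) := fun a x =>
    hR.flow.mfderiv_apply (mdifferentiableAt_of_isom (hact.isom _ _)) fun t => hcomm _ _ _
  have hα : ∀ a x v, α.val (act a x) (mfderiv I I (act a) x v) = α.val x v := by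
    intro a x v
    have h1 := hK.metric_reeb hforms hTR.alphaR (act a x) (mfderiv I I (act a) x v)
    have h2 := hact.isom a x (R x) (R x)
    have h3 := hact.isom a x (R x) v
    rw [hpush] at h2 h3
    rw [h3, h2, hK.metric_reeb hforms hTR.alphaR x v] at h1
    exact (mul_right_cancel₀ (g.posdef x _ (hK.nonzero x)).ne' h1).symm
  obtain ⟨F, hFc, hF⟩ := hTR.exists_lie_beta
  have hβ : ∀ a x v, β.val x v = 0 → β.val (act a x) (mfderiv I I (act a) x v) = 0 := by
    intro a x v hv
    have h1 : IsClosed {a | β.val (act a x) (mfderiv I I (act a) x v) = 0} :=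
      isClosed_eq (hact.continuous_form hM β x v) continuous_const
    refine closure_minimal ?_ h1 (hdense a)
    rintro _ ⟨t, rfl⟩
    exact hR.form_eq_zero hM (hact.isometricFlow θ₀) hFc hF hv t
  have hlα : ∀ V, SmoothVF I V → ∀ x, lieOneForm I α X V x = 0 := fun V hV x =>
    hX.lieOneForm_eq_zero hM hV fun t => hα _ x (V x)
  refine ⟨hlα, ⟨hX.smooth, fun V hV x => ?_⟩, hX.isKilling hM (hact.isometricFlow θ)⟩
  have hVD : ∀ x, α.val x (V x) = 0 ∧ β.val x (V x) = 0 := fun x => by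
    have := hV.2 x
    rw [hforms.1] at this
    exact this
  have h1 := hlα V hV.1 x
  have h2 : lieOneForm I β X V x = 0 :=
    hX.lieOneForm_eq_zero hM hV.1 fun t => hβ _ x (V x) (hVD x).2
  rw [lieOneForm, vderiv_of_forall_eq fun y => (hVD y).1] at h1
  rw [lieOneForm, vderiv_of_forall_eq fun y => (hVD y).2] at h2
  rw [hforms.1]
  exact ⟨by simpa using h1, by simpa using h2⟩

end EngelSymmetries

section NewReebFields

open Filter Topology Metric
open scoped ContDiff

set_option maxSynthPendingDepth 3

lemma vderiv_add {f h : M → ℝ} (hf : SmoothFn I f) (hh : SmoothFn I h) (V : VF I M) (x : M) :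
    vderiv I V (fun y => f y + h y) x = vderiv I V f x + vderiv I V h x := by
  have h1 := (hf.mdifferentiableAt x).hasMFDerivAt.add (hh.mdifferentiableAt x).hasMFDerivAt
  rw [vderiv, show (fun y => f y + h y) = f + h from rfl, h1.mfderiv]
  rfl

lemma vderiv_mul {f h : M → ℝ} (hf : SmoothFn I f) (hh : SmoothFn I h) (V : VF I M) (x : M) :
    vderiv I V (fun y => f y * h y) x = f x * vderiv I V h x + h x * vderiv I V f x := by
  have h1 := (hf.mdifferentiableAt x).hasMFDerivAt.mul (hh.mdifferentiableAt x).hasMFDerivAt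
  rw [vderiv, show (fun y => f y * h y) = f * h from rfl, h1.mfderiv]
  rfl

lemma OneForm.d_of_const {η : OneForm I M} {V W : VF I M} {a b : ℝ}
    (hV : ∀ x, η.val x (V x) = a) (hW : ∀ x, η.val x (W x) = b) (x : M) :
    η.d V W x = - η.val x (vfLie I V W x) := by
  rw [OneForm.d, dOfFun, vderiv_of_forall_eq hV, vderiv_of_forall_eq hW]
  ring

/-- Multiplication of a `1`-form by a smooth function. -/
def OneForm.smulFn {f : M → ℝ} (hf : SmoothFn I f) (η : OneForm I M) : OneForm I M where
  val x := f x • η.val x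
  smooth' V hV := hf.mul (η.smooth' V hV)

/-- The difference of two `1`-forms. -/
def OneForm.subForm (η ζ : OneForm I M) : OneForm I M where
  val x := η.val x - ζ.val x
  smooth' V hV := (η.smooth' V hV).sub (ζ.smooth' V hV)

/-- The metric obtained from `g` by splitting `TM` as `ker η ⊕ ℝ X`, with `X` of length one. -/
def RMetric.adapt (g : RMetric I M) (η : OneForm I M) {X : VF I M} (hX : SmoothVF I X) :
    RMetric I M where
  val x := LinearMap.mk₂ ℝ
    (fun u v => g.val x (u - η.val x u • X x) (v - η.val x v • X x) + η.val x u * η.val x v)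
    (fun _ _ _ => by
      simp only [map_add, map_sub, map_smul, LinearMap.add_apply, LinearMap.sub_apply,
        LinearMap.smul_apply, smul_eq_mul]
      ring)
    (fun _ _ _ => by
      simp only [map_sub, map_smul, LinearMap.sub_apply, LinearMap.smul_apply, smul_eq_mul]
      ring)
    (fun _ _ _ => by
      simp only [map_add, map_sub, map_smul, LinearMap.sub_apply, LinearMap.smul_apply,
        smul_eq_mul]
      ring)
    (fun _ _ _ => by
      simp only [map_sub, map_smul, LinearMap.sub_apply, LinearMap.smul_apply, smul_eq_mul]
      ring)
  symm x u v := by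
    rw [LinearMap.mk₂_apply, LinearMap.mk₂_apply, g.symm, mul_comm]
  posdef x v hv := by
    rw [LinearMap.mk₂_apply]
    have hnn : ∀ w, 0 ≤ g.val x w w := fun w => by
      rcases eq_or_ne w 0 with rfl | hw
      · rw [map_zero]
      · exact (g.posdef x w hw).le
    by_cases h : η.val x v = 0
    · rw [h, zero_smul, sub_zero, mul_zero, add_zero]
      exact g.posdef x v hv
    · exact add_pos_of_nonneg_of_pos (hnn _) (mul_self_pos.2 h)
  smooth' V W hV hW :=
    (g.smooth' (V - (fun x => η.val x (V x)) • X) (W - (fun x => η.val x (W x)) • X)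
      (hV.sub (SmoothVF.smul (η.smooth' V hV) hX)) (hW.sub (SmoothVF.smul (η.smooth' W hW) hX))).add
      ((η.smooth' V hV).mul (η.smooth' W hW))

lemma RMetric.adapt_apply (g : RMetric I M) (η : OneForm I M) {X : VF I M} (hX : SmoothVF I X)
    (x : M) (u v : TangentSpace I x) :
    (g.adapt η hX).val x u v
      = g.val x (u - η.val x u • X x) (v - η.val x v • X x) + η.val x u * η.val x v := rfl

/-- An alternating form on a plane which is nonzero on a pair of vectors expresses every vector in
terms of the pair. -/
lemma smul_eq_of_alternating {V : Type*} [AddCommGroup V] [Module ℝ V] {P : Submodule ℝ V}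
    (hP : finrank ℝ P = 2) {B : V →ₗ[ℝ] V →ₗ[ℝ] ℝ} (hB : ∀ u v, B u v = - B v u) {u₁ u₂ v : V}
    (h₁ : u₁ ∈ P) (h₂ : u₂ ∈ P) (h : B u₁ u₂ ≠ 0) (hv : v ∈ P) :
    B u₁ u₂ • v = B v u₂ • u₁ + B u₁ v • u₂ := by
  have hself : ∀ u, B u u = 0 := fun u => by linarith [hB u u]
  have hfin : FiniteDimensional ℝ P := FiniteDimensional.of_finrank_pos (by omega)
  have hli : LinearIndependent ℝ ![(⟨u₁, h₁⟩ : P), ⟨u₂, h₂⟩] := by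
    rw [LinearIndependent.pair_iff]
    intro s t hst
    have h0 : s • u₁ + t • u₂ = 0 := congrArg Subtype.val hst
    have e1 : B (s • u₁ + t • u₂) u₂ = 0 := by rw [h0, map_zero, LinearMap.zero_apply]
    have e2 : B u₁ (s • u₁ + t • u₂) = 0 := by rw [h0, map_zero]
    simp only [map_add, map_smul, LinearMap.add_apply, LinearMap.smul_apply, hself, smul_eq_mul,
      mul_zero, add_zero, zero_add] at e1 e2
    exact ⟨(mul_eq_zero.1 e1).resolve_right h, (mul_eq_zero.1 e2).resolve_right h⟩
  have hspan := hli.span_eq_top_of_card_eq_finrank' (by simp [hP])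
  have hmem : (⟨v, hv⟩ : P) ∈ Submodule.span ℝ (range ![(⟨u₁, h₁⟩ : P), ⟨u₂, h₂⟩]) := by
    rw [hspan]; trivial
  rw [Matrix.range_cons, Matrix.range_cons, Matrix.range_empty, union_empty, singleton_union,
    Submodule.mem_span_pair] at hmem
  obtain ⟨a, b, hab⟩ := hmem
  obtain rfl : a • u₁ + b • u₂ = v := congrArg Subtype.val hab
  simp only [map_add, map_smul, LinearMap.add_apply, LinearMap.smul_apply, hself, smul_eq_mul,
    mul_zero, add_zero, zero_add, smul_add, smul_smul]
  rw [mul_comm a, mul_comm b]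

variable [I.Boundaryless] [FiniteDimensional ℝ E] {D : TangentDist I M} {α β : OneForm I M}

/-- The splitting of the tangent bundle defined by dual vector fields lets vectors in `D` extend to
sections of `D`. -/
lemma EngelDefiningForms.exists_section (hM : HasSpanningVF I M)
    (hforms : EngelDefiningForms I D α β) {T X : VF I M} (hT : SmoothVF I T) (hX : SmoothVF I X)
    (hαT : ∀ x, α.val x (T x) = 0) (hβT : ∀ x, β.val x (T x) = 1)
    (hαX : ∀ x, α.val x (X x) = 1) (hβX : ∀ x, β.val x (X x) = 0) {x : M}
    {v : TangentSpace I x} (hv : v ∈ D x) : ∃ V, IsSection I D V ∧ V x = v := by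
  obtain ⟨V, hV, rfl⟩ := hM x v
  refine ⟨V - (fun x => α.val x (V x)) • X - (fun x => β.val x (V x)) • T,
    ⟨(hV.sub (SmoothVF.smul (α.smooth' V hV) hX)).sub (SmoothVF.smul (β.smooth' V hV) hT), fun y => ?_⟩, ?_⟩
  · rw [hforms.1]
    show _ ∧ _
    constructor
    · show α.val y (V y - α.val y (V y) • X y - β.val y (V y) • T y) = 0
      rw [map_sub, map_sub, map_smul, map_smul, hαX, hαT]; simp
    · show β.val y (V y - α.val y (V y) • X y - β.val y (V y) • T y) = 0
      rw [map_sub, map_sub, map_smul, map_smul, hβX, hβT]; simp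
  · rw [hforms.1] at hv
    have h1 : α.val x (V x) = 0 := hv.1
    have h2 : β.val x (V x) = 0 := hv.2
    show V x - α.val x (V x) • X x - β.val x (V x) • T x = V x
    rw [h1, h2, zero_smul, zero_smul, sub_zero, sub_zero]

lemma IsEngel.exists_lie_beta_ne_zero (hD : IsEngel I D) (hforms : EngelDefiningForms I D α β)
    (x : M) : ∃ V W, IsSection I D V ∧ IsSection I D W ∧ β.val x (vfLie I V W x) ≠ 0 := by
  by_contra! hcon
  have hle : derivedDist I D x ≤ D x := by
    refine Submodule.span_le.2 ?_
    rintro v (⟨V, hV, rfl⟩ | ⟨V, W, hV, hW, rfl⟩)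
    · exact hV.2 x
    · rw [hforms.1]
      refine ⟨?_, hcon V W hV hW⟩
      rw [← hforms.2]
      exact Submodule.subset_span (Or.inr ⟨V, W, hV, hW, rfl⟩)
  have hfin : FiniteDimensional ℝ (TangentSpace I x) := ‹FiniteDimensional ℝ E›
  have := Submodule.finrank_mono hle
  rw [hD.1, hD.2.1] at this
  omega

/-- A section of `D` correcting a given vector field to one whose contraction with `dβ` vanishes
on `D`. -/
lemma IsEngel.exists_correction (hM : HasSpanningVF I M) (hD : IsEngel I D)
    (hforms : EngelDefiningForms I D α β) {T : VF I M} (hT : SmoothVF I T)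
    (hβT : ∀ x, β.val x (T x) = 1) :
    ∃ U, IsSection I D U ∧ ∀ x, ∀ v ∈ D x, β.dAt x (T x + U x) v = 0 := by
  choose U₁ U₂ h₁ h₂ hne using hD.exists_lie_beta_ne_zero hforms
  have hβ : ∀ {V}, IsSection I D V → ∀ x, β.val x (V x) = 0 := fun hV x => by
    have := hV.2 x
    rw [hforms.1] at this
    exact this.2
  have hB : ∀ {V W}, IsSection I D V → IsSection I D W → ∀ x,
      β.dAt x (V x) (W x) = - β.val x (vfLie I V W x) := fun hV hW x => by
    rw [← β.d_eq_dAt hM hV.1 hW.1, OneForm.d_of_const (hβ hV) (hβ hW)]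
  have hBT : ∀ {V}, IsSection I D V → ∀ x,
      β.dAt x (T x) (V x) = - β.val x (vfLie I T V x) := fun hV x => by
    rw [← β.d_eq_dAt hM hT hV.1, OneForm.d_of_const hβT (hβ hV)]
  have hBs : ∀ {V W}, IsSection I D V → IsSection I D W →
      SmoothFn I fun x => β.dAt x (V x) (W x) := fun {V W} hV hW => by
    rw [funext (hB hV hW)]
    exact ContMDiff.neg (β.smooth' _ (hV.1.vfLie hW.1))
  have hBTs : ∀ {V}, IsSection I D V → SmoothFn I fun x => β.dAt x (T x) (V x) :=
    fun {V} hV => by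
      rw [funext (hBT hV)]
      exact ContMDiff.neg (β.smooth' _ (hT.vfLie hV.1))
  let p : M → M → ℝ := fun z x => - β.dAt x (T x) (U₂ z x) * (β.dAt x (U₁ z x) (U₂ z x))⁻¹
  let q : M → M → ℝ := fun z x => β.dAt x (T x) (U₁ z x) * (β.dAt x (U₁ z x) (U₂ z x))⁻¹
  let L : M → VF I M := fun z => p z • U₁ z + q z • U₂ z
  have hLD : ∀ z x, L z x ∈ D x := fun z x =>
    add_mem (Submodule.smul_mem _ _ ((h₁ z).2 x)) (Submodule.smul_mem _ _ ((h₂ z).2 x))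
  have hL : ∀ z x, β.dAt x (U₁ z x) (U₂ z x) ≠ 0 → ∀ v ∈ D x, β.dAt x (T x + L z x) v = 0 := by
    intro z x h0 v hv
    have h3 := smul_eq_of_alternating (hD.1 x) (β.dAt_swap x) ((h₁ z).2 x) ((h₂ z).2 x) h0 hv
    have h4 : β.dAt x (T x + L z x) (β.dAt x (U₁ z x) (U₂ z x) • v) = 0 := by
      have hs : ∀ u, β.dAt x u u = 0 := fun u => by linarith [β.dAt_swap x u u]
      have e1 : β.dAt x (T x + L z x) (U₁ z x) = 0 := by
        show β.dAt x (T x + (p z x • U₁ z x + q z x • U₂ z x)) (U₁ z x) = 0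
        simp only [map_add, map_smul, LinearMap.add_apply, LinearMap.smul_apply, smul_eq_mul, hs,
          β.dAt_swap x (U₂ z x) (U₁ z x), q]
        field_simp
        ring
      have e2 : β.dAt x (T x + L z x) (U₂ z x) = 0 := by
        show β.dAt x (T x + (p z x • U₁ z x + q z x • U₂ z x)) (U₂ z x) = 0
        simp only [map_add, map_smul, LinearMap.add_apply, LinearMap.smul_apply, smul_eq_mul, hs, p]
        field_simp
        ring
      rw [h3, map_add, map_smul, map_smul, e1, e2, smul_zero, smul_zero, add_zero]
    rw [map_smul, smul_eq_mul] at h4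
    exact (mul_eq_zero.1 h4).resolve_left h0
  have hne' : ∀ z, β.dAt z (U₁ z z) (U₂ z z) ≠ 0 := fun z => by
    rw [hB (h₁ z) (h₂ z)]
    exact neg_ne_zero.2 (hne z)
  have huniq : ∀ x, ∀ u ∈ D x, (∀ v ∈ D x, β.dAt x u v = 0) → u = 0 := by
    intro x u hu h0
    have h3 := smul_eq_of_alternating (hD.1 x) (β.dAt_swap x) ((h₁ x).2 x) ((h₂ x).2 x) (hne' x) hu
    rw [β.dAt_swap x _ u, h0 _ ((h₁ x).2 x), h0 _ ((h₂ x).2 x), neg_zero, zero_smul, zero_smul,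
      add_zero] at h3
    exact (smul_eq_zero.1 h3).resolve_left (hne' x)
  refine ⟨fun x => L x x, ⟨fun z => ?_, fun x => hLD x x⟩, fun x => hL x x (hne' x)⟩
  have hev : ∀ᶠ x in 𝓝 z, β.dAt x (U₁ z x) (U₂ z x) ≠ 0 :=
    (hBs (h₁ z) (h₂ z)).continuous.continuousAt.eventually_ne (hne' z)
  have heq : (fun x => (⟨x, L x x⟩ : TangentBundle I M)) =ᶠ[𝓝 z] fun x => ⟨x, L z x⟩ := by
    filter_upwards [hev] with x hx
    have h5 : L x x - L z x = 0 := huniq x _ (sub_mem (hLD x x) (hLD z x)) fun v hv => by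
      have e1 := hL x x (hne' x) v hv
      have e2 := hL z x hx v hv
      rw [map_add, LinearMap.add_apply] at e1 e2
      rw [map_sub, LinearMap.sub_apply]
      linarith
    rw [sub_eq_zero.1 h5]
  refine ContMDiffAt.congr_of_eventuallyEq ?_ heq
  have := isManifold_add_one I M
  have hinv : ContMDiffAt I 𝓘(ℝ) (⊤ : ℕ∞) (fun x => (β.dAt x (U₁ z x) (U₂ z x))⁻¹) z :=
    (contDiffAt_inv ℝ (hne' z)).contMDiffAt.comp z (hBs (h₁ z) (h₂ z) z)
  have hp : ContMDiffAt I 𝓘(ℝ) (⊤ : ℕ∞) (p z) z := (hBTs (h₂ z) z).neg.mul hinv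
  have hq : ContMDiffAt I 𝓘(ℝ) (⊤ : ℕ∞) (q z) z := (hBTs (h₁ z) z).mul hinv
  exact ContMDiffAt.add_section (ContMDiffAt.smul_section hp ((h₁ z).1 z))
    (ContMDiffAt.smul_section hq ((h₂ z).1 z))

/-- An Engel vector field dual to Engel defining forms is the Reeb field `R` of a Reeb pair. -/
lemma EngelDefiningForms.exists_reebPair (hM : HasSpanningVF I M) (hD : IsEngel I D)
    (hforms : EngelDefiningForms I D α β) {T X : VF I M} (hT : SmoothVF I T)
    (hX : IsEngelVF I D X)
    (hαT : ∀ x, α.val x (T x) = 0) (hβT : ∀ x, β.val x (T x) = 1)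
    (hαX : ∀ x, α.val x (X x) = 1) (hβX : ∀ x, β.val x (X x) = 0) :
    ∃ T', IsReebPair I α β T' X := by
  obtain ⟨U, hU, hUT⟩ := hD.exists_correction hM hforms hT hβT
  have hDmem : ∀ {x} {v : TangentSpace I x}, v ∈ D x → α.val x v = 0 ∧ β.val x v = 0 :=
    fun {x v} hv => by
      rw [hforms.1] at hv
      exact hv
  have hT' : SmoothVF I (T + U) := hT.add hU.1
  have hαT' : ∀ x, α.val x ((T + U) x) = 0 := fun x => by
    show α.val x (T x + U x) = 0
    rw [map_add, hαT, (hDmem (hU.2 x)).1, add_zero]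
  have hβT' : ∀ x, β.val x ((T + U) x) = 1 := fun x => by
    show β.val x (T x + U x) = 1
    rw [map_add, hβT, (hDmem (hU.2 x)).2, add_zero]
  have hs : ∀ x u, β.dAt x u u = 0 := fun x u => by linarith [β.dAt_swap x u u]
  have hdec : ∀ x (v : TangentSpace I x),
      v - α.val x v • X x - β.val x v • (T + U) x ∈ D x := fun x v => by
    rw [hforms.1]
    constructor
    · show α.val x (v - α.val x v • X x - β.val x v • (T + U) x) = 0
      rw [map_sub, map_sub, map_smul, map_smul, hαX, hαT']; simp
    · show β.val x (v - α.val x v • X x - β.val x v • (T + U) x) = 0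
      rw [map_sub, map_sub, map_smul, map_smul, hβX, hβT']; simp
  have hdT : ∀ x (v : TangentSpace I x),
      β.dAt x ((T + U) x) v = α.val x v * β.dAt x ((T + U) x) (X x) := fun x v => by
    have h1 : β.dAt x ((T + U) x) _ = 0 := hUT x _ (hdec x v)
    rw [map_sub, map_sub, map_smul, map_smul, hs, smul_eq_mul, smul_eq_mul] at h1
    linarith
  have hXD : ∀ x, ∀ v ∈ D x, β.dAt x (X x) v = 0 := fun x v hv => by
    obtain ⟨V, hV, rfl⟩ := hforms.exists_section hM hT hX.1 hαT hβT hαX hβX hv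
    rw [← β.d_eq_dAt hM hX.1 hV.1, OneForm.d_of_const hβX fun y => (hDmem (hV.2 y)).2,
      (hDmem (hX.2 V hV x)).2, neg_zero]
  have hdX : ∀ x (v : TangentSpace I x),
      β.dAt x (X x) v = β.val x v * β.dAt x (X x) ((T + U) x) := fun x v => by
    have h1 := hXD x _ (hdec x v)
    rw [map_sub, map_sub, map_smul, map_smul, hs, smul_eq_mul, smul_eq_mul] at h1
    linarith
  refine ⟨T + U, hT', hX.1, hαT', hβT', hαX, hβX, fun V W hV hW x => ?_, fun V W hV hW x => ?_⟩
  · rw [wedge1_2, hαT', β.d_eq_dAt hM hT' hV, β.d_eq_dAt hM hT' hW, hdT x (V x), hdT x (W x)]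
    ring
  · rw [wedge1_2, hβX, β.d_eq_dAt hM hX.1 hV, β.d_eq_dAt hM hX.1 hW, hdX x (V x), hdX x (W x)]
    ring

/-- An Engel and Killing vector field preserving `α` and positively transverse to `ker α` is the
Reeb field of a K-Engel structure with the same underlying Engel structure. -/
theorem IsKEngel.exists_of_transverse (hM : HasSpanningVF I M) {g : RMetric I M} {R T X : VF I M}
    (hK : IsKEngel I D g R) (hforms : EngelDefiningForms I D α β) (hTR : IsReebPair I α β T R)
    (hlie : ∀ V, SmoothVF I V → ∀ x, lieOneForm I α X V x = 0) (hX : IsEngelVF I D X)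
    (hkill : IsKilling I g X) (hpos : ∀ x, 0 < α.val x (X x)) :
    ∃ (g' : RMetric I M) (α' β' : OneForm I M), EngelDefiningForms I D α' β' ∧
      (∃ T', IsReebPair I α' β' T' X) ∧ IsKEngel I D g' X := by
  have hne : ∀ x, α.val x (X x) ≠ 0 := fun x => (hpos x).ne'
  have hXs := hX.1
  have hu : SmoothFn I fun x => α.val x (X x) := α.smooth' X hXs
  let α' : OneForm I M := α.smulFn (hu.inv hne)
  let β' : OneForm I M := β.subForm (α.smulFn ((β.smooth' X hXs).mul (hu.inv hne)))
  have hα' : ∀ x v, α'.val x v = (α.val x (X x))⁻¹ * α.val x v := fun _ _ => rfl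
  have hβ' : ∀ x v, β'.val x v
      = β.val x v - β.val x (X x) * (α.val x (X x))⁻¹ * α.val x v := fun _ _ => rfl
  have hαX : ∀ x, α'.val x (X x) = 1 := fun x => by rw [hα', inv_mul_cancel₀ (hne x)]
  have hβX : ∀ x, β'.val x (X x) = 0 := fun x => by
    rw [hβ', mul_assoc, inv_mul_cancel₀ (hne x), mul_one, sub_self]
  have hker : ∀ x, LinearMap.ker (α'.val x) = LinearMap.ker (α.val x) := fun x => by
    ext v
    rw [LinearMap.mem_ker, LinearMap.mem_ker, hα', mul_eq_zero, or_iff_right (inv_ne_zero (hne x))]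
  have hforms' : EngelDefiningForms I D α' β' := by
    refine ⟨fun x => ?_, fun x => by rw [hker, hforms.2]⟩
    rw [hforms.1, hker]
    ext v
    simp only [Submodule.mem_inf, LinearMap.mem_ker]
    refine and_congr_right fun h => ?_
    rw [hβ', h, mul_zero, sub_zero]
  have hXu : ∀ x, vderiv I X (fun y => α.val y (X y)) x = 0 := fun x => by
    have := hlie X hXs x
    rwa [lieOneForm, vfLie_self, map_zero, sub_zero] at this
  have hlie' : ∀ V, SmoothVF I V → ∀ x,
      vderiv I X (fun y => α'.val y (V y)) x = α'.val x (vfLie I X V x) := fun V hV x => by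
    have h1 := vderiv_mul hu (α'.smooth' V hV) X x
    have h2 : (fun y => α.val y (X y) * α'.val y (V y)) = fun y => α.val y (V y) := by
      funext y
      rw [hα', mul_inv_cancel_left₀ (hne y)]
    have h3 := hlie V hV x
    rw [lieOneForm, sub_eq_zero] at h3
    rw [h2, hXu, mul_zero, add_zero, h3] at h1
    rw [hα', h1, inv_mul_cancel_left₀ (hne x)]
  have hT1 : ∀ x, α'.val x (T x) = 0 := fun x => by rw [hα', hTR.alphaT, mul_zero]
  have hT2 : ∀ x, β'.val x (T x) = 1 := fun x => by
    rw [hβ', hTR.alphaT, hTR.betaT, mul_zero, sub_zero]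
  refine ⟨g.adapt α' hXs, α', β', hforms',
    hforms'.exists_reebPair hM hK.engel hTR.smoothT hX hT1 hT2 hαX hβX,
    hK.engel, hX, fun V W hV hW x => ?_, fun x v hv => ?_, fun x h0 => ?_⟩
  · let Q : VF I M → VF I M := fun V => V + (fun y => -α'.val y (V y)) • X
    have hQ : ∀ {V}, SmoothVF I V → SmoothVF I (Q V) := fun {V} hV =>
      hV.add (SmoothVF.smul (ContMDiff.neg (α'.smooth' V hV)) hXs)
    have hQa : ∀ V y, Q V y = V y - α'.val y (V y) • X y := fun V y => by
      show V y + (-α'.val y (V y)) • X y = _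
      rw [neg_smul, sub_eq_add_neg]
    have hQl : ∀ {V}, SmoothVF I V → vfLie I X (Q V) x
        = vfLie I X V x - α'.val x (vfLie I X V x) • X x := fun {V} hV => by
      have hn : SmoothFn I fun y => -α'.val y (V y) := ContMDiff.neg (α'.smooth' V hV)
      have h0 : vderiv I X (fun y => -α'.val y (V y)) x = - α'.val x (vfLie I X V x) := by
        have h1 := vderiv_add hn (α'.smooth' V hV) X x
        rw [vderiv_of_forall_eq (c := 0) fun y => by ring, hlie' V hV] at h1
        linarith
      rw [vfLie_add_right X hV (SmoothVF.smul hn hXs), vfLie_smul_right X hn hXs, vfLie_self, h0,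
        smul_zero, add_zero, neg_smul, sub_eq_add_neg]
    have h1 : (fun y => (g.adapt α' hXs).val y (V y) (W y))
        = fun y => g.val y (Q V y) (Q W y) + α'.val y (V y) * α'.val y (W y) := by
      funext y
      rw [RMetric.adapt_apply, hQa, hQa]
    rw [h1, vderiv_add (g.smooth' _ _ (hQ hV) (hQ hW))
      ((α'.smooth' V hV).mul (α'.smooth' W hW)), vderiv_mul (α'.smooth' V hV) (α'.smooth' W hW),
      hkill _ _ (hQ hV) (hQ hW), hQl hV, hQl hW, hlie' V hV, hlie' W hW, RMetric.adapt_apply,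
      RMetric.adapt_apply, hQa, hQa]
    ring
  · rw [hforms'.2] at hv
    rw [RMetric.adapt_apply, hαX, one_smul, sub_self, map_zero, LinearMap.zero_apply, zero_add,
      one_mul]
    exact hv
  · have := hαX x
    rw [h0, map_zero] at this
    exact zero_ne_one this

end NewReebFields

section RationalFrames

/-- Every vector is approximated by a basis consisting of rational vectors. -/
lemma exists_rat_linearIndependent {k : ℕ} (θ₀ : Fin k → ℝ) {ε : ℝ} (hε : 0 < ε) :
    ∃ r : Fin k → Fin k → ℚ, (∀ i j, |(r i j : ℝ) - θ₀ j| < ε) ∧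
      LinearIndependent ℝ fun i j => (r i j : ℝ) := by
  have hq : ∀ j, ∃ q : ℚ, |(q : ℝ) - θ₀ j| < ε / 2 := fun j => by
    obtain ⟨q, h1, h2⟩ := exists_rat_btwn (show θ₀ j - ε / 2 < θ₀ j by linarith)
    exact ⟨q, by rw [abs_lt]; constructor <;> linarith⟩
  choose q hq using hq
  obtain ⟨δ, hδ0, hδε, hδ⟩ : ∃ δ : ℚ, 0 < δ ∧ (δ : ℝ) < ε / 2 ∧ ∑ j, q j + δ ≠ 0 := by
    obtain ⟨δ, h1, h2⟩ := exists_rat_btwn (show (0 : ℝ) < ε / 2 by linarith)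
    have h1' : 0 < δ := by exact_mod_cast h1
    by_cases h : ∑ j, q j + δ = 0
    · refine ⟨δ / 2, by linarith, by push_cast; linarith, fun h' => ?_⟩
      linarith
    · exact ⟨δ, h1', h2, h⟩
  refine ⟨fun i j => q j + if i = j then δ else 0, fun i j => ?_, ?_⟩
  · have h1 := hq j
    have h2 : (0 : ℝ) < δ := by exact_mod_cast hδ0
    rw [abs_lt] at h1 ⊢
    dsimp only
    split_ifs <;> push_cast <;> constructor <;> linarith
  · rw [Fintype.linearIndependent_iff]
    intro c hc
    have h1 : ∀ j, (∑ i, c i) * q j + c j * δ = 0 := fun j => by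
      have h := congrFun hc j
      simp only [Finset.sum_apply, Pi.smul_apply, smul_eq_mul, Rat.cast_add, mul_add,
        Finset.sum_add_distrib, Pi.zero_apply] at h
      have h' : ∑ i, c i * ((if i = j then δ else 0 : ℚ) : ℝ) = c j * δ := by
        rw [Finset.sum_eq_single j (fun i _ hi => by simp [hi]) (by simp), if_pos rfl]
      rwa [← Finset.sum_mul, h'] at h
    have h2 : (∑ i, c i) * ((∑ j, q j + δ : ℚ) : ℝ) = 0 := by
      push_cast
      rw [mul_add, Finset.mul_sum, Finset.sum_mul, ← Finset.sum_add_distrib]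
      exact Finset.sum_eq_zero fun j _ => h1 j
    have h3 := (mul_eq_zero.1 h2).resolve_right (by exact_mod_cast hδ)
    intro i
    have h4 := h1 i
    rw [h3, zero_mul, zero_add] at h4
    exact (mul_eq_zero.1 h4).resolve_right (by exact_mod_cast hδ0.ne')

/-- One-parameter subgroups of the torus with rational velocity are periodic. -/
lemma exists_torusExp_ratCast_eq_one {k : ℕ} (r : Fin k → ℚ) :
    ∃ τ : ℝ, 0 < τ ∧ torusExp (fun i => (r i : ℝ)) τ = 1 := by
  have hN : ∀ i, ∃ m : ℤ, ((∏ j, (r j).den : ℕ) : ℝ) * (r i : ℝ) = m := fun i => by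
    obtain ⟨c, hc⟩ := Finset.dvd_prod_of_mem (fun j => (r j).den) (Finset.mem_univ i)
    refine ⟨c * (r i).num, ?_⟩
    have h1 : (((r i).den : ℝ)) * (r i : ℝ) = (r i).num := by exact_mod_cast (r i).den_mul_eq_num
    rw [hc]
    push_cast
    rw [← h1]
    ring
  choose m hm using hN
  refine ⟨_, ?_, torusExp_intCast hm⟩
  have : 0 < ∏ j, (r j).den := Finset.prod_pos fun j _ => (r j).den_pos
  have h2 : (0 : ℝ) < ((∏ j, (r j).den : ℕ) : ℝ) := by exact_mod_cast this
  have := Real.pi_pos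
  positivity

end RationalFrames

section Positivity

/-- A linear family of vector fields on a compact manifold on which a `1`-form takes the value one
at some parameter stays positive on it near that parameter. -/
lemma exists_form_pos_near [CompactSpace M] {k : ℕ} (α : OneForm I M)
    {X : (Fin k → ℝ) →ₗ[ℝ] VF I M} (hX : ∀ θ, SmoothVF I (X θ)) {θ₀ : Fin k → ℝ}
    (h₀ : ∀ x, α.val x (X θ₀ x) = 1) :
    ∃ ε : ℝ, 0 < ε ∧ ∀ θ, (∀ j, |θ j - θ₀ j| < ε) → ∀ x, 0 < α.val x (X θ x) := by
  let e : Fin k → Fin k → ℝ := fun j => Pi.single j 1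
  have hcont : Continuous fun x => ∑ j, |α.val x (X (e j) x)| :=
    continuous_finsetSum _ fun j _ => (ContMDiff.continuous (α.smooth' _ (hX (e j)))).abs
  obtain ⟨C, hC⟩ := isCompact_univ.exists_bound_of_continuousOn hcont.continuousOn
  have hC' : ∀ x, ∑ j, |α.val x (X (e j) x)| ≤ |C| := fun x =>
    (le_abs_self _).trans ((hC x (mem_univ x)).trans (le_abs_self C))
  have hpos : 0 < |C| + 1 := by positivity
  refine ⟨1 / (|C| + 1), by positivity, fun θ hθ x => ?_⟩
  have h1 : X θ = X θ₀ + ∑ j, (θ j - θ₀ j) • X (e j) := by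
    have h2 : θ = θ₀ + ∑ j, (θ j - θ₀ j) • e j := by
      funext i
      simp [e, Finset.sum_apply, Pi.single_apply]
    conv_lhs => rw [h2]
    rw [map_add, map_sum]
    simp only [map_smul]
  have h3 : α.val x (X θ x) = 1 + ∑ j, (θ j - θ₀ j) * α.val x (X (e j) x) := by
    rw [h1, Pi.add_apply, map_add, h₀, Finset.sum_apply, map_sum]
    simp only [Pi.smul_apply, map_smul, smul_eq_mul]
  have h4 : |∑ j, (θ j - θ₀ j) * α.val x (X (e j) x)| ≤ 1 / (|C| + 1) * |C| := by
    refine (Finset.abs_sum_le_sum_abs _ _).trans ?_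
    refine le_trans (Finset.sum_le_sum fun j _ => ?_) (le_trans
      (Finset.mul_sum _ _ (1 / (|C| + 1))).ge (mul_le_mul_of_nonneg_left (hC' x) (by positivity)))
    rw [abs_mul]
    exact mul_le_mul_of_nonneg_right (hθ j).le (abs_nonneg _)
  have h5 : 1 / (|C| + 1) * |C| < 1 := by
    rw [one_div, inv_mul_lt_iff₀ hpos]
    linarith
  rw [h3]
  linarith [(abs_le.1 h4).1]

end Positivity

/-- Let `(M, D = ker α∧β, g, R)` be a K-Engel structure of rank `k` on a
closed manifold.  Then there exist rank-one K-Engel structures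
`(M, D = ker αᵢ∧βᵢ, gᵢ, Rᵢ)`, `i = 1, …, k`, inducing the same Engel structure `D`, such
that `R₁, …, R_k` are linearly independent. -/
theorem kengel_rank_one_perturbations {M : Type*} [TopologicalSpace M]
    [ChartedSpace (EuclideanSpace ℝ (Fin 4)) M] [IsManifold (𝓡 4) (⊤ : ℕ∞) M]
    [CompactSpace M]
    (D : TangentDist (𝓡 4) M) (g : RMetric (𝓡 4) M) (R : VF (𝓡 4) M)
    (hK : IsKEngel (𝓡 4) D g R)
    (α β : OneForm (𝓡 4) M) (hforms : EngelDefiningForms (𝓡 4) D α β)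
    (T : VF (𝓡 4) M) (hTR : IsReebPair (𝓡 4) α β T R)
    (φ : ℝ → M → M) (hφ : IsFlowOf (𝓡 4) R φ)
    -- the K-Engel structure has rank `k` : the closure of the flow of `R` in the isometry
    -- group of `(M, g)` is a torus `T^k` acting freely with orbits the `R`-orbit closures
    (k : ℕ) (P : PrincipalTorusBundle k (4 - k) M)
    (hPflow : ∀ t : ℝ, ∃ a : Torus k, ∀ x, φ t x = P.act a x)
    (hPiso : ∀ (a : Torus k) (x : M) (v w : TangentSpace (𝓡 4) x),
      g.val (P.act a x) (mfderiv (𝓡 4) (𝓡 4) (P.act a) x v)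
          (mfderiv (𝓡 4) (𝓡 4) (P.act a) x w)
        = g.val x v w)
    (hPorb : ∀ x, {y | ∃ a : Torus k, P.act a x = y}
      = closure (Set.range fun t : ℝ => φ t x)) :
    ∃ (Rv : Fin k → VF (𝓡 4) M) (gv : Fin k → RMetric (𝓡 4) M)
      (αv βv : Fin k → OneForm (𝓡 4) M),
      (∀ i, EngelDefiningForms (𝓡 4) D (αv i) (βv i)) ∧
      (∀ i, ∃ Ti, IsReebPair (𝓡 4) (αv i) (βv i) Ti (Rv i)) ∧
      (∀ i, IsKEngel (𝓡 4) D (gv i) (Rv i)) ∧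
      -- each of the new K-Engel structures has rank 1: `Rᵢ` is totally periodic
      (∀ i, ∃ φi : ℝ → M → M, IsFlowOf (𝓡 4) (Rv i) φi ∧
        ∃ τ : ℝ, 0 < τ ∧ ∀ x, φi τ x = x) ∧
      -- `R₁, …, R_k` are linearly independent
      (∀ x, LinearIndependent ℝ fun i : Fin k => Rv i x) := by
  rcases isEmpty_or_nonempty M with hemp | hne
  · exact ⟨fun _ => R, fun _ => g, fun _ => α, fun _ => β, fun _ => hforms, fun _ => ⟨T, hTR⟩,
      fun _ => hK, fun _ => ⟨φ, hφ, 1, one_pos, fun x => isEmptyElim x⟩, fun x => isEmptyElim x⟩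
  have hM := hK.engel.hasSpanningVF
  have hact : IsometricAction g P.act := ⟨P.continuous_act, P.act_one, P.act_mul, hPiso⟩
  obtain ⟨θ₀, hθ₀, hdense⟩ := P.exists_torusExp hφ.1 hφ.2.2.1 hPflow hPorb
  obtain ⟨X, hX, hXinj⟩ := hact.exists_generators hM
  obtain rfl : φ = fun t => P.act (torusExp θ₀ t) := funext fun t => funext (hθ₀ t)
  obtain rfl : R = X θ₀ := hφ.unique (hX θ₀).flow
  obtain ⟨ε, hε, hpos⟩ := exists_form_pos_near α (fun θ => (hX θ).smooth) hTR.alphaR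
  obtain ⟨r, hr, hli⟩ := exists_rat_linearIndependent θ₀ hε
  have hsym : ∀ i, _ := fun i : Fin k =>
    hK.torus_generator hM hforms hTR hact (hX θ₀) hdense (hX fun j => (r i j : ℝ))
  choose gv αv βv hf hT hKv using fun i => hK.exists_of_transverse hM hforms hTR (hsym i).1
    (hsym i).2.1 (hsym i).2.2 (hpos _ (hr i))
  refine ⟨fun i => X fun j => (r i j : ℝ), gv, αv, βv, hf, hT, hKv, fun i => ?_, fun x => ?_⟩
  · obtain ⟨τ, hτ, h1⟩ := exists_torusExp_ratCast_eq_one (r i)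
    exact ⟨_, (hX _).flow, τ, hτ, fun x => by rw [h1, P.act_one]⟩
  · let L : (Fin k → ℝ) →ₗ[ℝ] TangentSpace (𝓡 4) x := (LinearMap.proj x).comp X
    exact hli.map' L (LinearMap.ker_eq_bot'.2 fun θ h => hXinj P.free x θ h)

end
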